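/- arXiv:0908.2604 — 2 statements merged into one kernel-verified Lean document; each statement's English description precedes it below -/
import Mathlib

section
/- Assume that μ is an isomorphism. Let M' denote the unique maximal proper T-submodule of M and let L denote the quotient T-module M/M'. Then the sequence (a; {e_i}_{i=0}^d; a*; {e*_i}_{i=0}^d) acts on L as a sharp tridiagonal system with eigenvalue sequence {θ_i}_{i=0}^d, dual eigenvalue sequence {θ*_i}_{i=0}^d, and split sequence {ζ_i}_{i=0}^d; that is, as a sharp tridiagonal system with parameter array ({θ_i}_{i=0}^d; {θ*_i}_{i=0}^d; {ζ_i}_{i=0}^d). -/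
open Polynomial

noncomputable section

/-- The polynomial `τ_i = (λ−θ_0)(λ−θ_1)⋯(λ−θ_{i−1})`. -/
def tauPoly {F : Type*} [Field F] (θ : ℕ → F) (i : ℕ) : Polynomial F :=
  ∏ j ∈ Finset.range i, (X - C (θ j))

/-- The polynomial `η_i = (λ−θ_d)(λ−θ_{d−1})⋯(λ−θ_{d−i+1})`. -/
def etaPoly {F : Type*} [Field F] (d : ℕ) (θ : ℕ → F) (i : ℕ) : Polynomial F :=
  ∏ j ∈ Finset.range i, (X - C (θ (d - j)))

/-- Generators of the algebra `T`: `a`, `a*`, `e_0,…,e_d`, `e*_0,…,e*_d`. -/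
inductive TGen (d : ℕ) : Type
  | a : TGen d
  | astar : TGen d
  | e : Fin (d + 1) → TGen d
  | estar : Fin (d + 1) → TGen d

/-- The defining relations of the algebra `T`. -/
inductive TRel (F : Type*) [Field F] (d : ℕ) (θ θs : ℕ → F) :
    FreeAlgebra F (TGen d) → FreeAlgebra F (TGen d) → Prop
  | ee (i j : Fin (d + 1)) :
      TRel F d θ θs (FreeAlgebra.ι F (TGen.e i) * FreeAlgebra.ι F (TGen.e j))
        (if i = j then FreeAlgebra.ι F (TGen.e i) else 0)
  | eses (i j : Fin (d + 1)) :
      TRel F d θ θs (FreeAlgebra.ι F (TGen.estar i) * FreeAlgebra.ι F (TGen.estar j))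
        (if i = j then FreeAlgebra.ι F (TGen.estar i) else 0)
  | sum_e : TRel F d θ θs (∑ i : Fin (d + 1), FreeAlgebra.ι F (TGen.e i)) 1
  | sum_estar : TRel F d θ θs (∑ i : Fin (d + 1), FreeAlgebra.ι F (TGen.estar i)) 1
  | a_eq : TRel F d θ θs (FreeAlgebra.ι F TGen.a)
      (∑ i : Fin (d + 1), θ (i : ℕ) • FreeAlgebra.ι F (TGen.e i))
  | astar_eq : TRel F d θ θs (FreeAlgebra.ι F TGen.astar)
      (∑ i : Fin (d + 1), θs (i : ℕ) • FreeAlgebra.ι F (TGen.estar i))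
  | trid (i j : Fin (d + 1)) (k : ℕ) (hk : k ≤ d)
      (h : k < max ((i : ℕ) - (j : ℕ)) ((j : ℕ) - (i : ℕ))) :
      TRel F d θ θs (FreeAlgebra.ι F (TGen.estar i) * FreeAlgebra.ι F TGen.a ^ k *
        FreeAlgebra.ι F (TGen.estar j)) 0
  | tridstar (i j : Fin (d + 1)) (k : ℕ) (hk : k ≤ d)
      (h : k < max ((i : ℕ) - (j : ℕ)) ((j : ℕ) - (i : ℕ))) :
      TRel F d θ θs (FreeAlgebra.ι F (TGen.e i) * FreeAlgebra.ι F TGen.astar ^ k *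
        FreeAlgebra.ι F (TGen.e j)) 0

/-- The `F`-algebra `T` presented by the above generators and relations. -/
abbrev TAlg (F : Type*) [Field F] (d : ℕ) (θ θs : ℕ → F) : Type _ :=
  RingQuot (TRel F d θ θs)

/-- The image in `T` of a generator. -/
def tgen (F : Type*) [Field F] (d : ℕ) (θ θs : ℕ → F) (g : TGen d) : TAlg F d θ θs :=
  RingQuot.mkAlgHom F (TRel F d θ θs) (FreeAlgebra.ι F g)

/-- The element `a` of `T`. -/
def aT (F : Type*) [Field F] (d : ℕ) (θ θs : ℕ → F) : TAlg F d θ θs :=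
  tgen F d θ θs TGen.a

/-- The element `a*` of `T`. -/
def asT (F : Type*) [Field F] (d : ℕ) (θ θs : ℕ → F) : TAlg F d θ θs :=
  tgen F d θ θs TGen.astar

/-- The element `e_i` of `T` (defined to be `0` for `i > d`). -/
def eT (F : Type*) [Field F] (d : ℕ) (θ θs : ℕ → F) (i : ℕ) : TAlg F d θ θs :=
  if h : i < d + 1 then tgen F d θ θs (TGen.e ⟨i, h⟩) else 0

/-- The element `e*_i` of `T` (defined to be `0` for `i > d`). -/
def esT (F : Type*) [Field F] (d : ℕ) (θ θs : ℕ → F) (i : ℕ) : TAlg F d θ θs :=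
  if h : i < d + 1 then tgen F d θ θs (TGen.estar ⟨i, h⟩) else 0

/-- Conditions (i) and (iii): the `θ_i` are mutually distinct, the `θ*_i` are mutually
distinct, and the expressions `(θ_{i-2}−θ_{i+1})/(θ_{i-1}−θ_i)`,
`(θ*_{i-2}−θ*_{i+1})/(θ*_{i-1}−θ*_i)` are equal and independent of `i` for `2 ≤ i ≤ d−1`. -/
def EigCond (F : Type*) [Field F] (d : ℕ) (θ θs : ℕ → F) : Prop :=
  (∀ i j, i ≤ d → j ≤ d → i ≠ j → θ i ≠ θ j) ∧
  (∀ i j, i ≤ d → j ≤ d → i ≠ j → θs i ≠ θs j) ∧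
  ∃ β : F, ∀ i, 2 ≤ i → i + 1 ≤ d →
    θ (i - 2) - θ (i + 1) = β * (θ (i - 1) - θ i) ∧
    θs (i - 2) - θs (i + 1) = β * (θs (i - 1) - θs i)

/-- The subalgebra `D` of `T` generated by `a`, as an `F`-subspace. -/
def Dsub (F : Type*) [Field F] (d : ℕ) (θ θs : ℕ → F) : Submodule F (TAlg F d θ θs) :=
  Subalgebra.toSubmodule (Algebra.adjoin F {aT F d θ θs})

/-- The subalgebra `D*` of `T` generated by `a*`, as an `F`-subspace. -/
def DsSub (F : Type*) [Field F] (d : ℕ) (θ θs : ℕ → F) : Submodule F (TAlg F d θ θs) :=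
  Subalgebra.toSubmodule (Algebra.adjoin F {asT F d θ θs})

end

noncomputable section

/-- A tridiagonal system on `V` of diameter `d`, with data `(A; {E_i}; A*; {E*_i})`,
eigenvalue sequence `θ` and dual eigenvalue sequence `θs`.  The families `E`, `Es` are the
orderings of the primitive idempotents of `A`, `A*` (so the `E_i V` are the eigenspaces of the
diagonalizable map `A`, ordered so that the tridiagonal conditions hold, and similarly for
`A*`), and the last condition is the irreducibility condition (iv). -/
def IsTDSystem (F : Type*) [Field F] (V : Type*) [AddCommGroup V] [Module F V]
    (d : ℕ) (A As : V →ₗ[F] V) (E Es : ℕ → (V →ₗ[F] V)) (θ θs : ℕ → F) : Prop :=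
  FiniteDimensional F V ∧ 0 < Module.finrank F V ∧
  (∀ i j, i ≤ d → j ≤ d → i ≠ j → θ i ≠ θ j) ∧
  (∀ i j, i ≤ d → j ≤ d → i ≠ j → θs i ≠ θs j) ∧
  (∀ i, i ≤ d → E i ≠ 0) ∧
  (∀ i, i ≤ d → Es i ≠ 0) ∧
  (∀ i j, i ≤ d → j ≤ d → E i ∘ₗ E j = if i = j then E i else 0) ∧
  (∀ i j, i ≤ d → j ≤ d → Es i ∘ₗ Es j = if i = j then Es i else 0) ∧
  (∑ i ∈ Finset.range (d + 1), E i) = LinearMap.id ∧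
  (∑ i ∈ Finset.range (d + 1), Es i) = LinearMap.id ∧
  A = ∑ i ∈ Finset.range (d + 1), θ i • E i ∧
  As = ∑ i ∈ Finset.range (d + 1), θs i • Es i ∧
  (∀ i, i ≤ d → Submodule.map As (LinearMap.range (E i)) ≤
    (if i = 0 then ⊥ else LinearMap.range (E (i - 1))) ⊔ LinearMap.range (E i) ⊔
      (if i = d then ⊥ else LinearMap.range (E (i + 1)))) ∧
  (∀ i, i ≤ d → Submodule.map A (LinearMap.range (Es i)) ≤
    (if i = 0 then ⊥ else LinearMap.range (Es (i - 1))) ⊔ LinearMap.range (Es i) ⊔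
      (if i = d then ⊥ else LinearMap.range (Es (i + 1)))) ∧
  (∀ W : Submodule F V, (∀ w ∈ W, A w ∈ W) → (∀ w ∈ W, As w ∈ W) → W = ⊥ ∨ W = ⊤)

/-- A sharp tridiagonal system with parameter array `(θ; θs; ζ)`:  a tridiagonal system
which is sharp (`dim E*_0 V = 1`) and whose split sequence is `ζ`, i.e.
`E*_0 τ_i(A) E*_0 = ζ_i E*_0 / ((θ*_0−θ*_1)⋯(θ*_0−θ*_i))` for `0 ≤ i ≤ d`. -/
def SharpTDWithArray (F : Type*) [Field F] (V : Type*) [AddCommGroup V] [Module F V]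
    (d : ℕ) (A As : V →ₗ[F] V) (E Es : ℕ → (V →ₗ[F] V)) (θ θs ζ : ℕ → F) : Prop :=
  IsTDSystem F V d A As E Es θ θs ∧
  Module.finrank F (LinearMap.range (Es 0)) = 1 ∧
  ∀ i, i ≤ d → Es 0 ∘ₗ (Polynomial.aeval A (tauPoly θ i)) ∘ₗ Es 0 =
    (ζ i / ∏ h ∈ Finset.Icc 1 i, (θs 0 - θs h)) • Es 0

/-- The action of an element `x` of `T` on a `T`-module `M`, as an `F`-linear map. -/
def actL {F : Type*} [Field F] {d : ℕ} {θ θs : ℕ → F} {M : Type*} [AddCommGroup M]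
    [Module F M] [Module (TAlg F d θ θs) M] [IsScalarTower F (TAlg F d θ θs) M]
    (x : TAlg F d θ θs) : M →ₗ[F] M where
  toFun m := x • m
  map_add' := smul_add x
  map_smul' c m := (smul_comm c x m).symm

/-- The `F`-linear map `T → M`, `t ↦ t • v`, for a vector `v` of a `T`-module `M`. -/
def applyVec {F : Type*} [Field F] {d : ℕ} {θ θs : ℕ → F} {M : Type*} [AddCommGroup M]
    [Module F M] [Module (TAlg F d θ θs) M] [IsScalarTower F (TAlg F d θ θs) M]
    (v : M) : TAlg F d θ θs →ₗ[F] M where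
  toFun t := t • v
  map_add' x y := add_smul x y v
  map_smul' c t := smul_assoc c t v

/-- The `F`-subspace `e*_0 T e*_0` of `T`. -/
def corner (F : Type*) [Field F] (d : ℕ) (θ θs : ℕ → F) : Submodule F (TAlg F d θ θs) :=
  LinearMap.range ((LinearMap.mulLeft F (esT F d θ θs 0)).comp
    (LinearMap.mulRight F (esT F d θ θs 0)))

/-- The properties characterizing the homomorphism `μ : F[x_1,…,x_d] → e*_0 T e*_0`:
it is `F`-linear, unital (with `1 ↦ e*_0`, the identity of `e*_0Te*_0`), multiplicative,
sends `x_i ↦ e*_0 τ_i(a) e*_0` for `1 ≤ i ≤ d`, and is onto `e*_0 T e*_0`. -/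
def MuProps (F : Type*) [Field F] (d : ℕ) (θ θs : ℕ → F)
    (μ : MvPolynomial (Fin d) F →ₗ[F] TAlg F d θ θs) : Prop :=
  μ 1 = esT F d θ θs 0 ∧
  (∀ p q, μ (p * q) = μ p * μ q) ∧
  (∀ i : Fin d, μ (MvPolynomial.X i) =
    esT F d θ θs 0 * (Polynomial.aeval (aT F d θ θs) (tauPoly θ ((i : ℕ) + 1))) *
      esT F d θ θs 0) ∧
  LinearMap.range μ = corner F d θ θs

/-- Conditions (ii) on the split sequence: `ζ_0 = 1`, `ζ_d ≠ 0` and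
`Σ_{i=0}^d η_{d−i}(θ_0) η*_{d−i}(θ*_0) ζ_i ≠ 0`. -/
def ZetaCond (F : Type*) [Field F] (d : ℕ) (θ θs : ℕ → F) (ζ : ℕ → F) : Prop :=
  ζ 0 = 1 ∧ ζ d ≠ 0 ∧
  (∑ i ∈ Finset.range (d + 1),
    (etaPoly d θ (d - i)).eval (θ 0) * (etaPoly d θs (d - i)).eval (θs 0) * ζ i) ≠ 0

/-- The element `g_i = e*_0 τ_i(a) e*_0 − ζ_i e*_0/((θ*_0−θ*_1)⋯(θ*_0−θ*_i))` of `T`. -/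
def gElt (F : Type*) [Field F] (d : ℕ) (θ θs : ℕ → F) (ζ : ℕ → F) (i : ℕ) :
    TAlg F d θ θs :=
  esT F d θ θs 0 * (Polynomial.aeval (aT F d θ θs) (tauPoly θ i)) * esT F d θ θs 0 -
    (ζ i / ∏ h ∈ Finset.Icc 1 i, (θs 0 - θs h)) • esT F d θ θs 0

/-- The left ideal `J = T(1−e*_0) + Σ_{i=1}^d T g_i` of `T`, as a submodule of `T` over
itself (with the left regular action). -/
def Jideal (F : Type*) [Field F] (d : ℕ) (θ θs : ℕ → F) (ζ : ℕ → F) :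
    Submodule (TAlg F d θ θs) (TAlg F d θ θs) :=
  Submodule.span (TAlg F d θ θs)
    ({1 - esT F d θ θs 0} ∪ (gElt F d θ θs ζ '' Set.Icc 1 d))

/-- The `F`-subspace `D D* D D* D ⋯ D D* D` of `T` with `n+1` factors `D`. -/
def DDchain (F : Type*) [Field F] (d : ℕ) (θ θs : ℕ → F) : ℕ → Submodule F (TAlg F d θ θs)
  | 0 => Dsub F d θ θs
  | n + 1 => DDchain F d θ θs n * DsSub F d θ θs * Dsub F d θ θs

/-- The `F`-subspace `e*_r D e*_{κ 1} D e*_{κ 2} ⋯ D e*_{κ m}` of `T`. -/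
def esChain (F : Type*) [Field F] (d : ℕ) (θ θs : ℕ → F) (r : ℕ) (κ : ℕ → ℕ) :
    ℕ → Submodule F (TAlg F d θ θs)
  | 0 => Submodule.span F {esT F d θ θs r}
  | m + 1 => esChain F d θ θs r κ m * Dsub F d θ θs *
      Submodule.span F {esT F d θ θs (κ (m + 1))}

/-- The sequence `(c_0, c_1, …, c_m)` is convex: `c_{i−1} − c_i ≥ c_i − c_{i+1}`
for `1 ≤ i ≤ m−1`. -/
def ConvexSeq (c : ℕ → ℤ) (m : ℕ) : Prop :=
  ∀ i, 1 ≤ i → i + 1 ≤ m → c i - c (i + 1) ≤ c (i - 1) - c i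

end

section Vanishing

variable {F : Type*} [Field F] {E : Type*} [AddCommGroup E] [Module F E]

/-- A vector-valued function on `d + 1` distinct nodes which is orthogonal to all polynomials of
degree less than `m` and is supported on at most `m` nodes vanishes. -/
theorem eq_zero_of_orthogonal_of_card_support_le {d : ℕ} {θ : ℕ → F}
    (hθ : ∀ i j, i ≤ d → j ≤ d → i ≠ j → θ i ≠ θ j) {f : ℕ → E} {m : ℕ} (S : Finset ℕ)
    (hS : S.card ≤ m) (hf : ∀ i ≤ d, i ∉ S → f i = 0)
    (horth : ∀ q : F[X], q.natDegree < m → ∑ i ∈ Finset.range (d + 1), q.eval (θ i) • f i = 0)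
    {i : ℕ} (hi : i ≤ d) : f i = 0 := by
  by_contra hne
  have hiS : i ∈ S := by
    by_contra h
    exact hne (hf i hi h)
  set S' := (S.filter (· ≤ d)).erase i with hS'
  set q : F[X] := ∏ j ∈ S', (X - C (θ j)) with hq
  have hcard : S'.card < m := by
    have h1 : S'.card < (S.filter (· ≤ d)).card :=
      Finset.card_erase_lt_of_mem (Finset.mem_filter.2 ⟨hiS, hi⟩)
    have h2 := Finset.card_filter_le S (· ≤ d)
    omega
  have hdeg : q.natDegree < m := by
    rwa [hq, natDegree_prod_of_monic _ _ (fun j _ => monic_X_sub_C _), Finset.sum_congr rfl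
      (fun j _ => natDegree_X_sub_C _), Finset.sum_const, smul_eq_mul, mul_one]
  have h0 := horth q hdeg
  rw [Finset.sum_eq_single i] at h0
  · refine (smul_ne_zero ?_ hne) h0
    rw [hq, eval_prod]
    refine Finset.prod_ne_zero_iff.2 fun j hj => ?_
    obtain ⟨hji, hj⟩ := Finset.mem_erase.1 hj
    simpa [sub_eq_zero] using hθ i j hi (Finset.mem_filter.1 hj).2 hji.symm
  · intro j hj hji
    have hjd : j ≤ d := Nat.lt_succ_iff.1 (Finset.mem_range.1 hj)
    by_cases hjS : j ∈ S
    · have hjS' : j ∈ S' := Finset.mem_erase.2 ⟨hji, Finset.mem_filter.2 ⟨hjS, hjd⟩⟩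
      rw [hq, eval_prod, Finset.prod_eq_zero hjS' (by simp), zero_smul]
    · rw [hf j hjd hjS, smul_zero]
  · intro h
    exact absurd (Finset.mem_range.2 (Nat.lt_succ_of_le hi)) h

/-- A three-dimensional array satisfying tridiagonal orthogonality relations along its lines and
vanishing on the layers below `r` vanishes identically. -/
theorem array_eq_zero {d : ℕ} {θ θs : ℕ → F}
    (hθ : ∀ i j, i ≤ d → j ≤ d → i ≠ j → θ i ≠ θ j)
    (hθs : ∀ i j, i ≤ d → j ≤ d → i ≠ j → θs i ≠ θs j)
    {G : ℕ → ℕ → ℕ → E} {p k r : ℕ} (hp : p ≤ r) (hk : k < r)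
    (h₁ : ∀ i j, ∀ q : F[X], (q.natDegree + i < j ∨ q.natDegree + j < i) →
      ∑ t ∈ Finset.range (d + 1), q.eval (θs t) • G t i j = 0)
    (h₂ : ∀ t j, ∀ q : F[X], q.natDegree + p < t →
      ∑ i ∈ Finset.range (d + 1), q.eval (θ i) • G t i j = 0)
    (h₃ : ∀ t i, ∀ q : F[X], q.natDegree + k < t →
      ∑ j ∈ Finset.range (d + 1), q.eval (θ j) • G t i j = 0)
    (h₀ : ∀ t < r, ∀ i j, G t i j = 0) {t i j : ℕ} (ht : t ≤ d) (hi : i ≤ d) (hj : j ≤ d) :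
    G t i j = 0 := by
  induction hn : d - t using Nat.strong_induction_on generalizing t i j with
  | _ n ih =>
  subst hn
  rcases lt_or_ge t r with htr | htr
  · exact h₀ t htr i j
  have hband : ∀ i ≤ d, ∀ j ≤ d, (i + (t - r) < j ∨ j + (t - r) < i) → G t i j = 0 := by
    intro i hi j hj hij
    refine eq_zero_of_orthogonal_of_card_support_le hθs (f := fun t => G t i j)
      (m := max (i - j) (j - i)) (Finset.Icc r t) ?_ ?_ (fun q hq => h₁ i j q ?_) ht
    · rw [Nat.card_Icc]; omega
    · intro u hu hur
      rw [Finset.mem_Icc] at hur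
      rcases lt_or_ge u r with h | h
      · exact h₀ u h i j
      · exact ih (d - u) (by omega) hu hi hj rfl
    · omega
  have hcross : ∀ n ≤ d, (∀ j ≤ d, G t n j = 0) ∧ ∀ i ≤ d, G t i n = 0 := by
    intro n
    induction n using Nat.strong_induction_on with
    | _ n ihn =>
    intro hn
    have hrow : ∀ j ≤ d, G t n j = 0 := by
      intro j hj
      refine eq_zero_of_orthogonal_of_card_support_le hθ (f := fun j => G t n j)
        (m := t - k) (Finset.Icc n (n + (t - r))) ?_ ?_ (fun q hq => h₃ t n q (by omega)) hj
      · rw [Nat.card_Icc]; omega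
      · intro l hl hln
        rw [Finset.mem_Icc] at hln
        rcases lt_or_ge l n with h | h
        · exact (ihn l h hl).2 n hn
        · exact hband n hn l hl (by omega)
    refine ⟨hrow, fun i hi => ?_⟩
    refine eq_zero_of_orthogonal_of_card_support_le hθ (f := fun i => G t i n)
      (m := t - p) (Finset.Ioc n (n + (t - r))) ?_ ?_ (fun q hq => h₂ t n q (by omega)) hi
    · rw [Nat.card_Ioc]; omega
    · intro l hl hln
      rw [Finset.mem_Ioc] at hln
      rcases lt_trichotomy l n with h | h | h
      · exact (ihn l h hl).1 n hn
      · exact h ▸ hrow n hn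
      · exact hband l hl n hn (by omega)
  exact (hcross i hi).1 j hj

end Vanishing

section Idempotents

variable {F : Type*} [Field F] {R : Type*} [Ring R] [Algebra F R]

/-- A decomposition of `1` into orthogonal idempotents `e_0,…,e_d` with `a = ∑ θ_i e_i`. -/
structure IdemDecomp (d : ℕ) (a : R) (e : ℕ → R) (θ : ℕ → F) : Prop where
  mul_eq : ∀ i j, e i * e j = if i = j then e i else 0
  sum_eq_one : ∑ i ∈ Finset.range (d + 1), e i = 1
  eq_sum : a = ∑ i ∈ Finset.range (d + 1), θ i • e i

/-- The relations `e_i b^k e_j = 0` for `k < |i - j|`. -/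
def TridRel (e : ℕ → R) (b : R) : Prop :=
  ∀ i j k, (k + i < j ∨ k + j < i) → e i * b ^ k * e j = 0

theorem TridRel.aeval_eq_zero {e : ℕ → R} {b : R} (h : TridRel e b) {i j : ℕ} {q : F[X]}
    (hq : q.natDegree + i < j ∨ q.natDegree + j < i) : e i * aeval b q * e j = 0 := by
  rw [aeval_eq_sum_range, Finset.mul_sum, Finset.sum_mul]
  refine Finset.sum_eq_zero fun k hk => ?_
  rw [Finset.mem_range] at hk
  rw [mul_smul_comm, smul_mul_assoc, h i j k (by omega), smul_zero]

namespace IdemDecomp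

variable {d : ℕ} {a : R} {e : ℕ → R} {θ : ℕ → F} (h : IdemDecomp d a e θ)

include h

theorem eq_zero_of_notMem {i : ℕ} (hi : i ∉ Finset.range (d + 1)) : e i = 0 := by
  rw [← one_mul (e i), ← h.sum_eq_one, Finset.sum_mul]
  refine Finset.sum_eq_zero fun j hj => ?_
  rw [h.mul_eq, if_neg]
  rintro rfl
  exact hi hj

theorem mul_idem (i : ℕ) : a * e i = θ i • e i := by
  by_cases hi : i ∈ Finset.range (d + 1)
  · rw [h.eq_sum, Finset.sum_mul, Finset.sum_eq_single i (fun j _ hj => ?_) (fun h' => absurd hi h'),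
      smul_mul_assoc, h.mul_eq, if_pos rfl]
    rw [smul_mul_assoc, h.mul_eq, if_neg hj, smul_zero]
  · rw [h.eq_zero_of_notMem hi, mul_zero, smul_zero]

theorem aeval_mul_idem (q : F[X]) (i : ℕ) : aeval a q * e i = q.eval (θ i) • e i := by
  induction q using Polynomial.induction_on' with
  | add p q hp hq => rw [map_add, add_mul, hp, hq, eval_add, add_smul]
  | monomial n c =>
    rw [aeval_monomial, eval_monomial, mul_smul, mul_assoc, ← Algebra.smul_def]
    congr 1
    induction n with
    | zero => simp
    | succ n ih => rw [pow_succ, mul_assoc, h.mul_idem, mul_smul_comm, ih, smul_smul, ← pow_succ']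

theorem aeval_eq (q : F[X]) : aeval a q = ∑ i ∈ Finset.range (d + 1), q.eval (θ i) • e i := by
  rw [← mul_one (aeval a q), ← h.sum_eq_one, Finset.mul_sum]
  exact Finset.sum_congr rfl fun i _ => h.aeval_mul_idem q i

theorem idem_mul (i : ℕ) : e i * a = θ i • e i := by
  have h1 := h.aeval_eq (X : F[X])
  simp only [aeval_X, eval_X] at h1
  by_cases hi : i ∈ Finset.range (d + 1)
  · rw [h1, Finset.mul_sum, Finset.sum_eq_single i (fun j _ hj => ?_) (fun h' => absurd hi h'),
      mul_smul_comm, h.mul_eq, if_pos rfl]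
    rw [mul_smul_comm, h.mul_eq, if_neg hj.symm, smul_zero]
  · rw [h.eq_zero_of_notMem hi, zero_mul, smul_zero]

theorem exists_aeval_eq (hθ : ∀ i j, i ≤ d → j ≤ d → i ≠ j → θ i ≠ θ j) {i : ℕ} (hi : i ≤ d) :
    ∃ q : F[X], aeval a q = e i := by
  have hmem : i ∈ Finset.range (d + 1) := Finset.mem_range.2 (Nat.lt_succ_of_le hi)
  have hinj : Set.InjOn θ (Finset.range (d + 1) : Finset ℕ) := fun x hx y hy hxy => by
    by_contra hne
    exact hθ x y (Nat.lt_succ_iff.1 (by simpa using hx)) (Nat.lt_succ_iff.1 (by simpa using hy))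
      hne hxy
  refine ⟨Lagrange.basis (Finset.range (d + 1)) θ i, ?_⟩
  rw [h.aeval_eq, Finset.sum_eq_single i (fun j hj hji => ?_) (fun h' => absurd hmem h'),
    Lagrange.eval_basis_self hinj hmem, one_smul]
  rw [Lagrange.eval_basis_of_ne hji.symm hj, zero_smul]

theorem sum_smul_eq {L : Type*} [AddCommGroup L] [Module R L] (x : L) :
    ∑ i ∈ Finset.range (d + 1), e i • x = x := by
  rw [← Finset.sum_smul, h.sum_eq_one, one_smul]

variable {L : Type*} [AddCommGroup L] [Module F L] [Module R L] [IsScalarTower F R L]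

theorem smul_mem (hθ : ∀ i j, i ≤ d → j ≤ d → i ≠ j → θ i ≠ θ j) {W : Submodule F L}
    (hW : ∀ x ∈ W, a • x ∈ W) {i : ℕ} (hi : i ≤ d) {x : L} (hx : x ∈ W) : e i • x ∈ W := by
  obtain ⟨q, hq⟩ := h.exists_aeval_eq hθ hi
  rw [← hq]
  clear hq
  have hpow : ∀ n, a ^ n • x ∈ W := fun n => by
    induction n with
    | zero => simpa using hx
    | succ n ih => rw [pow_succ', mul_smul]; exact hW _ ih
  rw [aeval_eq_sum_range, Finset.sum_smul]
  refine W.sum_mem fun n _ => ?_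
  rw [smul_assoc]
  exact W.smul_mem _ (hpow n)

theorem sum_eval_smul_eq (q : F[X]) (x : L) :
    ∑ i ∈ Finset.range (d + 1), q.eval (θ i) • e i • x = aeval a q • x := by
  rw [h.aeval_eq, Finset.sum_smul]
  exact Finset.sum_congr rfl fun i _ => (smul_assoc _ _ _).symm

end IdemDecomp

end Idempotents

section Modules

variable {F : Type*} [Field F] {R : Type*} [Ring R] [Algebra F R]
  {L : Type*} [AddCommGroup L] [Module F L] [Module R L] [IsScalarTower F R L]
  {d : ℕ} {a b : R} {e es : ℕ → R} {θ θs : ℕ → F}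

/-- If `p ≤ r` and `k < r`, then `e*_p D e*_r D e*_k ⊆ ∑_{t < r} e*_p D e*_t D e*_k`, where
`D = F[a]`. -/
theorem smul_mem_of_forall_lt (h : IdemDecomp d a e θ) (hs : IdemDecomp d b es θs)
    (htr : TridRel es a) (htrs : TridRel e b)
    (hθ : ∀ i j, i ≤ d → j ≤ d → i ≠ j → θ i ≠ θ j)
    (hθs : ∀ i j, i ≤ d → j ≤ d → i ≠ j → θs i ≠ θs j)
    {p k r : ℕ} (hp : p ≤ r) (hk : k < r) {W : Submodule F L} {w : L} (hw : es k • w = w)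
    (hW : ∀ t < r, ∀ i j, es p • e i • es t • e j • w ∈ W) {t i j : ℕ} (ht : t ≤ d) (hi : i ≤ d)
    (hj : j ≤ d) : es p • e i • es t • e j • w ∈ W := by
  have hcomm : SMulCommClass F R L := IsScalarTower.to_smulCommClass
  have hG : W.mkQ (es p • e i • es t • e j • w) = 0 := by
    refine array_eq_zero hθ hθs (G := fun t i j => W.mkQ (es p • e i • es t • e j • w))
      hp hk ?_ ?_ ?_ ?_ ht hi hj
    · intro i j q hq
      simp only [← map_smul, ← map_sum]
      have : ∑ t ∈ Finset.range (d + 1), q.eval (θs t) • es p • e i • es t • e j • w =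
          es p • (e i * aeval b q * e j) • w := by
        rw [mul_smul, mul_smul, ← hs.sum_eval_smul_eq, Finset.smul_sum, Finset.smul_sum]
        refine Finset.sum_congr rfl fun t _ => ?_
        rw [smul_comm, smul_comm (q.eval (θs t)) (e i)]
      rw [this, htrs.aeval_eq_zero hq, zero_smul, smul_zero, map_zero]
    · intro t j q hq
      simp only [← map_smul, ← map_sum]
      have : ∑ i ∈ Finset.range (d + 1), q.eval (θ i) • es p • e i • es t • e j • w =
          (es p * aeval a q * es t) • e j • w := by
        rw [mul_smul, mul_smul, ← h.sum_eval_smul_eq, Finset.smul_sum]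
        exact Finset.sum_congr rfl fun i _ => smul_comm _ _ _
      rw [this, htr.aeval_eq_zero (Or.inl hq), zero_smul, map_zero]
    · intro t i q hq
      simp only [← map_smul, ← map_sum]
      have : ∑ j ∈ Finset.range (d + 1), q.eval (θ j) • es p • e i • es t • e j • w =
          es p • e i • (es t * aeval a q * es k) • w := by
        rw [mul_smul, mul_smul, hw, ← h.sum_eval_smul_eq, Finset.smul_sum, Finset.smul_sum,
          Finset.smul_sum]
        refine Finset.sum_congr rfl fun j _ => ?_
        rw [smul_comm, smul_comm (q.eval (θ j)) (e i), smul_comm (q.eval (θ j)) (es t)]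
      rw [this, htr.aeval_eq_zero (Or.inr hq), zero_smul, smul_zero, smul_zero, map_zero]
    · intro t ht i j
      exact (Submodule.Quotient.mk_eq_zero W).2 (hW t ht i j)
  exact (Submodule.Quotient.mk_eq_zero W).1 hG

/-- The spaces spanned by the vectors `e*_{k_1} e_{i_1} e*_{k_2} e_{i_2} ⋯ v` with
`n ≥ k_1 > k_2 > ⋯ > 0`. -/
def descendingSpan (F : Type*) [Field F] {R : Type*} [Ring R] [Algebra F R] {L : Type*}
    [AddCommGroup L] [Module F L] [Module R L] [IsScalarTower F R L] (d : ℕ) (e es : ℕ → R)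
    (v : L) : ℕ → Submodule F L
  | 0 => Submodule.span F {v}
  | n + 1 => descendingSpan F d e es v n ⊔ ⨆ i : Fin (d + 1),
      (descendingSpan F d e es v n).map (Algebra.lsmul F F L (es (n + 1) * e i))

theorem finite_descendingSpan (d : ℕ) (e es : ℕ → R) (v : L) (n : ℕ) :
    Module.Finite F (descendingSpan F d e es v n) := by
  induction n with
  | zero => rw [descendingSpan]; infer_instance
  | succ n ih => rw [descendingSpan]; infer_instance

theorem mem_descendingSpan_mono {v : L} {m n : ℕ} (hmn : m ≤ n) {x : L}
    (hx : x ∈ descendingSpan F d e es v m) : x ∈ descendingSpan F d e es v n :=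
  monotone_nat_of_le_succ (f := descendingSpan F d e es v)
    (fun n => by rw [descendingSpan.eq_2]; exact le_sup_left) hmn hx

theorem smul_mem_descendingSpan_succ {v : L} {n i : ℕ} (hi : i ≤ d) {x : L}
    (hx : x ∈ descendingSpan F d e es v n) :
    es (n + 1) • e i • x ∈ descendingSpan F d e es v (n + 1) := by
  rw [descendingSpan, ← mul_smul]
  refine Submodule.mem_sup_right (Submodule.mem_iSup_of_mem ⟨i, Nat.lt_succ_of_le hi⟩ ?_)
  exact ⟨x, hx, rfl⟩

theorem descendingSpan_induction {v : L} {n : ℕ} {P : Submodule F L}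
    (h₁ : ∀ x ∈ descendingSpan F d e es v n, x ∈ P)
    (h₂ : ∀ i ≤ d, ∀ x ∈ descendingSpan F d e es v n, es (n + 1) • e i • x ∈ P) {x : L}
    (hx : x ∈ descendingSpan F d e es v (n + 1)) : x ∈ P := by
  rw [descendingSpan] at hx
  refine (sup_le h₁ (iSup_le fun i => ?_) : _ ≤ P) hx
  rintro _ ⟨y, hy, rfl⟩
  have := h₂ i (Nat.lt_succ_iff.1 i.2) y hy
  rwa [← mul_smul] at this

theorem smul_eq_zero_of_mem_descendingSpan (hs : IdemDecomp d b es θs) {v : L}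
    (hv : es 0 • v = v) {n k : ℕ} (hk : n < k) {x : L}
    (hx : x ∈ descendingSpan F d e es v n) : es k • x = 0 := by
  induction n generalizing x with
  | zero =>
    rw [descendingSpan] at hx
    obtain ⟨c, rfl⟩ := Submodule.mem_span_singleton.1 hx
    have hcomm : SMulCommClass F R L := IsScalarTower.to_smulCommClass
    rw [smul_comm, ← hv, ← mul_smul (es k), hs.mul_eq, if_neg (by omega), zero_smul, smul_zero]
  | succ n ih =>
    refine descendingSpan_induction (P := LinearMap.ker (Algebra.lsmul F F L (es k)))
      (fun x hx => ih (by omega) hx) (fun i _ x _ => ?_) hx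
    change es k • es (n + 1) • e i • x = 0
    rw [← mul_smul (es k), hs.mul_eq, if_neg (by omega), zero_smul]

theorem smul_mem_descendingSpan (h : IdemDecomp d a e θ) (hs : IdemDecomp d b es θs)
    (htr : TridRel es a) (htrs : TridRel e b)
    (hθ : ∀ i j, i ≤ d → j ≤ d → i ≠ j → θ i ≠ θ j)
    (hθs : ∀ i j, i ≤ d → j ≤ d → i ≠ j → θs i ≠ θs j) {v : L} (hv : es 0 • v = v)
    (hspan : ∀ x : L, es 0 • x ∈ Submodule.span F {v}) {n : ℕ} (hn : n ≤ d) {t i : ℕ}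
    (ht : t ≤ n) (hi : i ≤ d) {x : L} (hx : x ∈ descendingSpan F d e es v n) :
    es t • e i • x ∈ descendingSpan F d e es v n := by
  have hcomm : SMulCommClass F R L := IsScalarTower.to_smulCommClass
  induction n generalizing t i x with
  | zero =>
    obtain rfl : t = 0 := by omega
    rw [descendingSpan]
    exact hspan _
  | succ n ih =>
    have hstep : ∀ t ≤ n + 1, ∀ i ≤ d, ∀ x ∈ descendingSpan F d e es v n,
        es t • e i • x ∈ descendingSpan F d e es v (n + 1) := by
      intro t ht i hi x hx
      rcases Nat.lt_or_ge n t with h' | h'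
      · obtain rfl : t = n + 1 := by omega
        exact smul_mem_descendingSpan_succ hi hx
      · exact mem_descendingSpan_mono (Nat.le_succ n) (ih (by omega) h' hi hx)
    have hzero : ∀ i, ¬ i ≤ d → e i = 0 := fun i hi =>
      h.eq_zero_of_notMem (by rw [Finset.mem_range]; omega)
    rw [← mul_smul]
    change x ∈ (descendingSpan F d e es v (n + 1)).comap (Algebra.lsmul F F L (es t * e i))
    refine descendingSpan_induction (fun x hx => ?_) (fun j hj y hy => ?_) hx
    · change (es t * e i) • x ∈ descendingSpan F d e es v (n + 1)
      rw [mul_smul]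
      exact hstep t ht i hi x hx
    · change (es t * e i) • es (n + 1) • e j • y ∈ descendingSpan F d e es v (n + 1)
      rw [mul_smul, ← hs.sum_smul_eq y]
      simp only [Finset.smul_sum]
      refine Submodule.sum_mem _ fun k _ => ?_
      rcases Nat.lt_or_ge n k with hk | hk
      · simp [smul_eq_zero_of_mem_descendingSpan hs hv hk hy]
      have hyk : es k • y ∈ descendingSpan F d e es v n := by
        rw [← h.sum_smul_eq y, Finset.smul_sum]
        exact Submodule.sum_mem _ fun l hl =>
          ih (by omega) hk (Nat.lt_succ_iff.1 (Finset.mem_range.1 hl)) hy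
      refine smul_mem_of_forall_lt h hs htr htrs hθ hθs ht (Nat.lt_succ_of_le hk) ?_ ?_ hn hi hj
      · rw [← mul_smul, hs.mul_eq, if_pos rfl]
      · intro u hu i j
        by_cases hj : j ≤ d
        · by_cases hi : i ≤ d
          · exact hstep t ht i hi _ (ih (by omega) (by omega) hj hyk)
          · simp [hzero i hi]
        · simp [hzero j hj]

/-- An irreducible module on which `e*_0` has rank one is finite-dimensional. -/
theorem module_finite_of_irreducible (h : IdemDecomp d a e θ) (hs : IdemDecomp d b es θs)
    (htr : TridRel es a) (htrs : TridRel e b)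
    (hθ : ∀ i j, i ≤ d → j ≤ d → i ≠ j → θ i ≠ θ j)
    (hθs : ∀ i j, i ≤ d → j ≤ d → i ≠ j → θs i ≠ θs j)
    (hirr : ∀ W : Submodule F L, (∀ x ∈ W, a • x ∈ W) → (∀ x ∈ W, b • x ∈ W) → W = ⊥ ∨ W = ⊤)
    {v : L} (hv0 : v ≠ 0) (hv : es 0 • v = v)
    (hspan : ∀ x : L, es 0 • x ∈ Submodule.span F {v}) : Module.Finite F L := by
  have hmem : ∀ t ∈ Finset.range (d + 1), ∀ i ∈ Finset.range (d + 1),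
      ∀ x ∈ descendingSpan F d e es v d, es t • e i • x ∈ descendingSpan F d e es v d :=
    fun t ht i hi x hx => smul_mem_descendingSpan h hs htr htrs hθ hθs hv hspan le_rfl
      (Nat.lt_succ_iff.1 (Finset.mem_range.1 ht)) (Nat.lt_succ_iff.1 (Finset.mem_range.1 hi)) hx
  have ha : ∀ x ∈ descendingSpan F d e es v d, a • x ∈ descendingSpan F d e es v d := by
    intro x hx
    rw [h.eq_sum, Finset.sum_smul]
    refine Submodule.sum_mem _ fun i hi => ?_
    rw [smul_assoc, ← hs.sum_smul_eq (e i • x)]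
    exact Submodule.smul_mem _ _ (Submodule.sum_mem _ fun t ht => hmem t ht i hi x hx)
  have hb : ∀ x ∈ descendingSpan F d e es v d, b • x ∈ descendingSpan F d e es v d := by
    intro x hx
    rw [hs.eq_sum, Finset.sum_smul]
    refine Submodule.sum_mem _ fun t ht => ?_
    rw [smul_assoc, ← h.sum_smul_eq x, Finset.smul_sum]
    exact Submodule.smul_mem _ _ (Submodule.sum_mem _ fun i hi => hmem t ht i hi x hx)
  rcases hirr (descendingSpan F d e es v d) ha hb with h' | h'
  · refine absurd ?_ hv0
    rw [← Submodule.mem_bot F, ← h']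
    refine mem_descendingSpan_mono (Nat.zero_le d) ?_
    rw [descendingSpan]
    exact Submodule.mem_span_singleton_self v
  · have := finite_descendingSpan (F := F) d e es v d
    rw [h'] at this
    exact Module.Finite.equiv (Submodule.topEquiv : (⊤ : Submodule F L) ≃ₗ[F] L)

end Modules

section Nonvanishing

variable {F : Type*} [Field F] {R : Type*} [Ring R] [Algebra F R]
  {L : Type*} [AddCommGroup L] [Module F L] [Module R L] [IsScalarTower F R L]
  {d : ℕ} {a b : R} {e es : ℕ → R} {θ θs : ℕ → F}

/-- In an irreducible module, the indices `i` with `e_i ≠ 0` form an interval. -/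
theorem exists_smul_ne_zero_of_endpoints (h : IdemDecomp d a e θ) (htrs : TridRel e b)
    (hirr : ∀ W : Submodule F L, (∀ x ∈ W, a • x ∈ W) → (∀ x ∈ W, b • x ∈ W) → W = ⊥ ∨ W = ⊤)
    (h₀ : ∃ x : L, e 0 • x ≠ 0) (hd : ∃ x : L, e d • x ≠ 0) {i : ℕ} (hi : i ≤ d) :
    ∃ x : L, e i • x ≠ 0 := by
  have hcomm : SMulCommClass F R L := IsScalarTower.to_smulCommClass
  by_contra! hzero
  obtain ⟨x₀, hx₀⟩ := h₀
  obtain ⟨xd, hxd⟩ := hd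
  have hi0 : i ≠ 0 := by rintro rfl; exact hx₀ (hzero x₀)
  let W : Submodule F L :=
    { carrier := {x | ∀ j, i ≤ j → e j • x = 0}
      add_mem' := fun hx hy j hj => by rw [smul_add, hx j hj, hy j hj, add_zero]
      zero_mem' := fun j _ => smul_zero _
      smul_mem' := fun c x hx j hj => by rw [smul_comm, hx j hj, smul_zero] }
  have hmem : ∀ x, x ∈ W ↔ ∀ j, i ≤ j → e j • x = 0 := fun x => Iff.rfl
  have haW : ∀ x ∈ W, a • x ∈ W := fun x hx j hj => by
    rw [← mul_smul, h.idem_mul, smul_assoc, hx j hj, smul_zero]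
  have hbW : ∀ x ∈ W, b • x ∈ W := fun x hx j hj => by
    rcases hj.eq_or_lt with rfl | hj
    · exact hzero _
    rw [← h.sum_smul_eq x, Finset.smul_sum, Finset.smul_sum]
    refine Finset.sum_eq_zero fun l _ => ?_
    rcases lt_or_ge l i with hl | hl
    · have := htrs j l 1 (by omega)
      rw [pow_one] at this
      rw [← mul_smul, ← mul_smul, this, zero_smul]
    · rw [hx l hl, smul_zero, smul_zero]
  rcases hirr W haW hbW with hW | hW
  · refine hx₀ ((Submodule.mem_bot F).1 (hW ▸ (hmem _).2 fun j hj => ?_))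
    rw [← mul_smul, h.mul_eq, if_neg (by omega), zero_smul]
  · exact hxd ((hmem xd).1 (hW ▸ Submodule.mem_top) d hi)

theorem aeval_tauPoly (h : IdemDecomp d a e θ) :
    aeval a (tauPoly θ d) = (tauPoly θ d).eval (θ d) • e d := by
  rw [h.aeval_eq, Finset.sum_range_succ, Finset.sum_eq_zero, zero_add]
  intro i hi
  rw [tauPoly, eval_prod, Finset.prod_eq_zero hi (by simp), zero_smul]

theorem tauPoly_succ (θ : ℕ → F) (i : ℕ) : tauPoly θ (i + 1) = tauPoly θ i * (X - C (θ i)) :=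
  Finset.prod_range_succ _ _

theorem etaPoly_sub (θ : ℕ → F) {i : ℕ} (hi : i ≤ d) :
    etaPoly d θ (d - i) = ∏ j ∈ Finset.Ico (i + 1) (d + 1), (X - C (θ j)) := by
  rw [etaPoly, Finset.prod_Ico_eq_prod_range, ← Finset.prod_range_reflect]
  rw [show d + 1 - (i + 1) = d - i by omega]
  refine Finset.prod_congr rfl fun j hj => ?_
  rw [Finset.mem_range] at hj
  congr 3
  omega

/-- The expansion of `η_d` in the basis `τ_0,…,τ_d`. -/
theorem prod_eq_sum_tauPoly (θ : ℕ → F) (d : ℕ) :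
    ∏ j ∈ Finset.Ico 1 (d + 1), (X - C (θ j)) =
      ∑ i ∈ Finset.range (d + 1),
        (∏ j ∈ Finset.Ico (i + 1) (d + 1), (θ 0 - θ j)) • tauPoly θ i := by
  induction d with
  | zero => simp [tauPoly]
  | succ d ih =>
    have hτ : tauPoly θ (d + 1) =
        (X - C (θ 0)) * ∏ j ∈ Finset.Ico 1 (d + 1), (X - C (θ j)) := by
      rw [tauPoly, Finset.range_eq_Ico, Finset.prod_eq_prod_Ico_succ_bot (Nat.succ_pos d)]
    rw [Finset.sum_range_succ, Finset.Ico_self, Finset.prod_empty, one_smul, hτ,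
      Finset.prod_Ico_succ_top (by omega)]
    have : ∑ i ∈ Finset.range (d + 1),
        (∏ j ∈ Finset.Ico (i + 1) (d + 1 + 1), (θ 0 - θ j)) • tauPoly θ i =
        (θ 0 - θ (d + 1)) • ∏ j ∈ Finset.Ico 1 (d + 1), (X - C (θ j)) := by
      rw [ih, Finset.smul_sum]
      refine Finset.sum_congr rfl fun i hi => ?_
      rw [Finset.mem_range] at hi
      rw [Finset.prod_Ico_succ_top (by omega), smul_smul, mul_comm]
    rw [this, smul_eq_C_mul, C_sub]
    ring

theorem aeval_etaPoly (h : IdemDecomp d a e θ) :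
    aeval a (etaPoly d θ d) = (etaPoly d θ d).eval (θ 0) • e 0 := by
  rw [h.aeval_eq, Finset.sum_range_succ', Finset.sum_eq_zero, zero_add]
  intro i hi
  have := etaPoly_sub (d := d) θ (Nat.zero_le d)
  rw [Nat.sub_zero] at this
  rw [this, eval_prod, Finset.prod_eq_zero (i := i + 1), zero_smul]
  · rw [Finset.mem_range] at hi
    rw [Finset.mem_Ico]
    omega
  · simp

/-- If `e*_0` has rank one, `e*_0 e_0 e*_0 ≠ 0` and `e*_0 e_d e*_0 ≠ 0`, then `e*_d ≠ 0`. -/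
theorem exists_estar_last_smul_ne_zero (hs : IdemDecomp d b es θs) (htrs : TridRel e b)
    (hθs : ∀ i j, i ≤ d → j ≤ d → i ≠ j → θs i ≠ θs j) {v : L} (hv0 : v ≠ 0)
    (hv : es 0 • v = v) (hspan : ∀ x : L, es 0 • x ∈ Submodule.span F {v})
    (h₀ : es 0 • e 0 • v ≠ 0) (hd : es 0 • e d • v ≠ 0) : ∃ x : L, es d • x ≠ 0 := by
  have hcomm : SMulCommClass F R L := IsScalarTower.to_smulCommClass
  rcases Nat.eq_zero_or_pos d with rfl | hpos
  · exact ⟨v, by rwa [hv]⟩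
  by_contra! hzero
  set q : F[X] := ∏ j ∈ Finset.Ico 1 d, (X - C (θs j)) with hq
  have hdeg : q.natDegree < d := by
    rw [hq, natDegree_prod_of_monic _ _ (fun j _ => monic_X_sub_C _), Finset.sum_congr rfl
      (fun j _ => natDegree_X_sub_C _), Finset.sum_const, smul_eq_mul, mul_one, Nat.card_Ico]
    omega
  have hq0 : q.eval (θs 0) ≠ 0 := by
    rw [hq, eval_prod]
    refine Finset.prod_ne_zero_iff.2 fun j hj => ?_
    rw [Finset.mem_Ico] at hj
    simpa [sub_eq_zero] using hθs 0 j (Nat.zero_le d) (by omega) (by omega)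
  have hqs : ∀ x : L, aeval b q • x = q.eval (θs 0) • es 0 • x := by
    intro x
    rw [← hs.sum_eval_smul_eq, Finset.sum_eq_single 0]
    · intro j hj hj0
      rw [Finset.mem_range] at hj
      rcases (Nat.lt_succ_iff.1 hj).eq_or_lt with rfl | hjd
      · rw [hzero, smul_zero]
      · rw [hq, eval_prod, Finset.prod_eq_zero (i := j), zero_smul]
        · rw [Finset.mem_Ico]; omega
        · simp
    · simp
  have hzero' : e 0 • es 0 • e d • v = 0 := by
    have h1 : (e 0 * aeval b q * e d) • v = 0 := by
      rw [htrs.aeval_eq_zero (Or.inl (by omega)), zero_smul]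
    rw [mul_smul, mul_smul, hqs, smul_comm] at h1
    exact (smul_eq_zero.1 h1).resolve_left hq0
  obtain ⟨c, hc⟩ := Submodule.mem_span_singleton.1 (hspan (e d • v))
  rw [← hc, smul_comm] at hzero'
  rcases smul_eq_zero.1 hzero' with rfl | h'
  · exact hd (by rw [← hc, zero_smul])
  · exact h₀ (by rw [h', smul_zero])

end Nonvanishing

section TAlgebra

variable {F : Type*} [Field F] {d : ℕ} {θ θs : ℕ → F}

theorem eT_val (i : Fin (d + 1)) : eT F d θ θs i = tgen F d θ θs (TGen.e i) :=
  dif_pos i.2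

theorem esT_val (i : Fin (d + 1)) : esT F d θ θs i = tgen F d θ θs (TGen.estar i) :=
  dif_pos i.2

theorem idemDecomp_eT : IdemDecomp d (aT F d θ θs) (eT F d θ θs) θ where
  mul_eq i j := by
    by_cases hi : i < d + 1
    · by_cases hj : j < d + 1
      · have := RingQuot.mkAlgHom_rel F (TRel.ee (F := F) (θ := θ) (θs := θs) ⟨i, hi⟩ ⟨j, hj⟩)
        simp only [map_mul, Fin.mk.injEq] at this
        rw [eT, eT, dif_pos hi, dif_pos hj, tgen, tgen, this]
        split_ifs <;> simp
      · rw [if_neg (by omega), eT, eT, dif_neg hj, mul_zero]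
    · have h0 : eT F d θ θs i = 0 := dif_neg hi
      simp [h0]
  sum_eq_one := by
    rw [Finset.sum_range]
    have := RingQuot.mkAlgHom_rel F (TRel.sum_e (F := F) (d := d) (θ := θ) (θs := θs))
    rw [map_sum, map_one] at this
    simp only [eT_val]
    exact this
  eq_sum := by
    rw [Finset.sum_range]
    have := RingQuot.mkAlgHom_rel F (TRel.a_eq (F := F) (d := d) (θ := θ) (θs := θs))
    simp only [map_sum, map_smul] at this
    simp only [eT_val]
    exact this

theorem idemDecomp_esT : IdemDecomp d (asT F d θ θs) (esT F d θ θs) θs where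
  mul_eq i j := by
    by_cases hi : i < d + 1
    · by_cases hj : j < d + 1
      · have := RingQuot.mkAlgHom_rel F (TRel.eses (F := F) (θ := θ) (θs := θs) ⟨i, hi⟩ ⟨j, hj⟩)
        simp only [map_mul, Fin.mk.injEq] at this
        rw [esT, esT, dif_pos hi, dif_pos hj, tgen, tgen, this]
        split_ifs <;> simp
      · rw [if_neg (by omega), esT, esT, dif_neg hj, mul_zero]
    · have h0 : esT F d θ θs i = 0 := dif_neg hi
      simp [h0]
  sum_eq_one := by
    rw [Finset.sum_range]
    have := RingQuot.mkAlgHom_rel F (TRel.sum_estar (F := F) (d := d) (θ := θ) (θs := θs))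
    rw [map_sum, map_one] at this
    simp only [esT_val]
    exact this
  eq_sum := by
    rw [Finset.sum_range]
    have := RingQuot.mkAlgHom_rel F (TRel.astar_eq (F := F) (d := d) (θ := θ) (θs := θs))
    simp only [map_sum, map_smul] at this
    simp only [esT_val]
    exact this

theorem tridRel_esT : TridRel (esT F d θ θs) (aT F d θ θs) := by
  intro i j k hk
  by_cases hi : i < d + 1
  · by_cases hj : j < d + 1
    · have := RingQuot.mkAlgHom_rel F (TRel.trid (F := F) (θ := θ) (θs := θs) ⟨i, hi⟩ ⟨j, hj⟩ k
        (by omega) (by simp only [lt_max_iff]; omega))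
      simp only [map_mul, map_pow, map_zero] at this
      rw [esT, esT, dif_pos hi, dif_pos hj]
      exact this
    · rw [esT, esT, dif_neg hj, mul_zero]
  · have h0 : esT F d θ θs i = 0 := dif_neg hi
    rw [h0, zero_mul, zero_mul]

theorem tridRel_eT : TridRel (eT F d θ θs) (asT F d θ θs) := by
  intro i j k hk
  by_cases hi : i < d + 1
  · by_cases hj : j < d + 1
    · have := RingQuot.mkAlgHom_rel F (TRel.tridstar (F := F) (θ := θ) (θs := θs) ⟨i, hi⟩ ⟨j, hj⟩ k
        (by omega) (by simp only [lt_max_iff]; omega))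
      simp only [map_mul, map_pow, map_zero] at this
      rw [eT, eT, dif_pos hi, dif_pos hj]
      exact this
    · rw [eT, eT, dif_neg hj, mul_zero]
  · have h0 : eT F d θ θs i = 0 := dif_neg hi
    rw [h0, zero_mul, zero_mul]

variable {L : Type*} [AddCommGroup L] [Module F L] [Module (TAlg F d θ θs) L]
  [IsScalarTower F (TAlg F d θ θs) L]

/-- A subspace invariant under `a` and `a*` is invariant under `T`. -/
theorem smul_mem_of_invariant (hθ : ∀ i j, i ≤ d → j ≤ d → i ≠ j → θ i ≠ θ j)
    (hθs : ∀ i j, i ≤ d → j ≤ d → i ≠ j → θs i ≠ θs j) {W : Submodule F L}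
    (ha : ∀ x ∈ W, aT F d θ θs • x ∈ W) (hb : ∀ x ∈ W, asT F d θ θs • x ∈ W)
    (t : TAlg F d θ θs) {x : L} (hx : x ∈ W) : t • x ∈ W := by
  obtain ⟨y, rfl⟩ := RingQuot.mkAlgHom_surjective F (TRel F d θ θs) t
  induction y using FreeAlgebra.induction generalizing x with
  | grade0 r =>
    rw [AlgHom.commutes, algebraMap_smul]
    exact W.smul_mem r hx
  | grade1 g =>
    cases g with
    | a => exact ha x hx
    | astar => exact hb x hx
    | e i =>
      have := idemDecomp_eT.smul_mem hθ ha (Nat.lt_succ_iff.1 i.2) hx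
      rwa [eT_val] at this
    | estar i =>
      have := idemDecomp_esT.smul_mem hθs hb (Nat.lt_succ_iff.1 i.2) hx
      rwa [esT_val] at this
  | mul y z ihy ihz =>
    rw [map_mul, mul_smul]
    exact ihy (ihz hx)
  | add y z ihy ihz =>
    rw [map_add, add_smul]
    exact W.add_mem (ihy hx) (ihz hx)

theorem eq_bot_or_eq_top_of_invariant [IsSimpleModule (TAlg F d θ θs) L]
    (hθ : ∀ i j, i ≤ d → j ≤ d → i ≠ j → θ i ≠ θ j)
    (hθs : ∀ i j, i ≤ d → j ≤ d → i ≠ j → θs i ≠ θs j) (W : Submodule F L)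
    (ha : ∀ x ∈ W, aT F d θ θs • x ∈ W) (hb : ∀ x ∈ W, asT F d θ θs • x ∈ W) :
    W = ⊥ ∨ W = ⊤ := by
  let N : Submodule (TAlg F d θ θs) L :=
    { W.toAddSubmonoid with
      smul_mem' := fun t _ hx => smul_mem_of_invariant hθ hθs ha hb t hx }
  have hN : ∀ x, x ∈ N ↔ x ∈ W := fun x => Iff.rfl
  rcases eq_bot_or_eq_top N with h | h
  · left
    ext x
    rw [← hN, h, Submodule.mem_bot, Submodule.mem_bot]
  · right
    ext x
    rw [← hN, h]
    exact iff_of_true Submodule.mem_top Submodule.mem_top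

theorem split_smul {ζ : ℕ → F} (hζ : ζ 0 = 1) {v : L} (hv : esT F d θ θs 0 • v = v)
    (hg : ∀ i ∈ Set.Icc 1 d, gElt F d θ θs ζ i • v = 0) {i : ℕ} (hi : i ≤ d) :
    esT F d θ θs 0 • aeval (aT F d θ θs) (tauPoly θ i) • v =
      (ζ i / ∏ h ∈ Finset.Icc 1 i, (θs 0 - θs h)) • v := by
  rcases Nat.eq_zero_or_pos i with rfl | hpos
  · simp [tauPoly, hζ, hv]
  · have := hg i ⟨hpos, hi⟩
    rw [gElt, sub_smul, mul_smul, mul_smul, smul_assoc, hv, sub_eq_zero] at this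
    exact this

/-- On a module generated by a vector `v ∈ e*_0 L` with `g_i v = 0`, the idempotent `e*_0` has
rank at most one. -/
theorem estar_zero_smul_mem_span [IsSimpleModule (TAlg F d θ θs) L]
    {μ : MvPolynomial (Fin d) F →ₗ[F] TAlg F d θ θs} (hμ : MuProps F d θ θs μ) {ζ : ℕ → F}
    (hζ : ζ 0 = 1) {v : L} (hv0 : v ≠ 0) (hv : esT F d θ θs 0 • v = v)
    (hg : ∀ i ∈ Set.Icc 1 d, gElt F d θ θs ζ i • v = 0) (x : L) :
    esT F d θ θs 0 • x ∈ Submodule.span F {v} := by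
  have hcomm : SMulCommClass F (TAlg F d θ θs) L := IsScalarTower.to_smulCommClass
  obtain ⟨hμ1, hμmul, hμX, hμrange⟩ := hμ
  have hpoly : ∀ p, μ p • v ∈ Submodule.span F {v} := by
    intro p
    induction p using MvPolynomial.induction_on with
    | C c =>
      rw [← mul_one (MvPolynomial.C c), ← MvPolynomial.smul_eq_C_mul, map_smul, hμ1, smul_assoc, hv]
      exact Submodule.smul_mem _ _ (Submodule.mem_span_singleton_self v)
    | add p q hp hq =>
      rw [map_add, add_smul]
      exact Submodule.add_mem _ hp hq
    | mul_X p i hp =>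
      rw [hμmul, hμX, mul_smul, mul_smul, mul_smul, hv,
        split_smul hζ hv hg (Nat.succ_le_of_lt i.2), smul_comm]
      exact Submodule.smul_mem _ _ hp
  obtain ⟨t, rfl⟩ := IsSimpleModule.toSpanSingleton_surjective (TAlg F d θ θs) hv0 x
  have hmem : esT F d θ θs 0 * (t * esT F d θ θs 0) ∈ LinearMap.range μ := by
    rw [hμrange]
    exact ⟨t, rfl⟩
  obtain ⟨p, hp⟩ := hmem
  have := hpoly p
  rwa [hp, mul_smul, mul_smul, hv] at this

theorem eta_smul (hθs : ∀ i j, i ≤ d → j ≤ d → i ≠ j → θs i ≠ θs j) {ζ : ℕ → F} (hζ : ζ 0 = 1)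
    {v : L} (hv : esT F d θ θs 0 • v = v)
    (hg : ∀ i ∈ Set.Icc 1 d, gElt F d θ θs ζ i • v = 0) :
    esT F d θ θs 0 • aeval (aT F d θ θs) (etaPoly d θ d) • v =
      ((∑ i ∈ Finset.range (d + 1), (etaPoly d θ (d - i)).eval (θ 0) *
        (etaPoly d θs (d - i)).eval (θs 0) * ζ i) /
          ∏ h ∈ Finset.Icc 1 d, (θs 0 - θs h)) • v := by
  have hcomm : SMulCommClass F (TAlg F d θ θs) L := IsScalarTower.to_smulCommClass
  have heta := etaPoly_sub (d := d) θ (Nat.zero_le d)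
  rw [Nat.sub_zero] at heta
  rw [heta, prod_eq_sum_tauPoly, map_sum, Finset.sum_smul, Finset.smul_sum, Finset.sum_div,
    Finset.sum_smul]
  refine Finset.sum_congr rfl fun i hi => ?_
  have hid : i ≤ d := Nat.lt_succ_iff.1 (Finset.mem_range.1 hi)
  rw [map_smul, smul_assoc, smul_comm, split_smul hζ hv hg hid, smul_smul, etaPoly_sub θ hid,
    etaPoly_sub θs hid, eval_prod, eval_prod]
  simp only [eval_sub, eval_X, eval_C]
  congr 1
  have hIcc : ∀ n, Finset.Icc 1 n = Finset.Ico 1 (n + 1) := fun n => rfl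
  rw [hIcc, hIcc, ← Finset.prod_Ico_consecutive _ (by omega : 1 ≤ i + 1) (by omega : i + 1 ≤ d + 1)]
  have hne : ∀ m n, 1 ≤ m → n ≤ d + 1 → ∏ j ∈ Finset.Ico m n, (θs 0 - θs j) ≠ 0 := by
    intro m n hm hn
    refine Finset.prod_ne_zero_iff.2 fun j hj => sub_ne_zero.2 ?_
    rw [Finset.mem_Ico] at hj
    exact hθs 0 j (Nat.zero_le d) (by omega) (by omega)
  have h1 := hne 1 (i + 1) le_rfl (by omega)
  have h2 := hne (i + 1) (d + 1) (by omega) le_rfl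
  field_simp

theorem map_range_actL_le {b : TAlg F d θ θs} {e : ℕ → TAlg F d θ θs} {a : TAlg F d θ θs}
    {η : ℕ → F} (h : IdemDecomp d a e η) (htrs : TridRel e b) (i : ℕ) :
    Submodule.map (actL (M := L) b) (LinearMap.range (actL (M := L) (e i))) ≤
      (if i = 0 then ⊥ else LinearMap.range (actL (M := L) (e (i - 1)))) ⊔
        LinearMap.range (actL (M := L) (e i)) ⊔
          (if i = d then ⊥ else LinearMap.range (actL (M := L) (e (i + 1)))) := by
  rintro _ ⟨_, ⟨x, rfl⟩, rfl⟩
  change b • e i • x ∈ _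
  rw [← h.sum_smul_eq (b • e i • x)]
  refine Submodule.sum_mem _ fun j hj => ?_
  rw [Finset.mem_range] at hj
  have hmem : e j • b • e i • x ∈ LinearMap.range (actL (M := L) (e j)) := ⟨_, rfl⟩
  by_cases h1 : j + 1 = i
  · refine Submodule.mem_sup_left (Submodule.mem_sup_left ?_)
    rw [if_neg (by omega)]
    rwa [show i - 1 = j by omega]
  by_cases h2 : j = i
  · exact Submodule.mem_sup_left (Submodule.mem_sup_right (h2 ▸ hmem))
  by_cases h3 : j = i + 1
  · refine Submodule.mem_sup_right ?_
    rw [if_neg (by omega)]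
    rwa [← h3]
  · have := htrs j i 1 (by omega)
    rw [pow_one] at this
    rw [← mul_smul, ← mul_smul, this, zero_smul]
    exact Submodule.zero_mem _

/-- A simple `T`-module generated by a vector `v` with `e*_0 v = v` and `g_i v = 0` for
`1 ≤ i ≤ d` is a sharp tridiagonal system with parameter array `(θ; θs; ζ)`. -/
theorem sharpTDWithArray_of_isSimpleModule [IsSimpleModule (TAlg F d θ θs) L]
    (h : EigCond F d θ θs) {μ : MvPolynomial (Fin d) F →ₗ[F] TAlg F d θ θs}
    (hμ : MuProps F d θ θs μ) {ζ : ℕ → F} (hζ : ZetaCond F d θ θs ζ) {v : L} (hv0 : v ≠ 0)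
    (hv : esT F d θ θs 0 • v = v) (hg : ∀ i ∈ Set.Icc 1 d, gElt F d θ θs ζ i • v = 0) :
    SharpTDWithArray F L d (actL (aT F d θ θs)) (actL (asT F d θ θs))
      (fun i => actL (eT F d θ θs i)) (fun i => actL (esT F d θ θs i)) θ θs ζ := by
  have hcomm : SMulCommClass F (TAlg F d θ θs) L := IsScalarTower.to_smulCommClass
  obtain ⟨hθ, hθs, -⟩ := h
  obtain ⟨hζ0, hζd, hζsum⟩ := hζ
  have he := idemDecomp_eT (F := F) (d := d) (θ := θ) (θs := θs)
  have hes := idemDecomp_esT (F := F) (d := d) (θ := θ) (θs := θs)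
  have htr := tridRel_esT (F := F) (d := d) (θ := θ) (θs := θs)
  have htrs := tridRel_eT (F := F) (d := d) (θ := θ) (θs := θs)
  have hirr := eq_bot_or_eq_top_of_invariant (L := L) hθ hθs
  have hspan := estar_zero_smul_mem_span hμ hζ0 hv0 hv hg
  have hfin : Module.Finite F L :=
    module_finite_of_irreducible he hes htr htrs hθ hθs hirr hv0 hv hspan
  have hprod : ∏ j ∈ Finset.Icc 1 d, (θs 0 - θs j) ≠ 0 := by
    refine Finset.prod_ne_zero_iff.2 fun j hj => sub_ne_zero.2 ?_
    rw [Finset.mem_Icc] at hj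
    exact hθs 0 j (Nat.zero_le d) hj.2 (by omega)
  have hlast : esT F d θ θs 0 • eT F d θ θs d • v ≠ 0 := by
    have h1 := split_smul hζ0 hv hg le_rfl
    rw [aeval_tauPoly he, smul_assoc, smul_comm] at h1
    intro h0
    rw [h0, smul_zero] at h1
    exact smul_ne_zero (div_ne_zero hζd hprod) hv0 h1.symm
  have hfirst : esT F d θ θs 0 • eT F d θ θs 0 • v ≠ 0 := by
    have h1 := eta_smul hθs hζ0 hv hg
    rw [aeval_etaPoly he, smul_assoc, smul_comm] at h1
    intro h0
    rw [h0, smul_zero] at h1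
    exact smul_ne_zero (div_ne_zero hζsum hprod) hv0 h1.symm
  have hne : ∀ x : TAlg F d θ θs, (∃ y : L, x • y ≠ 0) → actL (M := L) x ≠ 0 := by
    rintro x ⟨y, hy⟩ h0
    exact hy (LinearMap.congr_fun h0 y)
  have hcomp : ∀ x y : TAlg F d θ θs, actL (M := L) x ∘ₗ actL y = actL (x * y) :=
    fun x y => LinearMap.ext fun z => (mul_smul x y z).symm
  have hsum : ∀ (c : ℕ → F) (e : ℕ → TAlg F d θ θs), ∑ i ∈ Finset.range (d + 1),
      c i • actL (M := L) (e i) = actL (∑ i ∈ Finset.range (d + 1), c i • e i) := by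
    intro c e
    refine LinearMap.ext fun x => ?_
    rw [LinearMap.sum_apply]
    change _ = (∑ i ∈ Finset.range (d + 1), c i • e i) • x
    rw [Finset.sum_smul]
    exact Finset.sum_congr rfl fun i _ => (smul_assoc (c i) (e i) x).symm
  have hsum1 : ∀ e : ℕ → TAlg F d θ θs, ∑ i ∈ Finset.range (d + 1), e i = 1 →
      ∑ i ∈ Finset.range (d + 1), actL (M := L) (e i) = LinearMap.id := by
    intro e h1
    have := hsum (fun _ => 1) e
    simp only [one_smul, h1] at this
    rw [this]
    exact LinearMap.ext fun x => one_smul _ x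
  have hmul : ∀ {e : ℕ → TAlg F d θ θs}, (∀ i j, e i * e j = if i = j then e i else 0) →
      ∀ i j, actL (M := L) (e i) ∘ₗ actL (e j) = if i = j then actL (e i) else 0 := by
    intro e h1 i j
    rw [hcomp, h1]
    split_ifs
    · rfl
    · exact LinearMap.ext fun x => zero_smul _ x
  refine ⟨⟨hfin, ?_, hθ, hθs, ?_, ?_, fun i j _ _ => hmul he.mul_eq i j,
    fun i j _ _ => hmul hes.mul_eq i j, hsum1 _ he.sum_eq_one, hsum1 _ hes.sum_eq_one, ?_, ?_,
    fun i _ => map_range_actL_le he htrs i, fun i _ => map_range_actL_le hes htr i,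
    hirr⟩, ?_, ?_⟩
  · have : Nontrivial L := ⟨v, 0, hv0⟩
    exact Module.finrank_pos
  · intro i hi
    refine hne _ (exists_smul_ne_zero_of_endpoints he htrs hirr ⟨v, fun h0 => hfirst ?_⟩
      ⟨v, fun h0 => hlast ?_⟩ hi)
    · rw [h0, smul_zero]
    · rw [h0, smul_zero]
  · intro i hi
    exact hne _ (exists_smul_ne_zero_of_endpoints hes htr (fun W hb ha => hirr W ha hb)
      ⟨v, by rwa [hv]⟩
      (exists_estar_last_smul_ne_zero hes htrs hθs hv0 hv hspan hfirst hlast) hi)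
  · rw [hsum, ← he.eq_sum]
  · rw [hsum, ← hes.eq_sum]
  · have hrange : LinearMap.range (actL (M := L) (esT F d θ θs 0)) = Submodule.span F {v} := by
      refine le_antisymm ?_ ?_
      · rintro _ ⟨x, rfl⟩
        exact hspan x
      · rw [Submodule.span_singleton_le_iff_mem]
        exact ⟨v, hv⟩
    rw [hrange]
    exact finrank_span_singleton hv0
  · intro i hi
    refine LinearMap.ext fun x => ?_
    have haeval : aeval (actL (M := L) (aT F d θ θs)) (tauPoly θ i) =
        actL (aeval (aT F d θ θs) (tauPoly θ i)) :=
      aeval_algHom_apply (Algebra.lsmul F F L) (aT F d θ θs) (tauPoly θ i)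
    rw [haeval]
    change esT F d θ θs 0 • aeval (aT F d θ θs) (tauPoly θ i) • esT F d θ θs 0 • x =
      (ζ i / ∏ h ∈ Finset.Icc 1 i, (θs 0 - θs h)) • esT F d θ θs 0 • x
    obtain ⟨c, hc⟩ := Submodule.mem_span_singleton.1 (hspan x)
    rw [← hc, smul_comm _ c v, smul_comm _ c (_ • v), split_smul hζ0 hv hg hi, smul_comm]

end TAlgebra

/-- If `μ` is an isomorphism, `M'` is the unique maximal proper `T`-submodule of `M = T/J`,
and `L = M/M'`, then `(a; {e_i}_{i=0}^d; a*; {e*_i}_{i=0}^d)` acts on `L` as a sharp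
tridiagonal system with parameter array `({θ_i}; {θ*_i}; {ζ_i})`. -/
theorem stmt16 {F : Type*} [Field F] (d : ℕ) (θ θs : ℕ → F) (h : EigCond F d θ θs)
    (μ : MvPolynomial (Fin d) F →ₗ[F] TAlg F d θ θs) (hμ : MuProps F d θ θs μ)
    (hinj : Function.Injective μ)
    (ζ : ℕ → F) (hζ : ZetaCond F d θ θs ζ)
    (M' : Submodule (TAlg F d θ θs) (TAlg F d θ θs ⧸ Jideal F d θ θs ζ))
    (hM1 : M' ≠ ⊤)
    (hM2 : ∀ N : Submodule (TAlg F d θ θs) (TAlg F d θ θs ⧸ Jideal F d θ θs ζ),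
      N ≠ ⊤ → M' ≤ N → M' = N) :
    SharpTDWithArray F ((TAlg F d θ θs ⧸ Jideal F d θ θs ζ) ⧸ M') d
      (actL (M := (TAlg F d θ θs ⧸ Jideal F d θ θs ζ) ⧸ M') (aT F d θ θs))
      (actL (M := (TAlg F d θ θs ⧸ Jideal F d θ θs ζ) ⧸ M') (asT F d θ θs))
      (fun i => actL (M := (TAlg F d θ θs ⧸ Jideal F d θ θs ζ) ⧸ M') (eT F d θ θs i))
      (fun i => actL (M := (TAlg F d θ θs ⧸ Jideal F d θ θs ζ) ⧸ M') (esT F d θ θs i))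
      θ θs ζ := by
  have : IsSimpleModule (TAlg F d θ θs) ((TAlg F d θ θs ⧸ Jideal F d θ θs ζ) ⧸ M') :=
    isSimpleModule_iff_isCoatom.2 ⟨hM1, fun N hN => by
      by_contra hNtop
      exact hN.ne (hM2 N hNtop hN.le)⟩
  have hJ : ∀ t : TAlg F d θ θs, t ∈ Jideal F d θ θs ζ →
      t • M'.mkQ ((Jideal F d θ θs ζ).mkQ 1) = 0 := by
    intro t ht
    rw [← map_smul, ← map_smul, smul_eq_mul, mul_one, Submodule.mkQ_apply (Jideal F d θ θs ζ),
      (Submodule.Quotient.mk_eq_zero (Jideal F d θ θs ζ)).2 ht, map_zero]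
  refine sharpTDWithArray_of_isSimpleModule h hμ hζ
    (v := M'.mkQ ((Jideal F d θ θs ζ).mkQ 1)) ?_ ?_ ?_
  · intro h0
    refine hM1 (eq_top_iff.2 fun x _ => ?_)
    obtain ⟨t, rfl⟩ := (Jideal F d θ θs ζ).mkQ_surjective x
    rw [← Submodule.Quotient.mk_eq_zero, ← Submodule.mkQ_apply, ← mul_one t, ← smul_eq_mul,
      map_smul, map_smul, h0, smul_zero]
  · have := hJ (1 - esT F d θ θs 0) (Submodule.subset_span (Or.inl rfl))
    rw [sub_smul, one_smul, sub_eq_zero] at this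
    exact this.symm
  · exact fun i hi => hJ _ (Submodule.subset_span (Or.inr ⟨i, hi, rfl⟩))
end

section
/- Assume that for every nonnegative integer d and all scalars θ_0,…,θ_d, θ*_0,…,θ*_d in F satisfying conditions (i) and (iii) below, the associated map μ : F[x_1,…,x_d] → e*_0 T e*_0 is an isomorphism. Then for every nonnegative integer d and every sequence of scalars ({θ_i}_{i=0}^d; {θ*_i}_{i=0}^d; {ζ_i}_{i=0}^d) taken from F, there exists a sharp tridiagonal system Φ over F with parameter array ({θ_i}_{i=0}^d; {θ*_i}_{i=0}^d; {ζ_i}_{i=0}^d) if and only if: (i) θ_i ≠ θ_j and θ*_i ≠ θ*_j whenever i ≠ j (0 ≤ i,j ≤ d); (ii) ζ_0 = 1, ζ_d ≠ 0, and Σ_{i=0}^d η_{d−i}(θ_0) η*_{d−i}(θ*_0) ζ_i ≠ 0; (iii) the expressions (θ_{i-2}−θ_{i+1})/(θ_{i-1}−θ_i) and (θ*_{i-2}−θ*_{i+1})/(θ*_{i-1}−θ*_i) are equal and independent of i for 2 ≤ i ≤ d−1. Moreover, if (i)–(iii) hold then Φ is unique up to isomorphism of tridiagonal systems. -/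
open Polynomial

/-- A vector-valued function on nodes `θ_0, …, θ_d` that is annihilated by the monomials of
degree `< n` and supported on at most `n` nodes vanishes. -/
theorem eq_zero_of_sum_pow_smul {F M : Type*} [Field F] [AddCommGroup M] [Module F M]
    {d n : ℕ} {θ : ℕ → F} (hθ : ∀ i j, i ≤ d → j ≤ d → i ≠ j → θ i ≠ θ j) (S : Finset ℕ)
    (hS : S.card ≤ n) (u : ℕ → M) (hu : ∀ r ≤ d, r ∉ S → u r = 0)
    (h : ∀ m < n, ∑ r ∈ Finset.range (d + 1), θ r ^ m • u r = 0) :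
    ∀ r ≤ d, u r = 0 := by
  intro r hr
  by_cases hrS : r ∈ S
  swap
  · exact hu r hr hrS
  have hp : ∀ p : F[X], p.natDegree < n →
      ∑ r ∈ Finset.range (d + 1), p.eval (θ r) • u r = 0 := by
    intro p hp
    simp_rw [eval_eq_sum_range, Finset.sum_smul]
    rw [Finset.sum_comm]
    refine Finset.sum_eq_zero fun m hm => ?_
    simp_rw [mul_smul]
    rw [← Finset.smul_sum, h m (by rw [Finset.mem_range] at hm; omega), smul_zero]
  set p : F[X] := ∏ j ∈ (S.erase r).filter (· ≤ d), (X - C (θ j)) with hpdef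
  have hdeg : p.natDegree < n := by
    rw [hpdef, natDegree_prod_of_monic _ _ fun j _ => monic_X_sub_C _]
    simp only [natDegree_X_sub_C, Finset.sum_const, smul_eq_mul, mul_one]
    exact ((Finset.card_filter_le _ _).trans_lt (Finset.card_erase_lt_of_mem hrS)).trans_le hS
  have hsum := hp p hdeg
  rw [Finset.sum_eq_single_of_mem r (Finset.mem_range.2 (by omega))] at hsum
  · refine (smul_eq_zero.1 hsum).resolve_left ?_
    rw [hpdef, eval_prod]
    refine Finset.prod_ne_zero_iff.2 fun j hj => ?_
    simp only [Finset.mem_filter, Finset.mem_erase] at hj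
    simpa [sub_eq_zero] using hθ r j hr hj.2 (Ne.symm hj.1.1)
  · intro j hj hjr
    rw [Finset.mem_range] at hj
    by_cases hjS : j ∈ S
    · have : p.eval (θ j) = 0 := by
        rw [hpdef, eval_prod]
        refine Finset.prod_eq_zero (i := j) ?_ (by simp)
        simp only [Finset.mem_filter, Finset.mem_erase]
        exact ⟨⟨hjr, hjS⟩, by omega⟩
      rw [this, zero_smul]
    · rw [hu j (by omega) hjS, smul_zero]

/-- Vanishing of a three-index array subject to triangle-type conditions.  The hypothesis `hc`
asks that the `n`-th column of a layer vanishes as soon as all earlier rows and columns do. -/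
theorem array_eq_zero_s17 {F M : Type*} [Field F] [AddCommGroup M] [Module F M]
    {d j : ℕ} {θ θs : ℕ → F} (hθ : ∀ i j, i ≤ d → j ≤ d → i ≠ j → θ i ≠ θ j)
    (hθs : ∀ i j, i ≤ d → j ≤ d → i ≠ j → θs i ≠ θs j) (t : ℕ → ℕ → ℕ → M)
    (h0 : ∀ r J s, r ≤ d → s ≤ d → J < j → t r J s = 0)
    (h2 : ∀ r J m, r ≤ d → J ≤ d → m + j < J →
      ∑ s ∈ Finset.range (d + 1), θ s ^ m • t r J s = 0)
    (h3 : ∀ r s m, r ≤ d → s ≤ d → (m + r < s ∨ m + s < r) →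
      ∑ J ∈ Finset.range (d + 1), θs J ^ m • t r J s = 0)
    (hc : ∀ J n, j ≤ J → J ≤ d → n ≤ d →
      (∀ r s, r ≤ d → s ≤ d → (r < n ∨ s < n ∨ r + (J - j) < s ∨ s + (J - j) < r) →
        t r J s = 0) → ∀ r ≤ d, t r J n = 0) :
    ∀ r J s, r ≤ d → J ≤ d → s ≤ d → t r J s = 0 := by
  suffices H : ∀ k J, d < J + k → ∀ r s, r ≤ d → J ≤ d → s ≤ d → t r J s = 0 from
    fun r J s hr hJ hs => H (d + 1) J (by omega) r s hr hJ hs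
  intro k
  induction k with
  | zero => intro J hJ r s _ hJ' _; omega
  | succ k ih =>
    intro J hJk r s hr hJ hs
    by_cases hJj : J < j
    · exact h0 r J s hr hs hJj
    push Not at hJj
    have hfar : ∀ r s, r ≤ d → s ≤ d → (r + (J - j) < s ∨ s + (J - j) < r) → t r J s = 0 := by
      intro r s hr hs hrs
      refine eq_zero_of_sum_pow_smul hθs (Finset.Icc j J) (n := J - j + 1)
        (by simp; omega) (fun J => t r J s) ?_ ?_ J hJ
      · intro J' hJ' hmem
        rw [Finset.mem_Icc] at hmem
        by_cases h : J' < j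
        · exact h0 r J' s hr hs h
        · exact ih J' (by omega) r s hr hJ' hs
      · intro m hm
        exact h3 r s m hr hs (by omega)
    have hsweep : ∀ n, n ≤ d + 1 → ∀ r s, r ≤ d → s ≤ d → (r < n ∨ s < n) → t r J s = 0 := by
      intro n
      induction n with
      | zero => intro _ r s _ _ h; omega
      | succ n ihn =>
        intro hn
        have ihn' := ihn (by omega)
        have hcol : ∀ r ≤ d, t r J n = 0 := by
          refine hc J n hJj hJ (by omega) fun r s hr hs h => ?_
          rcases h with h | h | h
          · exact ihn' r s hr hs (Or.inl h)
          · exact ihn' r s hr hs (Or.inr h)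
          · exact hfar r s hr hs h
        have hrow : ∀ s ≤ d, t n J s = 0 := by
          refine eq_zero_of_sum_pow_smul hθ (Finset.Icc (n + 1) (n + (J - j))) (n := J - j)
            (by simp) (fun s => t n J s) ?_ ?_
          · intro s hs hmem
            rw [Finset.mem_Icc] at hmem
            rcases lt_trichotomy s n with h | h | h
            · exact ihn' n s (by omega) hs (Or.inr h)
            · subst h; exact hcol s hs
            · exact hfar n s (by omega) hs (by omega)
          · intro m hm
            exact h2 n J m (by omega) hJ (by omega)
        intro r s hr hs h
        by_cases hrn : r = n
        · subst hrn; exact hrow s hs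
        by_cases hsn : s = n
        · subst hsn; exact hcol r hr
        exact ihn' r s hr hs (by omega)
    exact hsweep (d + 1) le_rfl r s hr hs (by omega)

/-- The relations satisfied by the generators of `T`, for elements of an arbitrary algebra,
together with the distinctness of the eigenvalues. -/
structure TDRel {F R : Type*} [Field F] [Ring R] [Algebra F R] (d : ℕ) (θ θs : ℕ → F)
    (a as : R) (e es : ℕ → R) : Prop where
  inj : ∀ i j, i ≤ d → j ≤ d → i ≠ j → θ i ≠ θ j
  injs : ∀ i j, i ≤ d → j ≤ d → i ≠ j → θs i ≠ θs j
  orth : ∀ i j, i ≤ d → j ≤ d → e i * e j = if i = j then e i else 0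
  orths : ∀ i j, i ≤ d → j ≤ d → es i * es j = if i = j then es i else 0
  sum : ∑ i ∈ Finset.range (d + 1), e i = 1
  sums : ∑ i ∈ Finset.range (d + 1), es i = 1
  a_eq : a = ∑ i ∈ Finset.range (d + 1), θ i • e i
  as_eq : as = ∑ i ∈ Finset.range (d + 1), θs i • es i
  tri : ∀ i j k, i ≤ d → j ≤ d → (k + i < j ∨ k + j < i) → es i * a ^ k * es j = 0
  tris : ∀ i j k, i ≤ d → j ≤ d → (k + i < j ∨ k + j < i) → e i * as ^ k * e j = 0

namespace TDRel

section Basic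

variable {F R : Type*} [Field F] [Ring R] [Algebra F R] {d : ℕ} {θ θs : ℕ → F}
  {a as : R} {e es : ℕ → R}

theorem dual (h : TDRel d θ θs a as e es) : TDRel d θs θ as a es e :=
  ⟨h.injs, h.inj, h.orths, h.orth, h.sums, h.sum, h.as_eq, h.a_eq, h.tris, h.tri⟩

theorem reverse (h : TDRel d θ θs a as e es) :
    TDRel d (fun i => θ (d - i)) θs a as (fun i => e (d - i)) es where
  inj i j hi hj hij := h.inj _ _ (by omega) (by omega) (by omega)
  injs := h.injs
  orth i j hi hj := by
    rw [h.orth _ _ (by omega) (by omega)]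
    by_cases hij : i = j
    · simp [hij]
    · rw [if_neg (by omega), if_neg hij]
  orths := h.orths
  sum := by
    rw [← h.sum, ← Finset.sum_range_reflect e (d + 1)]
    exact Finset.sum_congr rfl fun i _ => by congr 1
  sums := h.sums
  a_eq := by
    rw [h.a_eq, ← Finset.sum_range_reflect (fun i => θ i • e i) (d + 1)]
    exact Finset.sum_congr rfl fun i _ => by congr 1
  as_eq := h.as_eq
  tri := h.tri
  tris i j k hi hj hk := h.tris _ _ k (by omega) (by omega) (by omega)

theorem e_mul_self (h : TDRel d θ θs a as e es) {i : ℕ} (hi : i ≤ d) : e i * e i = e i := by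
  rw [h.orth i i hi hi, if_pos rfl]

theorem e_mul_of_ne (h : TDRel d θ θs a as e es) {i j : ℕ} (hi : i ≤ d) (hj : j ≤ d)
    (hij : i ≠ j) : e i * e j = 0 := by
  rw [h.orth i j hi hj, if_neg hij]

theorem a_mul_e (h : TDRel d θ θs a as e es) {i : ℕ} (hi : i ≤ d) : a * e i = θ i • e i := by
  rw [h.a_eq, Finset.sum_mul, Finset.sum_eq_single_of_mem i (Finset.mem_range.2 (by omega))]
  · rw [smul_mul_assoc, h.e_mul_self hi]
  · intro j hj hji
    rw [smul_mul_assoc, h.e_mul_of_ne (by simpa [Nat.lt_succ_iff] using hj) hi hji, smul_zero]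

theorem e_mul_a (h : TDRel d θ θs a as e es) {i : ℕ} (hi : i ≤ d) : e i * a = θ i • e i := by
  rw [h.a_eq, Finset.mul_sum, Finset.sum_eq_single_of_mem i (Finset.mem_range.2 (by omega))]
  · rw [mul_smul_comm, h.e_mul_self hi]
  · intro j hj hji
    rw [mul_smul_comm, h.e_mul_of_ne hi (by simpa [Nat.lt_succ_iff] using hj) hji.symm, smul_zero]

theorem aeval_mul_e (h : TDRel d θ θs a as e es) (p : F[X]) {i : ℕ} (hi : i ≤ d) :
    aeval a p * e i = p.eval (θ i) • e i := by
  induction p using Polynomial.induction_on' with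
  | add p q hp hq => rw [map_add, add_mul, hp, hq, eval_add, add_smul]
  | monomial n c =>
    rw [aeval_monomial, eval_monomial, mul_assoc, ← Algebra.smul_def, mul_smul]
    congr 1
    induction n with
    | zero => simp
    | succ n ih => rw [pow_succ, mul_assoc, h.a_mul_e hi, mul_smul_comm, ih, smul_smul, pow_succ']

theorem aeval_eq_sum (h : TDRel d θ θs a as e es) (p : F[X]) :
    aeval a p = ∑ i ∈ Finset.range (d + 1), p.eval (θ i) • e i := by
  rw [← mul_one (aeval a p), ← h.sum, Finset.mul_sum]
  exact Finset.sum_congr rfl fun i hi => h.aeval_mul_e p (by simpa [Nat.lt_succ_iff] using hi)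

theorem pow_eq_sum (h : TDRel d θ θs a as e es) (m : ℕ) :
    a ^ m = ∑ i ∈ Finset.range (d + 1), θ i ^ m • e i := by
  simpa using h.aeval_eq_sum (X ^ m)

theorem e_mul_aeval (h : TDRel d θ θs a as e es) (p : F[X]) {i : ℕ} (hi : i ≤ d) :
    e i * aeval a p = p.eval (θ i) • e i := by
  rw [h.aeval_eq_sum, Finset.mul_sum,
    Finset.sum_eq_single_of_mem i (Finset.mem_range.2 (by omega))]
  · rw [mul_smul_comm, h.e_mul_self hi]
  · intro j hj hji
    rw [mul_smul_comm, h.e_mul_of_ne hi (by simpa [Nat.lt_succ_iff] using hj) hji.symm, smul_zero]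

/-- Each idempotent `e i` is a polynomial in `a`. -/
theorem exists_aeval_eq (h : TDRel d θ θs a as e es) {i : ℕ} (hi : i ≤ d) :
    ∃ p : F[X], aeval a p = e i := by
  refine ⟨Lagrange.basis (Finset.range (d + 1)) θ i, ?_⟩
  have hinj : Set.InjOn θ (Finset.range (d + 1) : Set ℕ) := by
    intro x hx y hy hxy
    by_contra hne
    simp only [Finset.coe_range, Set.mem_Iio] at hx hy
    exact h.inj x y (by omega) (by omega) hne hxy
  rw [h.aeval_eq_sum, Finset.sum_eq_single_of_mem i (Finset.mem_range.2 (by omega))]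
  · rw [Lagrange.eval_basis_self hinj (Finset.mem_range.2 (by omega)), one_smul]
  · intro j hj hji
    rw [Lagrange.eval_basis_of_ne hji.symm hj, zero_smul]

theorem tri_aeval (h : TDRel d θ θs a as e es) {i j : ℕ} (hi : i ≤ d) (hj : j ≤ d) (p : F[X])
    (hp : p.natDegree + i < j ∨ p.natDegree + j < i) : es i * aeval a p * es j = 0 := by
  rw [aeval_eq_sum_range, Finset.mul_sum, Finset.sum_mul]
  refine Finset.sum_eq_zero fun k hk => ?_
  rw [Finset.mem_range] at hk
  rw [mul_smul_comm, smul_mul_assoc, h.tri i j k hi hj (by omega), smul_zero]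

theorem map {R' : Type*} [Ring R'] [Algebra F R'] (h : TDRel d θ θs a as e es)
    (f : R →ₐ[F] R') : TDRel d θ θs (f a) (f as) (fun i => f (e i)) (fun i => f (es i)) where
  inj := h.inj
  injs := h.injs
  orth i j hi hj := by rw [← map_mul, h.orth i j hi hj]; split_ifs <;> simp
  orths i j hi hj := by rw [← map_mul, h.orths i j hi hj]; split_ifs <;> simp
  sum := by rw [← map_sum, h.sum, map_one]
  sums := by rw [← map_sum, h.sums, map_one]
  a_eq := by simp [h.a_eq, map_sum]
  as_eq := by simp [h.as_eq, map_sum]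
  tri i j k hi hj hk := by rw [← map_pow, ← map_mul, ← map_mul, h.tri i j k hi hj hk, map_zero]
  tris i j k hi hj hk := by rw [← map_pow, ← map_mul, ← map_mul, h.tris i j k hi hj hk, map_zero]

/-- A sufficient condition for the `(i, j, k)` pieces to lie in a subspace: the pieces with a
smaller middle index lie in it. -/
theorem mem_of_forall_lt (h : TDRel d θ θs a as e es) {i j k : ℕ} (hi : i < j) (hj : j ≤ d)
    (hk : k ≤ j) (S : Submodule F R)
    (hS : ∀ J r s, J < j → r ≤ d → s ≤ d → es i * e r * es J * e s * es k ∈ S)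
    {r s : ℕ} (hr : r ≤ d) (hs : s ≤ d) : es i * e r * es j * e s * es k ∈ S := by
  have hcol : ∀ J s m, J ≤ d → s ≤ d → m + j ≤ J → ∑ r ∈ Finset.range (d + 1),
      θ r ^ m • S.mkQ (es i * e r * es J * e s * es k) = 0 := by
    intro J s m hJ hs hm
    have := congrArg (fun x => S.mkQ (x * e s * es k)) (h.tri i J m (by omega) hJ (by omega))
    simpa [h.pow_eq_sum, Finset.mul_sum, Finset.sum_mul] using this
  have key := array_eq_zero_s17 (j := j) h.inj h.injs
    (fun r J s => S.mkQ (es i * e r * es J * e s * es k)) ?_ ?_ ?_ ?_ r j s hr hj hs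
  · simpa using key
  · intro r J s hr hs hJ
    simpa using hS J r s hJ hr hs
  · intro r J m hr hJ hm
    have := congrArg (fun x => S.mkQ (es i * e r * x)) (h.tri J k m hJ (by omega) (by omega))
    simpa [h.pow_eq_sum, Finset.mul_sum, Finset.sum_mul, mul_assoc] using this
  · intro r s m hr hs hm
    have := congrArg (fun x => S.mkQ (es i * x * es k)) (h.tris r s m hr hs hm)
    simpa [h.dual.pow_eq_sum, Finset.mul_sum, Finset.sum_mul, mul_assoc] using this
  · intro J n hjJ hJ hn hvan
    refine eq_zero_of_sum_pow_smul h.inj (Finset.Icc n (n + (J - j))) (n := J - j + 1)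
      (by simp; omega) _ ?_ ?_
    · intro r hr hmem
      rw [Finset.mem_Icc] at hmem
      exact hvan r n hr hn (by omega)
    · intro m hm
      exact hcol J n m hJ hn (by omega)

theorem mem_of_forall_lt' (h : TDRel d θ θs a as e es) {i j k : ℕ} (hi : i ≤ j) (hj : j ≤ d)
    (hk : k < j) (S : Submodule F R)
    (hS : ∀ J r s, J < j → r ≤ d → s ≤ d → es i * e r * es J * e s * es k ∈ S)
    {r s : ℕ} (hr : r ≤ d) (hs : s ≤ d) : es i * e r * es j * e s * es k ∈ S := by
  have hcol : ∀ J r m, J ≤ d → r ≤ d → m + j ≤ J → ∑ s ∈ Finset.range (d + 1),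
      θ s ^ m • S.mkQ (es i * e r * es J * e s * es k) = 0 := by
    intro J r m hJ hr hm
    have := congrArg (fun x => S.mkQ (es i * e r * x)) (h.tri J k m hJ (by omega) (by omega))
    simpa [h.pow_eq_sum, Finset.mul_sum, Finset.sum_mul, mul_assoc] using this
  have key := array_eq_zero_s17 (j := j) h.inj h.injs
    (fun s J r => S.mkQ (es i * e r * es J * e s * es k)) ?_ ?_ ?_ ?_ s j r hs hj hr
  · simpa using key
  · intro s J r hs hr hJ
    simpa using hS J r s hJ hr hs
  · intro s J m hs hJ hm
    have := congrArg (fun x => S.mkQ (x * e s * es k)) (h.tri i J m (by omega) hJ (by omega))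
    simpa [h.pow_eq_sum, Finset.mul_sum, Finset.sum_mul] using this
  · intro s r m hs hr hm
    have := congrArg (fun x => S.mkQ (es i * x * es k)) (h.tris r s m hr hs (by omega))
    simpa [h.dual.pow_eq_sum, Finset.mul_sum, Finset.sum_mul, mul_assoc] using this
  · intro J n hjJ hJ hn hvan
    refine eq_zero_of_sum_pow_smul h.inj (Finset.Icc n (n + (J - j))) (n := J - j + 1)
      (by simp; omega) _ ?_ ?_
    · intro s hs hmem
      rw [Finset.mem_Icc] at hmem
      exact hvan s n hs hn (by omega)
    · intro m hm
      exact hcol J n m hJ hn (by omega)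

/-- The elements `es 0 * e r * es 0` commute. -/
theorem corner_comm (h : TDRel d θ θs a as e es) {r s : ℕ} (hr : r ≤ d) (hs : s ≤ d) :
    es 0 * e r * es 0 * e s * es 0 = es 0 * e s * es 0 * e r * es 0 := by
  have hcol : ∀ r J m, r ≤ d → J ≤ d → m < J → ∑ s ∈ Finset.range (d + 1),
      θ s ^ m • (es 0 * e r * es J * e s * es 0 - es 0 * e s * es J * e r * es 0) = 0 := by
    intro r J m hr hJ hm
    have h1 := congrArg (fun x => es 0 * e r * x) (h.tri J 0 m hJ (by omega) (by omega))
    have h2 := congrArg (fun x => x * e r * es 0) (h.tri 0 J m (by omega) hJ (by omega))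
    simp only [h.pow_eq_sum, Finset.mul_sum, Finset.sum_mul, mul_smul_comm, smul_mul_assoc,
      mul_zero, zero_mul] at h1 h2
    simp only [smul_sub, Finset.sum_sub_distrib, h2, sub_zero]
    simpa only [mul_assoc] using h1
  refine sub_eq_zero.1 (array_eq_zero_s17 (F := F) (j := 0) h.inj h.injs (fun r J s =>
    es 0 * e r * es J * e s * es 0 - es 0 * e s * es J * e r * es 0) ?_ ?_ ?_ ?_ r 0 s hr
    (by omega) hs)
  · intro r J s _ _ hJ
    omega
  · intro r J m hr hJ hm
    exact hcol r J m hr hJ (by omega)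
  · intro r s m hr hs hm
    have h1 := congrArg (fun x => es 0 * x * es 0) (h.tris r s m hr hs hm)
    have h2 := congrArg (fun x => es 0 * x * es 0) (h.tris s r m hs hr (by omega))
    simp only [h.dual.pow_eq_sum, Finset.mul_sum, Finset.sum_mul, mul_smul_comm, smul_mul_assoc,
      mul_zero, zero_mul] at h1 h2
    simp only [smul_sub, Finset.sum_sub_distrib]
    simp only [mul_assoc] at h1 h2 ⊢
    rw [h1, h2, sub_zero]
  · intro J n _ hJ hn hvan r hr
    rw [← neg_eq_zero, neg_sub]
    refine eq_zero_of_sum_pow_smul h.inj (Finset.Icc (n + 1) (n + J)) (n := J) (by simp)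
      (fun s => es 0 * e n * es J * e s * es 0 - es 0 * e s * es J * e n * es 0) ?_ ?_ r hr
    · intro s hs hmem
      rw [Finset.mem_Icc] at hmem
      rcases eq_or_ne s n with rfl | hsn
      · exact sub_self _
      · exact hvan n s hn hs (by omega)
    · intro m hm
      exact hcol n J m hn hJ hm

end Basic

end TDRel

/-- `CornerWord d e es m n i w` says that `w` is a product
`es i * e r₁ * es κ₁ * e r₂ * ⋯ * e rₙ * es 0` with all `κ`'s at most `m`. -/
inductive CornerWord {R : Type*} [Ring R] (d : ℕ) (e es : ℕ → R) (m : ℕ) : ℕ → ℕ → R → Prop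
  | nil : CornerWord d e es m 0 0 (es 0)
  | cons {n i r j : ℕ} {w : R} (hj : j ≤ m) (hr : r ≤ d) (hw : CornerWord d e es m n j w) :
      CornerWord d e es m (n + 1) i (es i * e r * w)

namespace TDRel

variable {F R : Type*} [Field F] [Ring R] [Algebra F R] {d : ℕ} {θ θs : ℕ → F}
  {a as : R} {e es : ℕ → R}

theorem es_mul_cornerWord (h : TDRel d θ θs a as e es) {m n i : ℕ} {w : R} (hi : i ≤ d)
    (hw : CornerWord d e es m n i w) : es i * w = w := by
  cases hw with
  | nil => exact h.dual.e_mul_self hi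
  | cons _ _ _ => rw [← mul_assoc, ← mul_assoc, h.dual.e_mul_self hi]

theorem cornerWord_mul_es (h : TDRel d θ θs a as e es) {m n i : ℕ} {w : R}
    (hw : CornerWord d e es m n i w) : w * es 0 = w := by
  induction hw with
  | nil => exact h.dual.e_mul_self (Nat.zero_le d)
  | cons _ _ _ ih => rw [mul_assoc, ih]

theorem mul_mem_span_cornerWord {m n i j r : ℕ} {w : R} (hj : j ≤ m) (hr : r ≤ d)
    (hw : w ∈ Submodule.span F {w | CornerWord d e es m n j w}) :
    es i * e r * w ∈ Submodule.span F {w | CornerWord d e es m (n + 1) i w} := by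
  have : Submodule.span F {w | CornerWord d e es m n j w} ≤
      (Submodule.span F {w | CornerWord d e es m (n + 1) i w}).comap
        (LinearMap.mulLeft F (es i * e r)) :=
    Submodule.span_le.2 fun w hw => Submodule.subset_span (CornerWord.cons hj hr hw)
  exact this hw

theorem cornerWord_mem_span_pred (h : TDRel d θ θs a as e es) {m n i : ℕ} {w : R}
    (hm : m + 1 ≤ d) (hi : i ≤ m) (hw : CornerWord d e es (m + 1) n i w) :
    w ∈ Submodule.span F {w | CornerWord d e es m n i w} := by
  induction n generalizing i w with
  | zero =>
    cases hw
    exact Submodule.subset_span CornerWord.nil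
  | succ n ih =>
    obtain - | @⟨_, _, r, j, w', hj, hr, hw'⟩ := hw
    rcases hj.lt_or_eq with hj | rfl
    · exact mul_mem_span_cornerWord (by omega) hr (ih (by omega) hw')
    · have hgen := hw'
      obtain - | @⟨n', _, s, k, w'', hk, hs, hw''⟩ := hw'
      have hS := h.mem_of_forall_lt (i := i) (j := m + 1) (k := k) (by omega) hm hk
        ((Submodule.span F {w | CornerWord d e es m (n' + 1 + 1) i w}).comap
          (LinearMap.mulRight F w'')) ?_ hr hs
      · simpa [mul_assoc, h.es_mul_cornerWord (hk.trans hm) hw''] using hS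
      · intro J r s hJ hr hs
        have := mul_mem_span_cornerWord (F := F) (i := i) (by omega) hr
          (ih (by omega) (CornerWord.cons (i := J) hk hs hw''))
        simpa [mul_assoc, h.es_mul_cornerWord (hk.trans hm) hw''] using this

theorem cornerWord_mem_span (h : TDRel d θ θs a as e es) {m n i : ℕ} {w : R}
    (hm : m ≤ d) (hi : i ≤ m) (hw : CornerWord d e es d n i w) :
    w ∈ Submodule.span F {w | CornerWord d e es m n i w} := by
  induction hm using Nat.decreasingInduction with
  | self => exact Submodule.subset_span hw
  | of_succ m hm ih =>
    exact Submodule.span_le.2 (fun w hw => h.cornerWord_mem_span_pred hm hi hw) (ih (by omega))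

/-- A subspace containing `es 0` and closed under left multiplication by the generators contains
`x * es 0` for all `x`; consequently `es i * x * es 0` is a combination of words. -/
theorem mul_es_zero_mem_span (h : TDRel d θ θs a as e es)
    (hgen : ∀ N : Submodule F R, (∀ i ≤ d, ∀ y ∈ N, e i * y ∈ N) →
      (∀ i ≤ d, ∀ y ∈ N, es i * y ∈ N) → ∀ x, ∀ y ∈ N, x * y ∈ N) {i : ℕ} (hi : i ≤ d) (x : R) :
    es i * x * es 0 ∈ Submodule.span F {w | ∃ n, CornerWord d e es d n i w} := by
  set N := Submodule.span F {w | ∃ n j, j ≤ d ∧ CornerWord d e es d n j w}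
  have hN : x * es 0 ∈ N := by
    refine hgen N ?_ ?_ x _ (Submodule.subset_span ⟨0, 0, by omega, CornerWord.nil⟩)
    · intro r hr
      change N ≤ N.comap (LinearMap.mulLeft F (e r))
      refine Submodule.span_le.2 ?_
      rintro w ⟨n, j, hj, hw⟩
      change e r * w ∈ N
      rw [← one_mul (e r * w), ← h.sums, Finset.sum_mul]
      refine Submodule.sum_mem _ fun k hk => Submodule.subset_span ⟨n + 1, k, ?_, ?_⟩
      · simpa [Nat.lt_succ_iff] using hk
      · rw [← mul_assoc]
        exact CornerWord.cons hj hr hw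
    · intro k hk
      change N ≤ N.comap (LinearMap.mulLeft F (es k))
      refine Submodule.span_le.2 ?_
      rintro w ⟨n, j, hj, hw⟩
      change es k * w ∈ N
      rw [← h.es_mul_cornerWord hj hw, ← mul_assoc, h.orths k j hk hj]
      split_ifs with hkj
      · subst hkj
        rw [h.es_mul_cornerWord hj hw]
        exact Submodule.subset_span ⟨n, k, hj, hw⟩
      · simp
  have hle : N ≤ (Submodule.span F {w | ∃ n, CornerWord d e es d n i w}).comap
      (LinearMap.mulLeft F (es i)) := by
    refine Submodule.span_le.2 ?_
    rintro w ⟨n, j, hj, hw⟩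
    change es i * w ∈ Submodule.span F _
    rw [← h.es_mul_cornerWord hj hw, ← mul_assoc, h.orths i j hi hj]
    split_ifs with hij
    · subst hij
      rw [h.es_mul_cornerWord hj hw]
      exact Submodule.subset_span ⟨n, hw⟩
    · simp
  rw [mul_assoc]
  exact hle hN

theorem mul_es_zero_mem_span_le (h : TDRel d θ θs a as e es)
    (hgen : ∀ N : Submodule F R, (∀ i ≤ d, ∀ y ∈ N, e i * y ∈ N) →
      (∀ i ≤ d, ∀ y ∈ N, es i * y ∈ N) → ∀ x, ∀ y ∈ N, x * y ∈ N) {i : ℕ} (hi : i ≤ d) (x : R) :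
    es i * x * es 0 ∈ Submodule.span F {w | ∃ n, CornerWord d e es i n i w} := by
  refine Submodule.span_le.2 ?_ (h.mul_es_zero_mem_span hgen hi x)
  rintro w ⟨n, hw⟩
  exact Submodule.span_mono (fun w hw => Exists.intro n hw) (h.cornerWord_mem_span hi le_rfl hw)

/-- `aeval a p` is a combination of the `τ_i(a)` with `i ≤ d`. -/
theorem aeval_mem_span_tauPoly (h : TDRel d θ θs a as e es) (p : F[X]) :
    aeval a p ∈ Submodule.span F {y | ∃ i ≤ d, y = aeval a (tauPoly θ i)} := by
  set N := Submodule.span F {y | ∃ i ≤ d, y = aeval a (tauPoly θ i)}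
  have hmul : N ≤ N.comap (LinearMap.mulLeft F a) := by
    refine Submodule.span_le.2 ?_
    rintro _ ⟨i, hi, rfl⟩
    change a * aeval a (tauPoly θ i) ∈ N
    have hrec : a * aeval a (tauPoly θ i) =
        aeval a (tauPoly θ (i + 1)) + θ i • aeval a (tauPoly θ i) := by
      rw [tauPoly, tauPoly, Finset.prod_range_succ, ← map_smul, ← map_add]
      have : a * aeval a (∏ j ∈ Finset.range i, (X - C (θ j))) =
          aeval a (X * ∏ j ∈ Finset.range i, (X - C (θ j))) := by simp
      rw [this, smul_eq_C_mul]
      congr 1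
      ring
    rw [hrec]
    refine N.add_mem ?_ (N.smul_mem _ (Submodule.subset_span ⟨i, hi, rfl⟩))
    rcases hi.lt_or_eq with hi | rfl
    · exact Submodule.subset_span ⟨i + 1, hi, rfl⟩
    · rw [h.aeval_eq_sum]
      convert N.zero_mem
      refine Finset.sum_eq_zero fun j hj => ?_
      rw [tauPoly, eval_prod, Finset.prod_eq_zero hj (by simp), zero_smul]
  have hone : (1 : R) ∈ N := Submodule.subset_span ⟨0, by omega, by simp [tauPoly]⟩
  induction p using Polynomial.induction_on' with
  | add p q hp hq => rw [map_add]; exact N.add_mem hp hq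
  | monomial n c =>
    rw [aeval_monomial, ← Algebra.smul_def]
    refine N.smul_mem _ ?_
    induction n with
    | zero => simpa using hone
    | succ n ih => rw [pow_succ']; exact hmul ih

/-- The corner `es 0 * R * es 0` is generated by the elements `es 0 * τ_i(a) * es 0`. -/
theorem corner_mem (h : TDRel d θ θs a as e es)
    (hgen : ∀ N : Submodule F R, (∀ i ≤ d, ∀ y ∈ N, e i * y ∈ N) →
      (∀ i ≤ d, ∀ y ∈ N, es i * y ∈ N) → ∀ x, ∀ y ∈ N, x * y ∈ N)
    (N : Submodule F R) (hone : es 0 ∈ N) (hmul : ∀ x ∈ N, ∀ y ∈ N, x * y ∈ N)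
    (htau : ∀ i, 1 ≤ i → i ≤ d → es 0 * aeval a (tauPoly θ i) * es 0 ∈ N) (x : R) :
    es 0 * x * es 0 ∈ N := by
  have he : ∀ r ≤ d, es 0 * e r * es 0 ∈ N := by
    intro r hr
    obtain ⟨p, hp⟩ := h.exists_aeval_eq hr
    rw [← hp]
    have : Submodule.span F {y | ∃ i ≤ d, y = aeval a (tauPoly θ i)} ≤
        N.comap ((LinearMap.mulLeft F (es 0)).comp (LinearMap.mulRight F (es 0))) := by
      refine Submodule.span_le.2 ?_
      rintro _ ⟨i, hi, rfl⟩
      change es 0 * (aeval a (tauPoly θ i) * es 0) ∈ N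
      rcases Nat.eq_zero_or_pos i with rfl | hi0
      · simpa [tauPoly, h.dual.e_mul_self (Nat.zero_le d)] using hone
      · rw [← mul_assoc]; exact htau i hi0 hi
    rw [mul_assoc]
    exact this (h.aeval_mem_span_tauPoly p)
  have hword : ∀ n w, CornerWord d e es 0 n 0 w → w ∈ N := by
    intro n
    induction n with
    | zero => intro w hw; cases hw; exact hone
    | succ n ih =>
      intro w hw
      obtain - | @⟨_, _, r, j, w', hj, hr, hw'⟩ := hw
      obtain rfl : j = 0 := by omega
      rw [← h.es_mul_cornerWord (Nat.zero_le d) hw', ← mul_assoc]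
      exact hmul _ (he r hr) _ (ih _ hw')
  refine Submodule.span_le.2 ?_ (h.mul_es_zero_mem_span_le hgen (Nat.zero_le d) x)
  rintro w ⟨n, hw⟩
  exact hword n w hw

/-- For `i > 0`, the space `es i * R * es 0` is reached from the spaces `es j * R * es 0`
with `j < i`. -/
theorem mul_es_zero_mem_span_lt (h : TDRel d θ θs a as e es)
    (hgen : ∀ N : Submodule F R, (∀ i ≤ d, ∀ y ∈ N, e i * y ∈ N) →
      (∀ i ≤ d, ∀ y ∈ N, es i * y ∈ N) → ∀ x, ∀ y ∈ N, x * y ∈ N) {i : ℕ} (hi0 : 0 < i)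
    (hi : i ≤ d) (x : R) :
    es i * x * es 0 ∈ Submodule.span F
      {w | ∃ j < i, ∃ s ≤ d, ∃ y, w = es i * e s * (es j * y * es 0)} := by
  set S := Submodule.span F {w | ∃ j < i, ∃ s ≤ d, ∃ y, w = es i * e s * (es j * y * es 0)}
  have hword : ∀ n w, CornerWord d e es i n i w → w ∈ S := by
    intro n
    induction n with
    | zero => intro w hw; cases hw; omega
    | succ n ih =>
      intro w hw
      obtain - | @⟨_, _, r, j, w', hj, hr, hw'⟩ := hw
      rcases hj.lt_or_eq with hj | rfl
      · refine Submodule.subset_span ⟨j, hj, r, hr, w', ?_⟩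
        rw [h.es_mul_cornerWord (by omega) hw', h.cornerWord_mul_es hw']
      · have : S ≤ S.comap (LinearMap.mulLeft F (es j * e r)) := by
          refine Submodule.span_le.2 ?_
          rintro _ ⟨k, hk, s, hs, y, rfl⟩
          have := h.mem_of_forall_lt' (i := j) (j := j) (k := k) le_rfl hi hk
            (S.comap (LinearMap.mulRight F (y * es 0))) ?_ hr hs
          · simpa [mul_assoc] using this
          · intro J r s hJ hr hs
            exact Submodule.subset_span ⟨J, hJ, r, hr, e s * es k * y, by simp [mul_assoc]⟩
        exact this (ih _ hw')
  refine Submodule.span_le.2 ?_ (h.mul_es_zero_mem_span_le hgen hi x)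
  rintro w ⟨n, hw⟩
  exact hword n w hw

/-- The elements `es 0 * p(a) * es 0` commute. -/
theorem corner_comm_aeval (h : TDRel d θ θs a as e es) (p q : F[X]) :
    Commute (es 0 * aeval a p * es 0) (es 0 * aeval a q * es 0) := by
  have h00 : es 0 * es 0 = es 0 := h.dual.e_mul_self (Nat.zero_le d)
  have hes : ∀ r s, r ≤ d → s ≤ d → Commute (es 0 * e r * es 0) (es 0 * e s * es 0) := by
    intro r s hr hs
    have := h.corner_comm hr hs
    have hx : ∀ x y : R, es 0 * x * es 0 * (es 0 * y * es 0) = es 0 * x * es 0 * y * es 0 := by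
      intro x y
      rw [← mul_assoc, ← mul_assoc, mul_assoc (es 0 * x), h00]
    rw [Commute, SemiconjBy, hx, hx, this]
  rw [h.aeval_eq_sum p, h.aeval_eq_sum q]
  simp only [Finset.mul_sum, Finset.sum_mul, mul_smul_comm, smul_mul_assoc]
  refine Commute.sum_left _ _ _ fun r hr => Commute.sum_right _ _ _ fun s hs => ?_
  rw [Finset.mem_range] at hr hs
  exact ((hes r s (by omega) (by omega)).smul_left _).smul_right _

end TDRel

section Presented

variable {F : Type*} [Field F] {d : ℕ} {θ θs : ℕ → F}

theorem eT_of_le {i : ℕ} (hi : i < d + 1) :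
    eT F d θ θs i = tgen F d θ θs (TGen.e ⟨i, hi⟩) := dif_pos hi

theorem esT_of_le {i : ℕ} (hi : i < d + 1) :
    esT F d θ θs i = tgen F d θ θs (TGen.estar ⟨i, hi⟩) := dif_pos hi

theorem tdRel_tAlg (hθ : ∀ i j, i ≤ d → j ≤ d → i ≠ j → θ i ≠ θ j)
    (hθs : ∀ i j, i ≤ d → j ≤ d → i ≠ j → θs i ≠ θs j) :
    TDRel d θ θs (aT F d θ θs) (asT F d θ θs) (eT F d θ θs) (esT F d θ θs) where
  inj := hθ
  injs := hθs
  orth i j hi hj := by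
    have := RingQuot.mkAlgHom_rel F (TRel.ee (F := F) (θ := θ) (θs := θs)
      ⟨i, Nat.lt_succ_of_le hi⟩ ⟨j, Nat.lt_succ_of_le hj⟩)
    rw [eT_of_le (Nat.lt_succ_of_le hi), eT_of_le (Nat.lt_succ_of_le hj), tgen, tgen, ← map_mul,
      this]
    by_cases hij : i = j <;> simp [hij]
  orths i j hi hj := by
    have := RingQuot.mkAlgHom_rel F (TRel.eses (F := F) (θ := θ) (θs := θs)
      ⟨i, Nat.lt_succ_of_le hi⟩ ⟨j, Nat.lt_succ_of_le hj⟩)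
    rw [esT_of_le (Nat.lt_succ_of_le hi), esT_of_le (Nat.lt_succ_of_le hj), tgen, tgen, ← map_mul,
      this]
    by_cases hij : i = j <;> simp [hij]
  sum := by
    have := RingQuot.mkAlgHom_rel F (TRel.sum_e (F := F) (d := d) (θ := θ) (θs := θs))
    rw [map_sum, map_one] at this
    rw [← Fin.sum_univ_eq_sum_range, ← this]
    exact Finset.sum_congr rfl fun i _ => eT_of_le i.2
  sums := by
    have := RingQuot.mkAlgHom_rel F (TRel.sum_estar (F := F) (d := d) (θ := θ) (θs := θs))
    rw [map_sum, map_one] at this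
    rw [← Fin.sum_univ_eq_sum_range, ← this]
    exact Finset.sum_congr rfl fun i _ => esT_of_le i.2
  a_eq := by
    have := RingQuot.mkAlgHom_rel F (TRel.a_eq (F := F) (d := d) (θ := θ) (θs := θs))
    rw [map_sum] at this
    rw [← Fin.sum_univ_eq_sum_range (fun i => θ i • eT F d θ θs i), aT, tgen, this]
    refine Finset.sum_congr rfl fun i _ => ?_
    rw [map_smul, eT_of_le i.2, tgen]
  as_eq := by
    have := RingQuot.mkAlgHom_rel F (TRel.astar_eq (F := F) (d := d) (θ := θ) (θs := θs))
    rw [map_sum] at this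
    rw [← Fin.sum_univ_eq_sum_range (fun i => θs i • esT F d θ θs i), asT, tgen, this]
    refine Finset.sum_congr rfl fun i _ => ?_
    rw [map_smul, esT_of_le i.2, tgen]
  tri i j k hi hj hk := by
    have := RingQuot.mkAlgHom_rel F (TRel.trid (F := F) (θ := θ) (θs := θs)
      ⟨i, Nat.lt_succ_of_le hi⟩ ⟨j, Nat.lt_succ_of_le hj⟩ k (by omega) (by simp; omega))
    rwa [map_mul, map_mul, map_pow, map_zero, ← tgen, ← tgen, ← tgen, ← aT, ← esT_of_le,
      ← esT_of_le] at this
  tris i j k hi hj hk := by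
    have := RingQuot.mkAlgHom_rel F (TRel.tridstar (F := F) (θ := θ) (θs := θs)
      ⟨i, Nat.lt_succ_of_le hi⟩ ⟨j, Nat.lt_succ_of_le hj⟩ k (by omega) (by simp; omega))
    rwa [map_mul, map_mul, map_pow, map_zero, ← tgen, ← tgen, ← tgen, ← asT, ← eT_of_le,
      ← eT_of_le] at this

/-- A subspace closed under left multiplication by the idempotents is a left ideal of `T`. -/
theorem tAlg_mul_mem (hθ : ∀ i j, i ≤ d → j ≤ d → i ≠ j → θ i ≠ θ j)
    (hθs : ∀ i j, i ≤ d → j ≤ d → i ≠ j → θs i ≠ θs j) (N : Submodule F (TAlg F d θ θs))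
    (he : ∀ i ≤ d, ∀ y ∈ N, eT F d θ θs i * y ∈ N)
    (hes : ∀ i ≤ d, ∀ y ∈ N, esT F d θ θs i * y ∈ N) (x : TAlg F d θ θs) :
    ∀ y ∈ N, x * y ∈ N := by
  have h := tdRel_tAlg hθ hθs
  obtain ⟨x, rfl⟩ := RingQuot.mkAlgHom_surjective F _ x
  induction x using FreeAlgebra.induction with
  | grade0 c =>
    intro y hy
    rw [AlgHom.commutes, ← Algebra.smul_def]
    exact N.smul_mem c hy
  | grade1 g =>
    intro y hy
    rw [← tgen]
    cases g with
    | a =>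
      rw [← aT, h.a_eq, Finset.sum_mul]
      refine N.sum_mem fun i hi => ?_
      rw [smul_mul_assoc]
      exact N.smul_mem _ (he i (by simpa [Nat.lt_succ_iff] using hi) y hy)
    | astar =>
      rw [← asT, h.as_eq, Finset.sum_mul]
      refine N.sum_mem fun i hi => ?_
      rw [smul_mul_assoc]
      exact N.smul_mem _ (hes i (by simpa [Nat.lt_succ_iff] using hi) y hy)
    | e i =>
      have := he i (Nat.lt_succ_iff.1 i.2) y hy
      rwa [eT_of_le i.2] at this
    | estar i =>
      have := hes i (Nat.lt_succ_iff.1 i.2) y hy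
      rwa [esT_of_le i.2] at this
  | mul x x' hx hx' =>
    intro y hy
    rw [map_mul, mul_assoc]
    exact hx _ (hx' _ hy)
  | add x x' hx hx' =>
    intro y hy
    rw [map_add, add_mul]
    exact N.add_mem (hx _ hy) (hx' _ hy)

open scoped IsMulCommutative in
/-- The homomorphism from the polynomial ring onto the corner `e*_0 T e*_0` exists. -/
theorem exists_muProps (hθ : ∀ i j, i ≤ d → j ≤ d → i ≠ j → θ i ≠ θ j)
    (hθs : ∀ i j, i ≤ d → j ≤ d → i ≠ j → θs i ≠ θs j) :
    ∃ μ : MvPolynomial (Fin d) F →ₗ[F] TAlg F d θ θs, MuProps F d θ θs μ := by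
  have h := tdRel_tAlg hθ hθs
  have h00 : esT F d θ θs 0 * esT F d θ θs 0 = esT F d θ θs 0 :=
    h.dual.e_mul_self (Nat.zero_le d)
  set y : Fin d → TAlg F d θ θs := fun i =>
    esT F d θ θs 0 * (aeval (aT F d θ θs) (tauPoly θ ((i : ℕ) + 1))) * esT F d θ θs 0 with hy
  have hcomm : IsMulCommutative (Algebra.adjoin F (Set.range y)) := by
    refine Algebra.isMulCommutative_adjoin F ?_
    rintro _ ⟨i, rfl⟩ _ ⟨j, rfl⟩
    exact h.corner_comm_aeval _ _
  let ψ : MvPolynomial (Fin d) F →ₐ[F] Algebra.adjoin F (Set.range y) :=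
    MvPolynomial.aeval fun i => ⟨y i, Algebra.subset_adjoin ⟨i, rfl⟩⟩
  have hψX : ∀ i, (ψ (MvPolynomial.X i) : TAlg F d θ θs) = y i := fun i => by simp [ψ]
  have hcommute : ∀ p, Commute (esT F d θ θs 0) (ψ p : TAlg F d θ θs) := by
    intro p
    refine Algebra.commute_of_mem_adjoin_of_forall_mem_commute (ψ p).2 ?_
    rintro _ ⟨i, rfl⟩
    change _ * _ = _ * _
    simp only [hy]
    rw [mul_assoc _ (esT F d θ θs 0) (esT F d θ θs 0), h00, ← mul_assoc, ← mul_assoc, h00]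
  set μ : MvPolynomial (Fin d) F →ₗ[F] TAlg F d θ θs :=
    (LinearMap.mulLeft F (esT F d θ θs 0)).comp
      ((Algebra.adjoin F (Set.range y)).val.toLinearMap.comp ψ.toLinearMap) with hμ
  have hμa : ∀ p, μ p = esT F d θ θs 0 * (ψ p : TAlg F d θ θs) := fun p => rfl
  have h1 : μ 1 = esT F d θ θs 0 := by rw [hμa, map_one]; simp
  have hm : ∀ p q, μ (p * q) = μ p * μ q := by
    intro p q
    rw [hμa, hμa, hμa, map_mul, mul_assoc, ← mul_assoc _ (esT F d θ θs 0), ← (hcommute p).eq,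
      mul_assoc, ← mul_assoc (esT F d θ θs 0) (esT F d θ θs 0), h00]
    simp
  have hX : ∀ i : Fin d, μ (MvPolynomial.X i) = y i := by
    intro i
    rw [hμa, hψX]
    simp only [hy]
    rw [← mul_assoc, ← mul_assoc, h00]
  refine ⟨μ, h1, hm, hX, le_antisymm ?_ ?_⟩
  · rintro _ ⟨p, rfl⟩
    refine ⟨ψ p, ?_⟩
    change esT F d θ θs 0 * ((ψ p : TAlg F d θ θs) * esT F d θ θs 0) = _
    rw [hμa, ← (hcommute p).eq, ← mul_assoc, h00]
  · rintro _ ⟨x, rfl⟩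
    change esT F d θ θs 0 * (x * esT F d θ θs 0) ∈ _
    rw [← mul_assoc]
    refine h.corner_mem (tAlg_mul_mem hθ hθs) (LinearMap.range μ) ⟨1, h1⟩ ?_ ?_ x
    · rintro _ ⟨p, rfl⟩ _ ⟨q, rfl⟩
      exact ⟨p * q, hm p q⟩
    · intro i hi1 hid
      refine ⟨MvPolynomial.X ⟨i - 1, by omega⟩, ?_⟩
      rw [hX, hy]
      simp only
      rw [Nat.sub_add_cancel hi1]

/-- If the map from the polynomial ring onto the corner is injective, then the corner has a
character with prescribed values on the generators; here it is extended to a functional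
on `T`. -/
theorem exists_character (hθ : ∀ i j, i ≤ d → j ≤ d → i ≠ j → θ i ≠ θ j)
    (hθs : ∀ i j, i ≤ d → j ≤ d → i ≠ j → θs i ≠ θs j)
    (hmu : ∀ μ : MvPolynomial (Fin d) F →ₗ[F] TAlg F d θ θs, MuProps F d θ θs μ →
        Function.Injective μ) (c : ℕ → F) (hc : c 0 = 1) :
    ∃ f : TAlg F d θ θs →ₗ[F] F, f (esT F d θ θs 0) = 1 ∧
      (∀ x y, f (esT F d θ θs 0 * x * esT F d θ θs 0 * (esT F d θ θs 0 * y * esT F d θ θs 0)) =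
        f (esT F d θ θs 0 * x * esT F d θ θs 0) * f (esT F d θ θs 0 * y * esT F d θ θs 0)) ∧
      ∀ i ≤ d, f (esT F d θ θs 0 * aeval (aT F d θ θs) (tauPoly θ i) * esT F d θ θs 0) = c i := by
  obtain ⟨μ, hμ⟩ := exists_muProps hθ hθs
  obtain ⟨ν, hν⟩ := LinearMap.exists_leftInverse_of_injective μ (LinearMap.ker_eq_bot.2 (hmu μ hμ))
  obtain ⟨h1, hm, hX, hr⟩ := hμ
  have hν' : ∀ p, ν (μ p) = p := fun p => LinearMap.congr_fun hν p
  have hcor : ∀ x, ∃ p, μ p = esT F d θ θs 0 * x * esT F d θ θs 0 := by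
    intro x
    have : esT F d θ θs 0 * x * esT F d θ θs 0 ∈ LinearMap.range μ := by
      rw [hr]
      exact ⟨x, by simp [mul_assoc]⟩
    exact this
  set ε : MvPolynomial (Fin d) F →ₐ[F] F := MvPolynomial.aeval fun i : Fin d => c ((i : ℕ) + 1)
  refine ⟨ε.toLinearMap.comp ν, ?_, ?_, ?_⟩
  · simp [← h1, hν']
  · intro x y
    obtain ⟨p, hp⟩ := hcor x
    obtain ⟨q, hq⟩ := hcor y
    rw [← hp, ← hq, ← hm]
    simp [hν']
  · intro i hi
    rcases Nat.eq_zero_or_pos i with rfl | hi0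
    · have h00 : esT F d θ θs 0 * esT F d θ θs 0 = esT F d θ θs 0 :=
        (tdRel_tAlg hθ hθs).dual.e_mul_self (Nat.zero_le d)
      have hμ1 : esT F d θ θs 0 * aeval (aT F d θ θs) (tauPoly θ 0) * esT F d θ θs 0 = μ 1 := by
        rw [h1]; simp [tauPoly, h00]
      rw [hμ1]
      simp [hν', hc]
    · obtain ⟨k, rfl⟩ : ∃ k, i = k + 1 := ⟨i - 1, by omega⟩
      have := hX ⟨k, by omega⟩
      simp only at this
      rw [← this]
      simp [hν', ε]

end Presented

namespace TDRel

section Recurrence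

variable {F R : Type*} [Field F] [Ring R] [Algebra F R] {d : ℕ} {θ θs : ℕ → F}
  {a as : R} {e es : ℕ → R}

theorem ext_of_e_mul (h : TDRel d θ θs a as e es) {x y : R}
    (hxy : ∀ i j, i ≤ d → j ≤ d → e i * x * e j = e i * y * e j) : x = y := by
  have hsum : ∀ z : R, z = ∑ i ∈ Finset.range (d + 1), ∑ j ∈ Finset.range (d + 1),
      e i * z * e j := by
    intro z
    simp_rw [← Finset.mul_sum, ← Finset.sum_mul, h.sum, one_mul, mul_one]
  rw [hsum x, hsum y]
  refine Finset.sum_congr rfl fun i hi => Finset.sum_congr rfl fun j hj => ?_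
  exact hxy i j (by simpa [Nat.lt_succ_iff] using hi) (by simpa [Nat.lt_succ_iff] using hj)

theorem tri_two_step_eq_zero (h : TDRel d θ θs a as e es) {p l q m n : ℕ} (hp : p ≤ d)
    (hl : l ≤ d) (hq : q ≤ d) (hlt : q + n < l ∨ l + m < p) :
    es p * a ^ m * es l * (a ^ n * es q) = 0 := by
  rcases hlt with hlt | hlt
  · rw [mul_assoc (es p * a ^ m), ← mul_assoc (es l), h.tri l q n hl hq (by omega), mul_zero]
  · rw [h.tri p l m hp hl (by omega), zero_mul]

theorem tri_split (h : TDRel d θ θs a as e es) {q m n : ℕ} (hd : q + n + m ≤ d) :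
    es (q + n + m) * a ^ (m + n) * es q =
      es (q + n + m) * a ^ m * es (q + n) * (a ^ n * es q) := by
  calc es (q + n + m) * a ^ (m + n) * es q
      = es (q + n + m) * a ^ m * 1 * (a ^ n * es q) := by simp [pow_add, mul_assoc]
    _ = _ := by
      rw [← h.sums, Finset.mul_sum, Finset.sum_mul,
        Finset.sum_eq_single_of_mem (q + n) (Finset.mem_range.2 (by omega))]
      intro l hl hne
      rw [Finset.mem_range] at hl
      exact h.tri_two_step_eq_zero hd (by omega) (by omega) (by omega)

theorem tri_insert (h : TDRel d θ θs a as e es) {q m n : ℕ} (hd : q + n + m ≤ d) :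
    es (q + n + m) * (a ^ m * as * a ^ n) * es q =
      θs (q + n) • (es (q + n + m) * a ^ (m + n) * es q) := by
  rw [h.tri_split hd, h.as_eq]
  simp only [Finset.mul_sum, Finset.sum_mul]
  rw [Finset.sum_eq_single_of_mem (q + n) (Finset.mem_range.2 (by omega))]
  · simp [mul_assoc]
  · intro l hl hne
    rw [Finset.mem_range] at hl
    have := h.tri_two_step_eq_zero (p := q + n + m) (l := l) (q := q) (m := m) (n := n)
      hd (by omega) (by omega) (by omega)
    simp only [mul_smul_comm, smul_mul_assoc]
    simp only [mul_assoc] at this ⊢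
    rw [this, smul_zero]

theorem tri_insert_eq_zero (h : TDRel d θ θs a as e es) {p q m n : ℕ} (hp : p ≤ d)
    (hd : q + n + m < p) : es p * (a ^ m * as * a ^ n) * es q = 0 := by
  rw [h.as_eq]
  simp only [Finset.mul_sum, Finset.sum_mul]
  refine Finset.sum_eq_zero fun l hl => ?_
  rw [Finset.mem_range] at hl
  have := h.tri_two_step_eq_zero (p := p) (l := l) (q := q) (m := m) (n := n)
    hp (by omega) (by omega) (by omega)
  simp only [mul_smul_comm, smul_mul_assoc]
  simp only [mul_assoc] at this ⊢
  rw [this, smul_zero]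

theorem tri_aeval_leading (h : TDRel d θ θs a as e es) {q k : ℕ} (hd : q + k ≤ d) {p : F[X]}
    (hp : p.natDegree ≤ k) :
    es (q + k) * aeval a p * es q = p.coeff k • (es (q + k) * a ^ k * es q) := by
  rw [aeval_eq_sum_range' (Nat.lt_succ_of_le hp), Finset.mul_sum, Finset.sum_mul,
    Finset.sum_eq_single_of_mem k (Finset.self_mem_range_succ k)]
  · simp
  · intro l hl hlk
    rw [Finset.mem_range] at hl
    rw [mul_smul_comm, smul_mul_assoc, h.tri _ _ l hd (by omega) (by omega), smul_zero]

theorem aeval_tauPoly (h : TDRel d θ θs a as e es) :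
    aeval a (tauPoly θ d) = (tauPoly θ d).eval (θ d) • e d := by
  rw [h.aeval_eq_sum, Finset.sum_eq_single_of_mem d (Finset.self_mem_range_succ d)]
  intro j hj hjd
  rw [Finset.mem_range] at hj
  rw [tauPoly, eval_prod, Finset.prod_eq_zero (Finset.mem_range.2 (by omega : j < d)) (by simp),
    zero_smul]

theorem eval_tauPoly_ne_zero (h : TDRel d θ θs a as e es) : (tauPoly θ d).eval (θ d) ≠ 0 := by
  rw [tauPoly, eval_prod]
  refine Finset.prod_ne_zero_iff.2 fun j hj => ?_
  rw [Finset.mem_range] at hj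
  simpa [sub_eq_zero] using h.inj d j le_rfl hj.le hj.ne'

theorem es_mul_pow_mul_es_ne_zero (h : TDRel d θ θs a as e es) (hne : es d * e d * es 0 ≠ 0)
    {q k : ℕ} (hd : q + k ≤ d) : es (q + k) * a ^ k * es q ≠ 0 := by
  have htop : es d * a ^ d * es 0 ≠ 0 := by
    intro h0
    have hlead := h.tri_aeval_leading (q := 0) (k := d) (by omega) (p := tauPoly θ d)
      (by simp [tauPoly, natDegree_prod_of_monic _ _ fun j _ => monic_X_sub_C (θ j)])
    rw [zero_add, h0, smul_zero, h.aeval_tauPoly, mul_smul_comm, smul_mul_assoc] at hlead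
    exact hne ((smul_eq_zero.1 hlead).resolve_left h.eval_tauPoly_ne_zero)
  have h1 : es (q + k) * a ^ (q + k) * es 0 ≠ 0 := by
    intro h0
    apply htop
    have := h.tri_split (q := 0) (n := q + k) (m := d - (q + k)) (by omega)
    rw [zero_add, Nat.add_sub_cancel' hd, Nat.sub_add_cancel hd] at this
    rw [this, mul_assoc (_ * _), ← mul_assoc (es (q + k)), h0, mul_zero]
  intro h0
  apply h1
  have := h.tri_split (q := 0) (n := q) (m := k) (by omega)
  rw [zero_add, add_comm k q] at this
  rw [this, h0, zero_mul]

/-- A polynomial in `a` expressing the antisymmetric element `a² a* a − a a* a²`. -/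
theorem exists_commutator_poly (h : TDRel d θ θs a as e es) :
    ∃ p : F[X], p.natDegree ≤ d ∧
      (∀ i, i + 1 ≤ d → p.eval (θ i) - p.eval (θ (i + 1)) =
        θ i * θ (i + 1) * (θ i - θ (i + 1))) ∧
      a ^ 2 * as * a ^ 1 - a ^ 1 * as * a ^ 2 = aeval a p * as - as * aeval a p := by
  have hinj : Set.InjOn θ (Finset.range (d + 1) : Set ℕ) := by
    intro x hx y hy hxy
    by_contra hne
    simp only [Finset.coe_range, Set.mem_Iio] at hx hy
    exact h.inj x y (by omega) (by omega) hne hxy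
  set g : ℕ → F := fun i => -∑ k ∈ Finset.range i, θ k * θ (k + 1) * (θ k - θ (k + 1)) with hg
  set p := Lagrange.interpolate (Finset.range (d + 1)) θ g with hp
  have heval : ∀ i ≤ d, p.eval (θ i) = g i := fun i hi =>
    Lagrange.eval_interpolate_at_node g hinj (Finset.mem_range.2 (by omega))
  have hstep : ∀ i, i + 1 ≤ d → p.eval (θ i) - p.eval (θ (i + 1)) =
      θ i * θ (i + 1) * (θ i - θ (i + 1)) := by
    intro i hi
    rw [heval i (by omega), heval (i + 1) hi]
    simp only [hg]
    rw [Finset.sum_range_succ]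
    ring
  refine ⟨p, ?_, hstep, ?_⟩
  · have := Lagrange.degree_interpolate_lt g hinj
    rw [Finset.card_range] at this
    exact natDegree_le_iff_coeff_eq_zero.2 fun N hN => (degree_lt_iff_coeff_zero _ _).1 this N hN
  · refine h.ext_of_e_mul fun i j hi hj => ?_
    have hL : ∀ q r : F[X], e i * (aeval a q * as * aeval a r) * e j =
        (q.eval (θ i) * r.eval (θ j)) • (e i * as * e j) := by
      intro q r
      rw [← mul_assoc, ← mul_assoc, h.e_mul_aeval q hi, mul_assoc _ (aeval a r),
        h.aeval_mul_e r hj, smul_mul_assoc, smul_mul_assoc, mul_smul_comm, smul_smul]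
    have h1 := hL (X ^ 2) (X ^ 1)
    have h2 := hL (X ^ 1) (X ^ 2)
    have h3 := hL p 1
    have h4 := hL 1 p
    simp only [map_pow, aeval_X, eval_pow, eval_X, map_one, mul_one, one_mul, eval_one]
      at h1 h2 h3 h4
    rw [mul_sub, mul_sub, sub_mul, sub_mul, h1, h2, h3, h4, ← sub_smul, ← sub_smul]
    rcases lt_trichotomy i j with hij | rfl | hij
    · rcases (Nat.succ_le_of_lt hij).lt_or_eq with hij' | rfl
      · have := h.tris i j 1 hi hj (by omega)
        rw [pow_one] at this
        rw [this, smul_zero, smul_zero]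
      · congr 1
        rw [hstep i hj]
        simp only [Nat.succ_eq_add_one]
        ring
    · congr 1
      ring
    · rcases (Nat.succ_le_of_lt hij).lt_or_eq with hij' | rfl
      · have := h.tris i j 1 hi hj (by omega)
        rw [pow_one] at this
        rw [this, smul_zero, smul_zero]
      · congr 1
        have := hstep j hi
        simp only [Nat.succ_eq_add_one]
        linear_combination this

/-- The three-term recurrence for both eigenvalue sequences. -/
theorem eigCond (h : TDRel d θ θs a as e es) (hne : es d * e d * es 0 ≠ 0) :
    EigCond F d θ θs := by
  refine ⟨h.inj, h.injs, ?_⟩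
  by_cases hd : d < 3
  · exact ⟨0, fun i _ _ => by omega⟩
  push Not at hd
  obtain ⟨p, hpd, hstep, hcomm⟩ := h.exists_commutator_poly
  have hR : ∀ k q, q + k ≤ d → p.natDegree ≤ k →
      es (q + k) * (aeval a p * as - as * aeval a p) * es q =
        ((θs q - θs (q + k)) * p.coeff k) • (es (q + k) * a ^ k * es q) := by
    intro k q hq hk
    rw [mul_sub, sub_mul, ← mul_assoc, ← mul_assoc, mul_assoc (_ * _) as, h.dual.a_mul_e (by omega),
      h.dual.e_mul_a hq, mul_smul_comm, smul_mul_assoc, smul_mul_assoc, h.tri_aeval_leading hq hk,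
      ← sub_smul, smul_smul]
  have hdeg : p.natDegree ≤ 3 := by
    by_contra hlt
    push Not at hlt
    have h1 := hR p.natDegree 0 (by omega) le_rfl
    rw [← hcomm, mul_sub, sub_mul, h.tri_insert_eq_zero (by omega) (by omega),
      h.tri_insert_eq_zero (by omega) (by omega), sub_zero] at h1
    rcases smul_eq_zero.1 h1.symm with h2 | h2
    · rcases mul_eq_zero.1 h2 with h3 | h3
      · exact h.injs 0 (0 + p.natDegree) (by omega) (by omega) (by omega) (sub_eq_zero.1 h3)
      · rw [coeff_natDegree, leadingCoeff_eq_zero] at h3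
        rw [h3, natDegree_zero] at hlt
        omega
    · exact h.es_mul_pow_mul_es_ne_zero hne (by omega) h2
  set c := p.coeff 3 with hc
  have hs : ∀ i, i + 3 ≤ d → θs (i + 1) - θs (i + 2) = c * (θs i - θs (i + 3)) := by
    intro i hi
    have h1 := hR 3 i hi hdeg
    have h2 := h.tri_insert (q := i) (n := 1) (m := 2) (by omega)
    have h3 := h.tri_insert (q := i) (n := 2) (m := 1) (by omega)
    rw [← hcomm, mul_sub, sub_mul, h2, h3] at h1
    rw [← sub_smul, ← sub_eq_zero, ← sub_smul] at h1
    have := (smul_eq_zero.1 h1).resolve_right (h.es_mul_pow_mul_es_ne_zero hne hi)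
    linear_combination this
  have hc0 : c ≠ 0 := by
    intro h0
    have := hs 0 hd
    rw [h0, zero_mul, sub_eq_zero] at this
    exact h.injs _ _ (by omega) (by omega) (by omega) this
  have hquad : ∀ i, i + 1 ≤ d → θ i * θ (i + 1) =
      c * (θ i ^ 2 + θ i * θ (i + 1) + θ (i + 1) ^ 2) + p.coeff 2 * (θ i + θ (i + 1)) +
        p.coeff 1 := by
    intro i hi
    have h1 := hstep i hi
    rw [eval_eq_sum_range' (Nat.lt_succ_of_le hdeg), eval_eq_sum_range' (Nat.lt_succ_of_le hdeg)]
      at h1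
    simp only [Finset.sum_range_succ, Finset.sum_range_zero] at h1
    refine mul_right_cancel₀ (sub_ne_zero.2 (h.inj i (i + 1) (by omega) hi (by omega))) ?_
    rw [← h1, hc]
    ring
  have hlin : ∀ i, i + 2 ≤ d → θ (i + 1) = c * (θ i + θ (i + 1) + θ (i + 2)) + p.coeff 2 := by
    intro i hi
    have h1 := hquad i (by omega)
    have h2 := hquad (i + 1) hi
    refine mul_right_cancel₀ (sub_ne_zero.2 (h.inj i (i + 2) (by omega) hi (by omega))) ?_
    linear_combination h1 - h2
  have ht : ∀ i, i + 3 ≤ d → θ (i + 1) - θ (i + 2) = c * (θ i - θ (i + 3)) := by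
    intro i hi
    linear_combination hlin i (by omega) - hlin (i + 1) hi
  refine ⟨c⁻¹, fun i hi2 hid => ?_⟩
  obtain ⟨k, rfl⟩ : ∃ k, i = k + 2 := ⟨i - 2, by omega⟩
  rw [show k + 2 - 2 = k by omega, show k + 2 - 1 = k + 1 by omega, ht k hid, hs k hid,
    inv_mul_cancel_left₀ hc0, inv_mul_cancel_left₀ hc0]
  exact ⟨rfl, rfl⟩

end Recurrence

end TDRel

theorem etaPoly_eq_prod_Ico {F : Type*} [Field F] {d i : ℕ} (θ : ℕ → F) (hi : i ≤ d) :
    etaPoly d θ (d - i) = ∏ j ∈ Finset.Ico (i + 1) (d + 1), (X - C (θ j)) := by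
  rw [etaPoly, Finset.prod_Ico_eq_prod_range, ← Finset.prod_range_reflect]
  have hdi : d + 1 - (i + 1) = d - i := by omega
  rw [hdi]
  refine Finset.prod_congr rfl fun j hj => ?_
  rw [Finset.mem_range] at hj
  congr 3
  omega

theorem prod_Ico_eq_sum_tauPoly {F : Type*} [Field F] (θ : ℕ → F) (n : ℕ) :
    ∏ j ∈ Finset.Ico 1 (n + 1), (X - C (θ j)) =
      ∑ i ∈ Finset.range (n + 1),
        C (∏ j ∈ Finset.Ico (i + 1) (n + 1), (θ 0 - θ j)) * tauPoly θ i := by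
  induction n with
  | zero => simp [tauPoly]
  | succ n ih =>
    have htau : tauPoly θ (n + 1) = (X - C (θ 0)) * ∏ j ∈ Finset.Ico 1 (n + 1), (X - C (θ j)) := by
      rw [tauPoly, Finset.range_eq_Ico, Finset.prod_eq_prod_Ico_succ_bot (Nat.succ_pos n)]
    rw [Finset.sum_range_succ, Finset.prod_Ico_succ_top (by omega : 1 ≤ n + 1),
      Finset.Ico_self, Finset.prod_empty, C_1, one_mul, htau]
    have hstep : ∑ i ∈ Finset.range (n + 1),
        C (∏ j ∈ Finset.Ico (i + 1) (n + 1 + 1), (θ 0 - θ j)) * tauPoly θ i =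
        (∏ j ∈ Finset.Ico 1 (n + 1), (X - C (θ j))) * (C (θ 0) - C (θ (n + 1))) := by
      rw [ih, Finset.sum_mul]
      refine Finset.sum_congr rfl fun i hi => ?_
      rw [Finset.mem_range] at hi
      rw [Finset.prod_Ico_succ_top (by omega : i + 1 ≤ n + 1), C_mul, C_sub]
      ring
    rw [hstep]
    ring

theorem eval_etaPoly_zero_ne_zero {F : Type*} [Field F] {d : ℕ} {θ : ℕ → F}
    (hθ : ∀ i j, i ≤ d → j ≤ d → i ≠ j → θ i ≠ θ j) : (etaPoly d θ d).eval (θ 0) ≠ 0 := by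
  rw [etaPoly, eval_prod]
  refine Finset.prod_ne_zero_iff.2 fun j hj => ?_
  rw [Finset.mem_range] at hj
  simpa [sub_eq_zero] using hθ 0 (d - j) (by omega) (by omega) (by omega)

namespace TDRel

section SplitSequence

variable {F R : Type*} [Field F] [Ring R] [Algebra F R] {d : ℕ} {θ θs ζ : ℕ → F}
  {a as : R} {e es : ℕ → R}

theorem aeval_etaPoly (h : TDRel d θ θs a as e es) :
    aeval a (etaPoly d θ d) = (etaPoly d θ d).eval (θ 0) • e 0 := by
  rw [h.aeval_eq_sum, Finset.sum_eq_single_of_mem 0 (by simp)]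
  intro j hj hj0
  rw [Finset.mem_range] at hj
  rw [etaPoly, eval_prod, Finset.prod_eq_zero (Finset.mem_range.2 (by omega : d - j < d)), zero_smul]
  rw [show d - (d - j) = j by omega]
  simp

theorem prod_sub_ne_zero (h : TDRel d θ θs a as e es) {i : ℕ} (hi : i ≤ d) :
    ∏ j ∈ Finset.Icc 1 i, (θs 0 - θs j) ≠ 0 := by
  refine Finset.prod_ne_zero_iff.2 fun j hj => ?_
  rw [Finset.mem_Icc] at hj
  exact sub_ne_zero.2 (h.injs 0 j (by omega) (by omega) (by omega))

theorem smul_es_mul_e_zero_mul_es (h : TDRel d θ θs a as e es)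
    (hz : ∀ i ≤ d, es 0 * aeval a (tauPoly θ i) * es 0 =
      (ζ i / ∏ j ∈ Finset.Icc 1 i, (θs 0 - θs j)) • es 0) :
    ((etaPoly d θs d).eval (θs 0) * (etaPoly d θ d).eval (θ 0)) • (es 0 * e 0 * es 0) =
      (∑ i ∈ Finset.range (d + 1),
        (etaPoly d θ (d - i)).eval (θ 0) * (etaPoly d θs (d - i)).eval (θs 0) * ζ i) • es 0 := by
  have h1 : (etaPoly d θ d).eval (θ 0) • (es 0 * e 0 * es 0) =
      es 0 * aeval a (etaPoly d θ d) * es 0 := by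
    rw [h.aeval_etaPoly, mul_smul_comm, smul_mul_assoc]
  have h2 := etaPoly_eq_prod_Ico θ (Nat.zero_le d)
  rw [Nat.sub_zero, zero_add, prod_Ico_eq_sum_tauPoly] at h2
  rw [mul_smul, h1, h2, map_sum, Finset.mul_sum, Finset.sum_mul, Finset.smul_sum, Finset.sum_smul]
  refine Finset.sum_congr rfl fun i hi => ?_
  rw [Finset.mem_range, Nat.lt_succ_iff] at hi
  rw [map_mul, aeval_C, ← Algebra.smul_def, mul_smul_comm, smul_mul_assoc, hz i hi, smul_smul,
    smul_smul]
  congr 1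
  have h3 := etaPoly_eq_prod_Ico θs (Nat.zero_le d)
  rw [Nat.sub_zero, zero_add] at h3
  rw [h3, etaPoly_eq_prod_Ico θ hi, etaPoly_eq_prod_Ico θs hi, eval_prod, eval_prod, eval_prod]
  simp only [eval_sub, eval_X, eval_C]
  rw [← Finset.prod_Ico_consecutive _ (by omega : 1 ≤ i + 1) (by omega : i + 1 ≤ d + 1)]
  have h4 := h.prod_sub_ne_zero hi
  rw [← Finset.Ico_add_one_right_eq_Icc] at h4 ⊢
  field_simp

theorem smul_es_mul_e_last_mul_es (h : TDRel d θ θs a as e es)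
    (hz : ∀ i ≤ d, es 0 * aeval a (tauPoly θ i) * es 0 =
      (ζ i / ∏ j ∈ Finset.Icc 1 i, (θs 0 - θs j)) • es 0) :
    (tauPoly θ d).eval (θ d) • (es 0 * e d * es 0) =
      (ζ d / ∏ j ∈ Finset.Icc 1 d, (θs 0 - θs j)) • es 0 := by
  rw [← hz d le_rfl, h.aeval_tauPoly, mul_smul_comm, smul_mul_assoc]

end SplitSequence

section Irreducible

variable {F V : Type*} [Field F] [AddCommGroup V] [Module F V] {d : ℕ} {θ θs : ℕ → F}
  {A As : Module.End F V} {E Es : ℕ → Module.End F V}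

theorem sum_apply (h : TDRel d θ θs A As E Es) (x : V) :
    ∑ i ∈ Finset.range (d + 1), E i x = x := by
  have := congrArg (fun f : Module.End F V => f x) h.sum
  simpa using this

theorem e_apply_a (h : TDRel d θ θs A As E Es) {i : ℕ} (hi : i ≤ d) (x : V) :
    E i (A x) = θ i • E i x := by
  have := congrArg (fun f : Module.End F V => f x) (h.e_mul_a hi)
  simpa using this

theorem e_apply_self (h : TDRel d θ θs A As E Es) {i : ℕ} (hi : i ≤ d) (x : V) :
    E i (E i x) = E i x := by
  have := congrArg (fun f : Module.End F V => f x) (h.e_mul_self hi)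
  simpa using this

theorem e_apply_of_ne (h : TDRel d θ θs A As E Es) {i j : ℕ} (hi : i ≤ d) (hj : j ≤ d)
    (hij : i ≠ j) (x : V) : E i (E j x) = 0 := by
  have := congrArg (fun f : Module.End F V => f x) (h.e_mul_of_ne hi hj hij)
  simpa using this

theorem es_apply_a_eq_zero (h : TDRel d θ θs A As E Es) {j : ℕ} (hj : j ≤ d) {x : V}
    (hx : ∀ l ≤ d, Es l x ≠ 0 → l + 1 < j ∨ j + 1 < l) : Es j (A x) = 0 := by
  rw [← h.dual.sum_apply x, map_sum, map_sum]
  refine Finset.sum_eq_zero fun l hl => ?_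
  rw [Finset.mem_range, Nat.lt_succ_iff] at hl
  by_cases h0 : Es l x = 0
  · rw [h0, map_zero, map_zero]
  · have := congrArg (fun f : Module.End F V => f x) (h.tri j l 1 hj hl (by
      have := hx l hl h0
      omega))
    simpa using this

theorem e_zero_apply_ne_zero (h : TDRel d θ θs A As E Es)
    (irr : ∀ W : Submodule F V, (∀ w ∈ W, A w ∈ W) → (∀ w ∈ W, As w ∈ W) → W = ⊥ ∨ W = ⊤)
    (hE : E 0 ≠ 0) {v : V} (hv : v ≠ 0) (hEsv : Es 0 v = v) : E 0 v ≠ 0 := by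
  intro hEv
  let U : ℕ → Submodule F V := fun n =>
    { carrier := {x | (∀ j ≤ d, n ≤ j → Es j x = 0) ∧ ∀ j ≤ d, j < n → E j x = 0}
      add_mem' := fun {x y} hx hy => ⟨fun j hj hn => by rw [map_add, hx.1 j hj hn, hy.1 j hj hn,
        add_zero], fun j hj hn => by rw [map_add, hx.2 j hj hn, hy.2 j hj hn, add_zero]⟩
      zero_mem' := ⟨fun j _ _ => map_zero _, fun j _ _ => map_zero _⟩
      smul_mem' := fun c x hx => ⟨fun j hj hn => by rw [map_smul, hx.1 j hj hn, smul_zero],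
        fun j hj hn => by rw [map_smul, hx.2 j hj hn, smul_zero]⟩ }
  have hU0 : ∀ x ∈ U 0, x = 0 := by
    intro x hx
    rw [← h.dual.sum_apply x]
    exact Finset.sum_eq_zero fun j hj => hx.1 j (by simpa [Nat.lt_succ_iff] using hj) (Nat.zero_le j)
  have hA : ∀ n, ∀ x ∈ U n, A x - θ n • x ∈ U (n + 1) := by
    intro n x hx
    refine ⟨fun j hj hn => ?_, fun j hj hn => ?_⟩
    · rw [map_sub, map_smul, hx.1 j hj (by omega), smul_zero, sub_zero]
      refine h.es_apply_a_eq_zero hj fun l hl hne => ?_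
      by_contra hcon
      exact hne (hx.1 l hl (by omega))
    · rw [map_sub, map_smul, h.e_apply_a hj]
      rcases Nat.lt_succ_iff_lt_or_eq.1 hn with hn | rfl
      · rw [hx.2 j hj hn, smul_zero, smul_zero, sub_zero]
      · exact sub_self _
  have hAs : ∀ n, ∀ x ∈ U (n + 1), As x - θs n • x ∈ U n := by
    intro n x hx
    refine ⟨fun j hj hn => ?_, fun j hj hn => ?_⟩
    · rw [map_sub, map_smul, h.dual.e_apply_a hj]
      rcases hn.eq_or_lt with rfl | hn
      · exact sub_self _
      · rw [hx.1 j hj hn, smul_zero, smul_zero, sub_zero]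
    · rw [map_sub, map_smul, hx.2 j hj (by omega), smul_zero, sub_zero]
      refine h.dual.es_apply_a_eq_zero hj fun l hl hne => ?_
      by_contra hcon
      exact hne (hx.2 l hl (by omega))
  have hle : ∀ n, U n ≤ ⨆ n, U n := le_iSup U
  have hWA : ∀ w ∈ ⨆ n, U n, A w ∈ ⨆ n, U n := by
    intro w hw
    refine (iSup_le fun n x hx => ?_ : (⨆ n, U n) ≤ (⨆ n, U n).comap A) hw
    rw [Submodule.mem_comap, ← sub_add_cancel (A x) (θ n • x)]
    exact add_mem (hle _ (hA n x hx)) (Submodule.smul_mem _ _ (hle n hx))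
  have hWAs : ∀ w ∈ ⨆ n, U n, As w ∈ ⨆ n, U n := by
    intro w hw
    refine (iSup_le fun n x hx => ?_ : (⨆ n, U n) ≤ (⨆ n, U n).comap As) hw
    rw [Submodule.mem_comap]
    cases n with
    | zero => rw [hU0 x hx, map_zero]; exact zero_mem _
    | succ n =>
      rw [← sub_add_cancel (As x) (θs n • x)]
      exact add_mem (hle _ (hAs n x hx)) (Submodule.smul_mem _ _ (hle _ hx))
  have hWker : (⨆ n, U n) ≤ LinearMap.ker (E 0) := by
    refine iSup_le fun n x hx => ?_
    cases n with
    | zero => rw [hU0 x hx]; exact zero_mem _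
    | succ n => exact hx.2 0 (Nat.zero_le d) (Nat.succ_pos n)
  have hvW : v ∈ ⨆ n, U n := by
    refine hle 1 ⟨fun j hj hj1 => ?_, fun j hj hj1 => ?_⟩
    · rw [← hEsv]
      exact h.dual.e_apply_of_ne hj (Nat.zero_le d) (by omega) v
    · rw [show j = 0 by omega, hEv]
  rcases irr _ hWA hWAs with hW | hW
  · rw [hW] at hvW
    exact hv (by simpa using hvW)
  · rw [hW, top_le_iff, LinearMap.ker_eq_top] at hWker
    exact hE hWker

theorem e_ne_zero (h : TDRel d θ θs A As E Es)
    (irr : ∀ W : Submodule F V, (∀ w ∈ W, A w ∈ W) → (∀ w ∈ W, As w ∈ W) → W = ⊥ ∨ W = ⊤)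
    (hE0 : E 0 ≠ 0) (hEd : E d ≠ 0) {i : ℕ} (hi : i ≤ d) : E i ≠ 0 := by
  intro hEi
  let W : Submodule F V :=
    { carrier := {x | ∀ j ≤ d, i < j → E j x = 0}
      add_mem' := fun {x y} hx hy j hj hn => by rw [map_add, hx j hj hn, hy j hj hn, add_zero]
      zero_mem' := fun j _ _ => map_zero _
      smul_mem' := fun c x hx j hj hn => by rw [map_smul, hx j hj hn, smul_zero] }
  have hWA : ∀ w ∈ W, A w ∈ W := by
    intro w hw j hj hij
    rw [h.e_apply_a hj, hw j hj hij, smul_zero]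
  have hWAs : ∀ w ∈ W, As w ∈ W := by
    intro w hw j hj hij
    refine h.dual.es_apply_a_eq_zero hj fun l hl hne => ?_
    by_contra hcon
    rcases eq_or_ne l i with rfl | hli
    · exact hne (by rw [hEi, LinearMap.zero_apply])
    · exact hne (hw l hl (by omega))
  have hi0 : i ≠ 0 := fun h0 => hE0 (h0 ▸ hEi)
  have hid : i ≠ d := fun h0 => hEd (h0 ▸ hEi)
  rcases irr W hWA hWAs with hW | hW
  · refine hE0 (LinearMap.ext fun x => ?_)
    have : E 0 x ∈ W := fun j hj hij => h.e_apply_of_ne hj (Nat.zero_le d) (by omega) x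
    rw [hW] at this
    simpa using this
  · refine hEd (LinearMap.ext fun x => ?_)
    have : x ∈ W := hW ▸ Submodule.mem_top
    exact this d le_rfl (by omega)

theorem es_last_ne_zero (h : TDRel d θ θs A As E Es)
    (irr : ∀ W : Submodule F V, (∀ w ∈ W, A w ∈ W) → (∀ w ∈ W, As w ∈ W) → W = ⊥ ∨ W = ⊤)
    (hE0 : E 0 ≠ 0) (hEd : E d ≠ 0) (hEs0 : Es 0 ≠ 0) : Es d ≠ 0 := by
  intro hEsd
  obtain ⟨x, hx⟩ := DFunLike.ne_iff.1 hEs0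
  have irr' : ∀ W : Submodule F V, (∀ w ∈ W, As w ∈ W) → (∀ w ∈ W, A w ∈ W) → W = ⊥ ∨ W = ⊤ :=
    fun W h1 h2 => irr W h2 h1
  have hEdx : E d (Es 0 x) ≠ 0 :=
    h.reverse.e_zero_apply_ne_zero irr hEd hx (h.dual.e_apply_self (Nat.zero_le d) x)
  have hEsEdx : Es 0 (E d (Es 0 x)) ≠ 0 :=
    h.reverse.dual.e_zero_apply_ne_zero irr' hEs0 hEdx (h.e_apply_self le_rfl _)
  have hne : E 0 (Es 0 (E d (Es 0 x))) ≠ 0 :=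
    h.e_zero_apply_ne_zero irr hE0 hEsEdx (h.dual.e_apply_self (Nat.zero_le d) _)
  have hd0 : d ≠ 0 := fun h0 => hEs0 (h0 ▸ hEsd)
  set q : F[X] := ∏ j ∈ Finset.Ico 1 d, (X - C (θs j)) with hq
  have hdeg : q.natDegree = d - 1 := by
    rw [hq, natDegree_prod_of_monic _ _ fun j _ => monic_X_sub_C (θs j)]
    simp
  have h1 := h.dual.tri_aeval (i := 0) (j := d) (Nat.zero_le d) le_rfl q (by omega)
  have h2 : aeval As q = q.eval (θs 0) • Es 0 := by
    rw [h.dual.aeval_eq_sum, Finset.sum_eq_single_of_mem 0 (by simp)]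
    intro j hj hj0
    rw [Finset.mem_range] at hj
    rcases eq_or_ne j d with rfl | hjd
    · rw [hEsd, smul_zero]
    · rw [hq, eval_prod, Finset.prod_eq_zero (Finset.mem_Ico.2 (by omega : 1 ≤ j ∧ j < d)) (by simp),
        zero_smul]
  have hq0 : q.eval (θs 0) ≠ 0 := by
    rw [hq, eval_prod]
    refine Finset.prod_ne_zero_iff.2 fun j hj => ?_
    rw [Finset.mem_Ico] at hj
    simpa [sub_eq_zero] using h.injs 0 j (by omega) (by omega) (by omega)
  rw [h2, mul_smul_comm, smul_mul_assoc] at h1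
  have h3 := (smul_eq_zero.1 h1).resolve_left hq0
  have h4 := congrArg (fun f : Module.End F V => f (Es 0 x)) h3
  exact hne (by simpa using h4)

end Irreducible

end TDRel

section Systems

variable {F V : Type*} [Field F] [AddCommGroup V] [Module F V] {d : ℕ} {θ θs ζ : ℕ → F}
  {A As : V →ₗ[F] V} {E Es : ℕ → V →ₗ[F] V}

theorem mul_pow_mul_eq_zero_of_map_range_le {B : Module.End F V} {P : ℕ → Module.End F V}
    (horth : ∀ i j, i ≤ d → j ≤ d → P i * P j = if i = j then P i else 0)
    (hsum : ∑ i ∈ Finset.range (d + 1), P i = 1)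
    (hr : ∀ i, i ≤ d → Submodule.map B (LinearMap.range (P i)) ≤
      (if i = 0 then ⊥ else LinearMap.range (P (i - 1))) ⊔ LinearMap.range (P i) ⊔
        (if i = d then ⊥ else LinearMap.range (P (i + 1))))
    {i j k : ℕ} (hi : i ≤ d) (hj : j ≤ d) (hk : k + i < j ∨ k + j < i) :
    P i * B ^ k * P j = 0 := by
  have hrange : ∀ l m, l ≤ d → m ≤ d → l ≠ m → LinearMap.range (P m) ≤ LinearMap.ker (P l) := by
    rintro l m hl hm hlm _ ⟨x, rfl⟩
    have := horth l m hl hm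
    rw [if_neg hlm] at this
    exact congrArg (fun f : Module.End F V => f x) this
  have hone : ∀ l m, l ≤ d → m ≤ d → (l + 1 < m ∨ m + 1 < l) → P l * B * P m = 0 := by
    intro l m hl hm hlm
    refine LinearMap.ext fun x => ?_
    have hx := hr m hm (Submodule.mem_map_of_mem (LinearMap.mem_range_self (P m) x))
    refine (sup_le (sup_le ?_ (hrange l m hl hm (by omega))) ?_ : _ ≤ LinearMap.ker (P l)) hx
    · split_ifs with h0
      · exact bot_le
      · exact hrange l (m - 1) hl (by omega) (by omega)
    · split_ifs with h0
      · exact bot_le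
      · exact hrange l (m + 1) hl (by omega) (by omega)
  induction k generalizing i with
  | zero => rw [pow_zero, mul_one, horth i j hi hj, if_neg (by omega)]
  | succ k ih =>
    have hsplit : P i * B ^ (k + 1) * P j = P i * B * 1 * (B ^ k * P j) := by
      simp [pow_succ', mul_assoc]
    rw [hsplit, ← hsum, Finset.mul_sum, Finset.sum_mul]
    refine Finset.sum_eq_zero fun l hl => ?_
    rw [Finset.mem_range, Nat.lt_succ_iff] at hl
    by_cases hlj : k + l < j ∨ k + j < l
    · rw [mul_assoc _ (P l), ← mul_assoc (P l), ih hl hlj, mul_zero]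
    · rw [hone i l hi hl (by omega), zero_mul]

theorem TDRel.map_range_le (h : TDRel (R := Module.End F V) d θ θs A As E Es) {i : ℕ}
    (hi : i ≤ d) : Submodule.map A (LinearMap.range (Es i)) ≤
      (if i = 0 then ⊥ else LinearMap.range (Es (i - 1))) ⊔ LinearMap.range (Es i) ⊔
        (if i = d then ⊥ else LinearMap.range (Es (i + 1))) := by
  rintro _ ⟨_, ⟨x, rfl⟩, rfl⟩
  rw [← h.dual.sum_apply (A (Es i x))]
  refine sum_mem fun l hl => ?_
  rw [Finset.mem_range, Nat.lt_succ_iff] at hl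
  by_cases hli : l + 1 < i ∨ i + 1 < l
  · rw [h.es_apply_a_eq_zero hl fun m hm hne => ?_]
    · exact zero_mem _
    · by_contra hcon
      exact hne (h.dual.e_apply_of_ne hm hi (by omega) x)
  · have hmem := LinearMap.mem_range_self (Es l) (A (Es i x))
    rcases lt_trichotomy l i with hlt | rfl | hlt
    · obtain rfl : l = i - 1 := by omega
      rw [if_neg (by omega)]
      exact Submodule.mem_sup_left (Submodule.mem_sup_left hmem)
    · exact Submodule.mem_sup_left (Submodule.mem_sup_right hmem)
    · obtain rfl : l = i + 1 := by omega
      rw [if_neg (by omega : ¬i = d)]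
      exact Submodule.mem_sup_right hmem

theorem IsTDSystem.tdRel (hS : IsTDSystem F V d A As E Es θ θs) :
    TDRel (R := Module.End F V) d θ θs A As E Es := by
  obtain ⟨-, -, hθ, hθs, -, -, ho, hos, hs, hss, hA, hAs, hrs, hr, -⟩ := hS
  exact
    { inj := hθ
      injs := hθs
      orth := ho
      orths := hos
      sum := hs
      sums := hss
      a_eq := hA
      as_eq := hAs
      tri := fun i j k hi hj hk => mul_pow_mul_eq_zero_of_map_range_le hos hss hr hi hj hk
      tris := fun i j k hi hj hk => mul_pow_mul_eq_zero_of_map_range_le ho hs hrs hi hj hk }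

theorem SharpTDWithArray.conditions (hS : SharpTDWithArray F V d A As E Es θ θs ζ) :
    EigCond F d θ θs ∧ ZetaCond F d θ θs ζ := by
  obtain ⟨hTD, -, hz⟩ := hS
  have h := hTD.tdRel
  obtain ⟨-, -, -, -, hE, hEs, -, -, -, -, -, -, -, -, irr⟩ := hTD
  have irr' : ∀ W : Submodule F V, (∀ w ∈ W, As w ∈ W) → (∀ w ∈ W, A w ∈ W) → W = ⊥ ∨ W = ⊤ :=
    fun W h1 h2 => irr W h2 h1
  have hz' : ∀ i ≤ d, (Es 0 : Module.End F V) * aeval (A : Module.End F V) (tauPoly θ i) * Es 0 =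
      (ζ i / ∏ j ∈ Finset.Icc 1 i, (θs 0 - θs j)) • Es 0 := hz
  have hEs0 := hEs 0 (Nat.zero_le d)
  obtain ⟨x, hx⟩ := DFunLike.ne_iff.1 hEs0
  have hEsx : Es 0 (Es 0 x) = Es 0 x := h.dual.e_apply_self (Nat.zero_le d) x
  have hEdx : E d (Es 0 x) ≠ 0 := h.reverse.e_zero_apply_ne_zero irr (hE d le_rfl) hx hEsx
  have hE0x : E 0 (Es 0 x) ≠ 0 := h.e_zero_apply_ne_zero irr (hE 0 (Nat.zero_le d)) hx hEsx
  have h1 : Es d (E d (Es 0 x)) ≠ 0 :=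
    h.reverse.dual.reverse.e_zero_apply_ne_zero irr' (hEs d le_rfl) hEdx (h.e_apply_self le_rfl _)
  have h2 : Es 0 (E d (Es 0 x)) ≠ 0 :=
    h.reverse.dual.e_zero_apply_ne_zero irr' hEs0 hEdx (h.e_apply_self le_rfl _)
  have h3 : Es 0 (E 0 (Es 0 x)) ≠ 0 :=
    h.dual.e_zero_apply_ne_zero irr' hEs0 hE0x (h.e_apply_self (Nat.zero_le d) _)
  refine ⟨h.eigCond fun h0 => h1 (congrArg (fun f : Module.End F V => f x) h0), ?_, ?_, ?_⟩
  · have h0 := congrArg (fun f : Module.End F V => f x) (hz' 0 (Nat.zero_le d))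
    simp only [tauPoly, Finset.range_zero, Finset.prod_empty, map_one, mul_one,
      h.dual.e_mul_self (Nat.zero_le d)] at h0
    have h5 : (ζ 0 - 1) • Es 0 x = 0 := by
      rw [sub_smul, one_smul, sub_eq_zero]
      simpa using h0.symm
    exact sub_eq_zero.1 ((smul_eq_zero.1 h5).resolve_right hx)
  · intro h0
    have h5 := h.smul_es_mul_e_last_mul_es hz'
    rw [h0, zero_div, zero_smul] at h5
    have h6 := (smul_eq_zero.1 h5).resolve_left h.eval_tauPoly_ne_zero
    exact h2 (congrArg (fun f : Module.End F V => f x) h6)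
  · intro h0
    have h5 := h.smul_es_mul_e_zero_mul_es hz'
    rw [h0, zero_smul] at h5
    have h6 := (smul_eq_zero.1 h5).resolve_left
      (mul_ne_zero (eval_etaPoly_zero_ne_zero h.injs) (eval_etaPoly_zero_ne_zero h.inj))
    exact h3 (congrArg (fun f : Module.End F V => f x) h6)

end Systems

theorem TDRel.exists_lift {F R : Type*} [Field F] [Ring R] [Algebra F R] {d : ℕ} {θ θs : ℕ → F}
    {a as : R} {e es : ℕ → R} (h : TDRel d θ θs a as e es) :
    ∃ ρ : TAlg F d θ θs →ₐ[F] R, ρ (aT F d θ θs) = a ∧ ρ (asT F d θ θs) = as ∧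
      ∀ i ≤ d, ρ (eT F d θ θs i) = e i ∧ ρ (esT F d θ θs i) = es i := by
  let g : TGen d → R := fun x => match x with
    | TGen.a => a
    | TGen.astar => as
    | TGen.e i => e i
    | TGen.estar i => es i
  have hrel : ∀ ⦃x y : FreeAlgebra F (TGen d)⦄, TRel F d θ θs x y →
      FreeAlgebra.lift F g x = FreeAlgebra.lift F g y := by
    intro x y hxy
    cases hxy with
    | ee i j =>
      have := h.orth i j (by omega) (by omega)
      by_cases hij : i = j
      · subst hij
        simpa [g] using this
      · rw [if_neg (by omega)] at this
        simpa [g, hij] using this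
    | eses i j =>
      have := h.orths i j (by omega) (by omega)
      by_cases hij : i = j
      · subst hij
        simpa [g] using this
      · rw [if_neg (by omega)] at this
        simpa [g, hij] using this
    | sum_e => simpa [g, Finset.sum_range] using h.sum
    | sum_estar => simpa [g, Finset.sum_range] using h.sums
    | a_eq => simpa [g, Finset.sum_range] using h.a_eq
    | astar_eq => simpa [g, Finset.sum_range] using h.as_eq
    | trid i j k hk hlt => simpa [g] using h.tri i j k (by omega) (by omega) (by omega)
    | tridstar i j k hk hlt => simpa [g] using h.tris i j k (by omega) (by omega) (by omega)
  have hgen : ∀ x, RingQuot.liftAlgHom F ⟨FreeAlgebra.lift F g, hrel⟩ (tgen F d θ θs x) = g x := by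
    intro x
    rw [tgen, RingQuot.liftAlgHom_mkAlgHom_apply, FreeAlgebra.lift_ι_apply]
  refine ⟨RingQuot.liftAlgHom F ⟨FreeAlgebra.lift F g, hrel⟩, hgen _, hgen _, fun i hi => ⟨?_, ?_⟩⟩
  · rw [eT_of_le (Nat.lt_succ_of_le hi), hgen]
  · rw [esT_of_le (Nat.lt_succ_of_le hi), hgen]

/-- The left ideal of elements whose left multiples all have zero corner value under `f`. -/
def cornerKer {F R : Type*} [Field F] [Ring R] [Algebra F R] (s : R) (f : R →ₗ[F] F) :
    Submodule R R where
  carrier := {y | ∀ t, f (s * (t * y) * s) = 0}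
  add_mem' {x y} hx hy t := by rw [mul_add, mul_add, add_mul, map_add, hx t, hy t, add_zero]
  zero_mem' t := by simp
  smul_mem' c y hy t := by rw [smul_eq_mul, ← mul_assoc t]; exact hy (t * c)

namespace TDRel

section Existence

variable {F R : Type*} [Field F] [Ring R] [Algebra F R] {d : ℕ} {θ θs ζ : ℕ → F}
  {a as : R} {e es : ℕ → R} {f : R →ₗ[F] F}

theorem smul_mk_cornerKer {s : R} (hs : s * s = s)
    (hmul : ∀ x y, f (s * x * s * (s * y * s)) = f (s * x * s) * f (s * y * s)) (hf : f s = 1)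
    (y : R) :
    s • (cornerKer s f).mkQ y = f (s * y * s) • (cornerKer s f).mkQ s := by
  have h1 : s * y - f (s * y * s) • s ∈ cornerKer s f := by
    intro t
    have h2 : s * (t * (s * y - f (s * y * s) • s)) * s =
        s * t * s * (s * y * s) - f (s * y * s) • (s * t * s * (s * 1 * s)) := by
      simp only [mul_sub, sub_mul, mul_smul_comm, smul_mul_assoc, mul_one, mul_assoc]
      simp only [← mul_assoc s s, hs]
    rw [h2, map_sub, map_smul, hmul, hmul, mul_one, hs, hf]
    simp [mul_comm]
  rw [← sub_eq_zero, ← map_smul, ← LinearMap.map_smul_of_tower, ← map_sub]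
  exact (Submodule.Quotient.mk_eq_zero _).2 h1

theorem mkQ_cornerKer_mul {s : R} (hs : s * s = s) (y : R) :
    (cornerKer s f).mkQ (y * s) = (cornerKer s f).mkQ y := by
  rw [← sub_eq_zero, ← map_sub]
  refine (Submodule.Quotient.mk_eq_zero _).2 fun t => ?_
  rw [mul_assoc, mul_assoc, sub_mul, mul_assoc y, hs, sub_self, mul_zero, mul_zero, map_zero]

theorem mkQ_cornerKer_ne_zero {s : R} (hs : s * s = s) (hf : f s = 1) :
    (cornerKer s f).mkQ s ≠ 0 := by
  intro h0
  have := (Submodule.Quotient.mk_eq_zero _).1 h0 1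
  rw [one_mul, hs, hs, hf] at this
  exact one_ne_zero this

theorem mul_smul_mem (h : TDRel d θ θs a as e es)
    (hgen : ∀ N : Submodule F R, (∀ i ≤ d, ∀ y ∈ N, e i * y ∈ N) →
      (∀ i ≤ d, ∀ y ∈ N, es i * y ∈ N) → ∀ x, ∀ y ∈ N, x * y ∈ N)
    {M : Type*} [AddCommGroup M] [Module F M] (ρ : R →ₐ[F] Module.End F M) (W : Submodule F M)
    (ha : ∀ w ∈ W, ρ a w ∈ W) (has : ∀ w ∈ W, ρ as w ∈ W) (x : R) {w : M} (hw : w ∈ W) :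
    ρ x w ∈ W := by
  have hpoly : ∀ b : R, (∀ w ∈ W, ρ b w ∈ W) → ∀ p : F[X], ∀ w ∈ W, ρ (aeval b p) w ∈ W := by
    intro b hb p
    induction p using Polynomial.induction_on' with
    | add p q hp hq =>
      intro w hw
      rw [map_add, map_add]
      exact add_mem (hp w hw) (hq w hw)
    | monomial n c =>
      intro w hw
      rw [aeval_monomial, ← Algebra.smul_def, map_smul]
      refine W.smul_mem c ?_
      induction n with
      | zero => simpa using hw
      | succ n ih =>
        rw [pow_succ', map_mul]
        exact hb _ ih
  let N : Submodule F R := W.comap ((LinearMap.applyₗ w).comp ρ.toLinearMap)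
  have hN : ∀ y, y ∈ N ↔ ρ y w ∈ W := fun y => Iff.rfl
  have hx : x * 1 ∈ N := by
    refine hgen N ?_ ?_ x 1 ?_
    · intro i hi y hy
      obtain ⟨p, hp⟩ := h.exists_aeval_eq hi
      rw [hN, ← hp, map_mul]
      exact hpoly a ha p _ hy
    · intro i hi y hy
      obtain ⟨p, hp⟩ := h.dual.exists_aeval_eq hi
      rw [hN, ← hp, map_mul]
      exact hpoly as has p _ hy
    · rw [hN, map_one]
      exact hw
  rwa [mul_one] at hx

theorem finiteDimensional_quotient_cornerKer (h : TDRel d θ θs a as e es)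
    (hgen : ∀ N : Submodule F R, (∀ i ≤ d, ∀ y ∈ N, e i * y ∈ N) →
      (∀ i ≤ d, ∀ y ∈ N, es i * y ∈ N) → ∀ x, ∀ y ∈ N, x * y ∈ N)
    (hmul : ∀ x y, f (es 0 * x * es 0 * (es 0 * y * es 0)) =
      f (es 0 * x * es 0) * f (es 0 * y * es 0)) (hf : f (es 0) = 1) :
    FiniteDimensional F (R ⧸ cornerKer (es 0) f) := by
  have h00 : es 0 * es 0 = es 0 := h.dual.e_mul_self (Nat.zero_le d)
  set L := cornerKer (es 0) f with hL
  set ρ : R →ₐ[F] Module.End F (R ⧸ L) := Algebra.lsmul F F (R ⧸ L) with hρ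
  have hρmk : ∀ x y : R, ρ x (L.mkQ y) = L.mkQ (x * y) := fun x y => rfl
  have hfin : ∀ i ≤ d, FiniteDimensional F (LinearMap.range (ρ (es i))) := by
    intro i
    induction i using Nat.strong_induction_on with
    | _ i ih =>
      intro hi
      rcases Nat.eq_zero_or_pos i with rfl | hi0
      · refine Submodule.finiteDimensional_of_le
          (S₂ := Submodule.span F {L.mkQ (es 0)}) ?_
        rintro _ ⟨x, rfl⟩
        obtain ⟨y, rfl⟩ := L.mkQ_surjective x
        have := smul_mk_cornerKer h00 hmul hf y
        exact Submodule.mem_span_singleton.2 ⟨_, this.symm⟩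
      · have hfinj : ∀ p : Fin i × Fin (d + 1), FiniteDimensional F
            ((LinearMap.range (ρ (es p.1))).map (ρ (es i * e p.2))) := by
          intro p
          have := ih p.1 p.1.2 (by omega)
          infer_instance
        let S : Submodule F (R ⧸ L) := ⨆ p : Fin i × Fin (d + 1),
          (LinearMap.range (ρ (es p.1))).map (ρ (es i * e p.2))
        refine Submodule.finiteDimensional_of_le (S₂ := S) ?_
        rintro _ ⟨x, rfl⟩
        obtain ⟨y, rfl⟩ := L.mkQ_surjective x
        rw [hρmk, ← mkQ_cornerKer_mul h00]
        have hle : Submodule.span F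
            {w | ∃ j < i, ∃ s ≤ d, ∃ y, w = es i * e s * (es j * y * es 0)} ≤
            S.comap (L.mkQ.restrictScalars F) := by
          refine Submodule.span_le.2 ?_
          rintro _ ⟨j, hj, s, hs, y, rfl⟩
          refine Submodule.mem_iSup_of_mem (⟨j, hj⟩, ⟨s, by omega⟩) ?_
          refine ⟨L.mkQ (es j * y * es 0), ⟨L.mkQ (y * es 0), ?_⟩, rfl⟩
          rw [hρmk, mul_assoc]
        exact hle (h.mul_es_zero_mem_span_lt hgen hi0 hi y)
  have htop : ⨆ i : Fin (d + 1), LinearMap.range (ρ (es i)) = ⊤ := by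
    refine eq_top_iff.2 fun x _ => ?_
    have hx : x = ∑ i ∈ Finset.range (d + 1), ρ (es i) x := by
      rw [← LinearMap.sum_apply, ← map_sum, h.sums, map_one, Module.End.one_apply]
    rw [hx]
    exact sum_mem fun i hi => Submodule.mem_iSup_of_mem (⟨i, Finset.mem_range.1 hi⟩ : Fin (d + 1))
      (LinearMap.mem_range_self _ x)
  have hfini : ∀ i : Fin (d + 1), FiniteDimensional F (LinearMap.range (ρ (es i))) :=
    fun i => hfin i (by omega)
  have hfintop : FiniteDimensional F (⊤ : Submodule F (R ⧸ L)) := htop ▸ inferInstance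
  exact Module.Finite.equiv Submodule.topEquiv

theorem irreducible_quotient_cornerKer (h : TDRel d θ θs a as e es)
    (hgen : ∀ N : Submodule F R, (∀ i ≤ d, ∀ y ∈ N, e i * y ∈ N) →
      (∀ i ≤ d, ∀ y ∈ N, es i * y ∈ N) → ∀ x, ∀ y ∈ N, x * y ∈ N)
    (hmul : ∀ x y, f (es 0 * x * es 0 * (es 0 * y * es 0)) =
      f (es 0 * x * es 0) * f (es 0 * y * es 0)) (hf : f (es 0) = 1)
    (W : Submodule F (R ⧸ cornerKer (es 0) f)) (ha : ∀ w ∈ W, a • w ∈ W)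
    (has : ∀ w ∈ W, as • w ∈ W) : W = ⊥ ∨ W = ⊤ := by
  have h00 : es 0 * es 0 = es 0 := h.dual.e_mul_self (Nat.zero_le d)
  have hW : ∀ x : R, ∀ w ∈ W, x • w ∈ W := fun x w hw =>
    h.mul_smul_mem hgen (Algebra.lsmul F F _) W ha has x hw
  refine or_iff_not_imp_left.2 fun hbot => ?_
  obtain ⟨w, hw, hw0⟩ := W.ne_bot_iff.1 hbot
  obtain ⟨y, rfl⟩ := (cornerKer (es 0) f).mkQ_surjective w
  have hy : y ∉ cornerKer (es 0) f := fun hy => hw0 ((Submodule.Quotient.mk_eq_zero _).2 hy)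
  obtain ⟨t, ht⟩ : ∃ t, f (es 0 * (t * y) * es 0) ≠ 0 := by
    by_contra! hcon
    exact hy hcon
  have h1 : es 0 • (cornerKer (es 0) f).mkQ (t * y) ∈ W := hW _ _ (hW t _ hw)
  rw [smul_mk_cornerKer h00 hmul hf] at h1
  have h2 : (cornerKer (es 0) f).mkQ (es 0) ∈ W := (W.smul_mem_iff ht).1 h1
  have h3 : (cornerKer (es 0) f).mkQ (1 * es 0) ∈ W := by rwa [one_mul]
  rw [mkQ_cornerKer_mul h00] at h3
  refine eq_top_iff.2 fun x _ => ?_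
  obtain ⟨x, rfl⟩ := (cornerKer (es 0) f).mkQ_surjective x
  have := hW x _ h3
  rwa [← map_smul, smul_eq_mul, mul_one] at this

theorem sharpTDWithArray_quotient_cornerKer (h : TDRel d θ θs a as e es)
    (hgen : ∀ N : Submodule F R, (∀ i ≤ d, ∀ y ∈ N, e i * y ∈ N) →
      (∀ i ≤ d, ∀ y ∈ N, es i * y ∈ N) → ∀ x, ∀ y ∈ N, x * y ∈ N)
    (hmul : ∀ x y, f (es 0 * x * es 0 * (es 0 * y * es 0)) =
      f (es 0 * x * es 0) * f (es 0 * y * es 0)) (hf : f (es 0) = 1)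
    (hz : ∀ i ≤ d, f (es 0 * aeval a (tauPoly θ i) * es 0) =
      ζ i / ∏ j ∈ Finset.Icc 1 i, (θs 0 - θs j)) (hζ : ZetaCond F d θ θs ζ) :
    SharpTDWithArray F (R ⧸ cornerKer (es 0) f) d (Algebra.lsmul F F _ a) (Algebra.lsmul F F _ as)
      (fun i => Algebra.lsmul F F _ (e i)) (fun i => Algebra.lsmul F F _ (es i)) θ θs ζ := by
  have h00 : es 0 * es 0 = es 0 := h.dual.e_mul_self (Nat.zero_le d)
  have hfin := h.finiteDimensional_quotient_cornerKer hgen hmul hf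
  have irr := h.irreducible_quotient_cornerKer hgen hmul hf
  set L := cornerKer (es 0) f with hL
  set ρ : R →ₐ[F] Module.End F (R ⧸ L) := Algebra.lsmul F F (R ⧸ L) with hρ
  have hρmk : ∀ x y : R, ρ x (L.mkQ y) = L.mkQ (x * y) := fun x y => rfl
  have hs0 : L.mkQ (es 0) ≠ 0 := mkQ_cornerKer_ne_zero h00 hf
  have hρs : ∀ y, ρ (es 0) (L.mkQ y) = f (es 0 * y * es 0) • L.mkQ (es 0) :=
    smul_mk_cornerKer h00 hmul hf
  have hT := h.map ρ
  have hzρ : ∀ i ≤ d, ρ (es 0) * aeval (ρ a) (tauPoly θ i) * ρ (es 0) =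
      (ζ i / ∏ j ∈ Finset.Icc 1 i, (θs 0 - θs j)) • ρ (es 0) := by
    intro i hi
    rw [aeval_algHom_apply, ← map_mul, ← map_mul]
    refine LinearMap.ext fun x => ?_
    obtain ⟨y, rfl⟩ := L.mkQ_surjective x
    have h1 := hρs (aeval a (tauPoly θ i) * es 0 * y)
    rw [hρmk] at h1
    rw [LinearMap.smul_apply, hρmk, hρs, smul_smul, ← hz i hi, ← hmul, mul_assoc, mul_assoc,
      ← mul_assoc _ (es 0) y, h1]
    congr 2
    simp only [mul_assoc]
    rw [← mul_assoc (es 0) (es 0), h00]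
  have hEs0 : ρ (es 0) ≠ 0 := by
    intro h0
    apply hs0
    rw [← mul_one (es 0), ← hρmk, h0, LinearMap.zero_apply]
  have hEd : ρ (e d) ≠ 0 := by
    intro h0
    have h1 := hT.smul_es_mul_e_last_mul_es hzρ
    rw [h0, mul_zero, zero_mul, smul_zero] at h1
    exact smul_ne_zero (div_ne_zero hζ.2.1 (h.prod_sub_ne_zero le_rfl)) hEs0 h1.symm
  have hE0 : ρ (e 0) ≠ 0 := by
    intro h0
    have h1 := hT.smul_es_mul_e_zero_mul_es hzρ
    rw [h0, mul_zero, zero_mul, smul_zero] at h1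
    exact smul_ne_zero hζ.2.2 hEs0 h1.symm
  have hEsd := hT.es_last_ne_zero irr hE0 hEd hEs0
  have irr' : ∀ W : Submodule F (R ⧸ L), (∀ w ∈ W, ρ as w ∈ W) → (∀ w ∈ W, ρ a w ∈ W) →
      W = ⊥ ∨ W = ⊤ := fun W h1 h2 => irr W h2 h1
  have : Nontrivial (R ⧸ L) := ⟨_, _, hs0⟩
  refine ⟨⟨hfin, Module.finrank_pos, h.inj, h.injs, fun i hi => hT.e_ne_zero irr hE0 hEd hi,
    fun i hi => hT.dual.e_ne_zero irr' hEs0 hEsd hi, hT.orth, hT.orths, hT.sum, hT.sums,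
    hT.a_eq, hT.as_eq, fun i hi => hT.dual.map_range_le hi, fun i hi => hT.map_range_le hi, irr⟩,
    ?_, hzρ⟩
  have hrange : LinearMap.range (ρ (es 0)) = Submodule.span F {L.mkQ (es 0)} := by
    refine le_antisymm ?_ ?_
    · rintro _ ⟨x, rfl⟩
      obtain ⟨y, rfl⟩ := L.mkQ_surjective x
      exact Submodule.mem_span_singleton.2 ⟨_, (hρs y).symm⟩
    · rw [Submodule.span_singleton_le_iff_mem]
      exact ⟨L.mkQ 1, by rw [hρmk, mul_one]⟩
  change Module.finrank F (LinearMap.range (ρ (es 0))) = 1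
  rw [hrange]
  exact finrank_span_singleton hs0

end Existence

end TDRel

section Uniqueness

variable {F R V V' : Type*} [Field F] [Ring R] [Algebra F R] [AddCommGroup V] [Module F V]
  [AddCommGroup V'] [Module F V'] {d : ℕ} {θ θs c : ℕ → F} {a as : R} {e es : ℕ → R}
  {ρ : R →ₐ[F] Module.End F V} {ρ' : R →ₐ[F] Module.End F V'}

theorem exists_algHom_apply_eq
    (irr : ∀ W : Submodule F V, (∀ w ∈ W, ρ a w ∈ W) → (∀ w ∈ W, ρ as w ∈ W) → W = ⊥ ∨ W = ⊤)
    {v : V} (hv : v ≠ 0) (u : V) : ∃ x, ρ x v = u := by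
  have hinv : ∀ b, ∀ w ∈ LinearMap.range ((LinearMap.applyₗ v).comp ρ.toLinearMap),
      ρ b w ∈ LinearMap.range ((LinearMap.applyₗ v).comp ρ.toLinearMap) := by
    rintro b _ ⟨x, rfl⟩
    exact ⟨b * x, by simp⟩
  have hmem : v ∈ LinearMap.range ((LinearMap.applyₗ v).comp ρ.toLinearMap) := ⟨1, by simp⟩
  rcases irr _ (hinv a) (hinv as) with hW | hW
  · rw [hW] at hmem
    exact absurd (by simpa using hmem) hv
  · obtain ⟨x, hx⟩ := hW.symm ▸ (Submodule.mem_top : u ∈ (⊤ : Submodule F V))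
    exact ⟨x, by simpa using hx⟩

namespace TDRel

theorem apply_eq_zero_of_apply_eq_zero (h : TDRel d θ θs a as e es)
    (hgen : ∀ N : Submodule F R, (∀ i ≤ d, ∀ y ∈ N, e i * y ∈ N) →
      (∀ i ≤ d, ∀ y ∈ N, es i * y ∈ N) → ∀ x, ∀ y ∈ N, x * y ∈ N)
    (irr : ∀ W : Submodule F V', (∀ w ∈ W, ρ' a w ∈ W) → (∀ w ∈ W, ρ' as w ∈ W) → W = ⊥ ∨ W = ⊤)
    {v : V} {v' : V'} (hv : v ≠ 0) (hv' : v' ≠ 0) (hes : ρ (es 0) v = v) (hes' : ρ' (es 0) v' = v')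
    (hc : ∀ i ≤ d, ρ (es 0 * aeval a (tauPoly θ i) * es 0) v = c i • v)
    (hc' : ∀ i ≤ d, ρ' (es 0 * aeval a (tauPoly θ i) * es 0) v' = c i • v') {t : R}
    (ht : ρ t v = 0) : ρ' t v' = 0 := by
  let N : Submodule F R :=
    { carrier := {x | ∃ r : F, ρ x v = r • v ∧ ρ' x v' = r • v'}
      add_mem' := by
        rintro x y ⟨r, hr, hr'⟩ ⟨s, hs, hs'⟩
        exact ⟨r + s, by simp [hr, hs, add_smul], by simp [hr', hs', add_smul]⟩
      zero_mem' := ⟨0, by simp, by simp⟩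
      smul_mem' := by
        rintro k x ⟨r, hr, hr'⟩
        exact ⟨k * r, by simp [hr, mul_smul], by simp [hr', mul_smul]⟩ }
  by_contra hne
  obtain ⟨x, hx⟩ := exists_algHom_apply_eq irr hne v'
  obtain ⟨r, hr, hr'⟩ : es 0 * (x * t) * es 0 ∈ N := by
    refine h.corner_mem hgen N ⟨1, by simp [hes], by simp [hes']⟩ ?_ ?_ _
    · rintro x ⟨r, hr, hr'⟩ y ⟨s, hs, hs'⟩
      exact ⟨s * r, by simp [hr, hs, mul_smul], by simp [hr', hs', mul_smul]⟩
    · exact fun i _ hi => ⟨c i, hc i hi, hc' i hi⟩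
  simp only [map_mul, Module.End.mul_apply, hes, hes', ht, hx, map_zero] at hr hr'
  have hr0 : r = 0 := (smul_eq_zero.1 hr.symm).resolve_right hv
  rw [hr0, zero_smul] at hr'
  exact hv' hr'

theorem exists_linearEquiv (h : TDRel d θ θs a as e es)
    (hgen : ∀ N : Submodule F R, (∀ i ≤ d, ∀ y ∈ N, e i * y ∈ N) →
      (∀ i ≤ d, ∀ y ∈ N, es i * y ∈ N) → ∀ x, ∀ y ∈ N, x * y ∈ N)
    (irr : ∀ W : Submodule F V, (∀ w ∈ W, ρ a w ∈ W) → (∀ w ∈ W, ρ as w ∈ W) → W = ⊥ ∨ W = ⊤)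
    (irr' : ∀ W : Submodule F V', (∀ w ∈ W, ρ' a w ∈ W) → (∀ w ∈ W, ρ' as w ∈ W) →
      W = ⊥ ∨ W = ⊤)
    {v : V} {v' : V'} (hv : v ≠ 0) (hv' : v' ≠ 0) (hes : ρ (es 0) v = v) (hes' : ρ' (es 0) v' = v')
    (hc : ∀ i ≤ d, ρ (es 0 * aeval a (tauPoly θ i) * es 0) v = c i • v)
    (hc' : ∀ i ≤ d, ρ' (es 0 * aeval a (tauPoly θ i) * es 0) v' = c i • v') :
    ∃ σ : V ≃ₗ[F] V', ∀ t w, σ (ρ t w) = ρ' t (σ w) := by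
  let g : R →ₗ[F] V := (LinearMap.applyₗ v).comp ρ.toLinearMap
  let g' : R →ₗ[F] V' := (LinearMap.applyₗ v').comp ρ'.toLinearMap
  have hg : Function.Surjective g := exists_algHom_apply_eq irr hv
  have hg' : Function.Surjective g' := exists_algHom_apply_eq irr' hv'
  have hker : LinearMap.ker g = LinearMap.ker g' := by
    ext t
    exact ⟨fun ht => h.apply_eq_zero_of_apply_eq_zero hgen irr' hv hv' hes hes' hc hc' ht,
      fun ht => h.apply_eq_zero_of_apply_eq_zero hgen irr hv' hv hes' hes hc' hc ht⟩
  let σ : V ≃ₗ[F] V' := (g.quotKerEquivOfSurjective hg).symm ≪≫ₗ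
    Submodule.quotEquivOfEq _ _ hker ≪≫ₗ g'.quotKerEquivOfSurjective hg'
  have hσ : ∀ x, σ (g x) = g' x := by
    intro x
    have : (g.quotKerEquivOfSurjective hg).symm (g x) = Submodule.Quotient.mk x := by
      rw [LinearEquiv.symm_apply_eq]
      rfl
    simp only [σ, LinearEquiv.trans_apply, this]
    rfl
  refine ⟨σ, fun t w => ?_⟩
  obtain ⟨x, rfl⟩ := hg w
  have h1 : ρ t (g x) = g (t * x) := by simp [g]
  rw [h1, hσ, hσ]
  simp [g']

end TDRel

end Uniqueness

theorem SharpTDWithArray.exists_representation {F V : Type*} [Field F] [AddCommGroup V]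
    [Module F V] {d : ℕ} {θ θs ζ : ℕ → F} {A As : V →ₗ[F] V} {E Es : ℕ → V →ₗ[F] V}
    (hS : SharpTDWithArray F V d A As E Es θ θs ζ) :
    ∃ ρ : TAlg F d θ θs →ₐ[F] Module.End F V, ρ (aT F d θ θs) = A ∧ ρ (asT F d θ θs) = As ∧
      (∀ i ≤ d, ρ (eT F d θ θs i) = E i ∧ ρ (esT F d θ θs i) = Es i) ∧
      ∃ v ≠ 0, ρ (esT F d θ θs 0) v = v ∧
        ∀ i ≤ d, ρ (esT F d θ θs 0 * aeval (aT F d θ θs) (tauPoly θ i) * esT F d θ θs 0) v =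
          (ζ i / ∏ j ∈ Finset.Icc 1 i, (θs 0 - θs j)) • v := by
  have h := hS.1.tdRel
  obtain ⟨ρ, ha, has, he⟩ := h.exists_lift
  obtain ⟨-, -, -, -, -, hEs, -⟩ := hS.1
  obtain ⟨x, hx⟩ := DFunLike.ne_iff.1 (hEs 0 (Nat.zero_le d))
  have hEsx : Es 0 (Es 0 x) = Es 0 x := h.dual.e_apply_self (Nat.zero_le d) x
  refine ⟨ρ, ha, has, he, Es 0 x, hx, ?_, fun i hi => ?_⟩
  · rw [(he 0 (Nat.zero_le d)).2, hEsx]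
  · rw [map_mul, map_mul, ← aeval_algHom_apply, ha, (he 0 (Nat.zero_le d)).2]
    have := congrArg (fun f : V →ₗ[F] V => f (Es 0 x)) (hS.2.2 i hi)
    simpa [hEsx] using this

theorem SharpTDWithArray.exists_linearEquiv {F V V' : Type*} [Field F] [AddCommGroup V]
    [Module F V] [AddCommGroup V'] [Module F V'] {d : ℕ} {θ θs ζ : ℕ → F}
    {A As : V →ₗ[F] V} {E Es : ℕ → V →ₗ[F] V} {A' As' : V' →ₗ[F] V'} {E' Es' : ℕ → V' →ₗ[F] V'}
    (hS : SharpTDWithArray F V d A As E Es θ θs ζ)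
    (hS' : SharpTDWithArray F V' d A' As' E' Es' θ θs ζ) :
    ∃ σ : V ≃ₗ[F] V',
      (∀ v, σ (A v) = A' (σ v)) ∧ (∀ v, σ (As v) = As' (σ v)) ∧
      (∀ i, i ≤ d → ∀ v, σ (E i v) = E' i (σ v)) ∧
      (∀ i, i ≤ d → ∀ v, σ (Es i v) = Es' i (σ v)) := by
  obtain ⟨ρ, ha, has, he, v, hv, hes, hc⟩ := hS.exists_representation
  obtain ⟨ρ', ha', has', he', v', hv', hes', hc'⟩ := hS'.exists_representation
  obtain ⟨-, -, hθ, hθs, -, -, -, -, -, -, -, -, -, -, irr⟩ := hS.1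
  obtain ⟨-, -, -, -, -, -, -, -, -, -, -, -, -, -, irr'⟩ := hS'.1
  obtain ⟨σ, hσ⟩ := (tdRel_tAlg hθ hθs).exists_linearEquiv (tAlg_mul_mem hθ hθs)
    (by rwa [ha, has]) (by rwa [ha', has']) hv hv' hes hes' hc hc'
  refine ⟨σ, fun w => ?_, fun w => ?_, fun i hi w => ?_, fun i hi w => ?_⟩
  · rw [← ha, hσ, ha']
  · rw [← has, hσ, has']
  · rw [← (he i hi).1, hσ, (he' i hi).1]
  · rw [← (he i hi).2, hσ, (he' i hi).2]

universe u

/-- The `μ`-conjecture implies the classification conjecture: if for all `d, θ, θs`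
satisfying (i), (iii) the map `μ` is an isomorphism, then for all scalars
`(θ; θs; ζ)` there exists a sharp tridiagonal system over `F` with parameter array
`(θ; θs; ζ)` if and only if (i), (ii), (iii) hold; moreover if (i)-(iii) hold then such
a system is unique up to isomorphism of tridiagonal systems. -/
theorem stmt17 {F : Type u} [Field F]
    (hmu : ∀ (d : ℕ) (θ θs : ℕ → F), EigCond F d θ θs →
      ∀ μ : MvPolynomial (Fin d) F →ₗ[F] TAlg F d θ θs, MuProps F d θ θs μ →
        Function.Injective μ)
    (d : ℕ) (θ θs ζ : ℕ → F) :
    ((∃ (V : Type u) (_ : AddCommGroup V) (_ : Module F V)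
        (A As : V →ₗ[F] V) (E Es : ℕ → (V →ₗ[F] V)),
        SharpTDWithArray F V d A As E Es θ θs ζ) ↔
      (EigCond F d θ θs ∧ ZetaCond F d θ θs ζ)) ∧
    (EigCond F d θ θs → ZetaCond F d θ θs ζ →
      ∀ (V : Type u) (_ : AddCommGroup V) (_ : Module F V)
        (V' : Type u) (_ : AddCommGroup V') (_ : Module F V')
        (A As : V →ₗ[F] V) (E Es : ℕ → (V →ₗ[F] V))
        (A' As' : V' →ₗ[F] V') (E' Es' : ℕ → (V' →ₗ[F] V')),
      SharpTDWithArray F V d A As E Es θ θs ζ →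
      SharpTDWithArray F V' d A' As' E' Es' θ θs ζ →
      ∃ σ : V ≃ₗ[F] V',
        (∀ v, σ (A v) = A' (σ v)) ∧ (∀ v, σ (As v) = As' (σ v)) ∧
        (∀ i, i ≤ d → ∀ v, σ (E i v) = E' i (σ v)) ∧
        (∀ i, i ≤ d → ∀ v, σ (Es i v) = Es' i (σ v))) := by
  refine ⟨⟨?_, ?_⟩, ?_⟩
  · rintro ⟨V, _, _, A, As, E, Es, hS⟩
    exact hS.conditions
  · rintro ⟨hθ, hζ⟩
    obtain ⟨f, hf, hmul, hz⟩ := exists_character hθ.1 hθ.2.1 (hmu d θ θs hθ)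
      (fun i => ζ i / ∏ j ∈ Finset.Icc 1 i, (θs 0 - θs j)) (by simp [hζ.1])
    exact ⟨_, _, _, _, _, _, _, (tdRel_tAlg hθ.1 hθ.2.1).sharpTDWithArray_quotient_cornerKer
      (tAlg_mul_mem hθ.1 hθ.2.1) hmul hf hz hζ⟩
  · intro _ _ V _ _ V' _ _ A As E Es A' As' E' Es' hS hS'
    exact hS.exists_linearEquiv hS'
end
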